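/- Let τ ∈ ℍ and m₀, m₁, m₂, m₃ ∈ ℤ_{≥0} with Σ m_k ≥ 1. The curvature equation Δu + e^u = 8π Σ_{k=0}^{3} m_k δ_{ω_k/2} on E_τ has a solution if and only if there exist T₁, T₂, T₃, E ∈ ℂ such that the linear ODE y″(z) = q(z)·y(z), where q(z) = Σ_{k=0}^{3} m_k(m_k+1)·℘(z − ω_k/2|τ) + Σ_{j=1}^{3} T_j·(ζ(z − ω_j/2|τ) − ζ(z|τ)) − E, is apparent at every lattice translate of each point ω_k/2 with m_k ≥ 1 and has unitary monodromy. Moreover, in that case the solution u admits a type II developing map. -/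

import Mathlib

open Metric Set Filter Topology

noncomputable section

/-- The lattice `Λ_τ = ℤ + τℤ` as a set of complex numbers. -/
def lat (τ : ℂ) : Set ℂ := {z | ∃ m n : ℤ, z = (m : ℂ) + (n : ℂ) * τ}

/-- The lattice point `m + nτ` attached to a pair of integers. -/
def latPt (τ : ℂ) (p : ℤ × ℤ) : ℂ := (p.1 : ℂ) + (p.2 : ℂ) * τ

/-- The Weierstrass elliptic function `℘(z|τ)`. -/
def wp (τ z : ℂ) : ℂ :=
  1 / z ^ 2 + ∑' p : {p : ℤ × ℤ // p ≠ 0},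
    (1 / (z - latPt τ p.1) ^ 2 - 1 / latPt τ p.1 ^ 2)

/-- `℘′(z|τ)`. -/
def wpd (τ z : ℂ) : ℂ := deriv (wp τ) z

/-- `℘″(z|τ)`. -/
def wpdd (τ z : ℂ) : ℂ := deriv (deriv (wp τ)) z

/-- The Weierstrass zeta function `ζ(z|τ)` (odd primitive of `-℘`). -/
def wzeta (τ z : ℂ) : ℂ :=
  1 / z + ∑' p : {p : ℤ × ℤ // p ≠ 0},
    (1 / (z - latPt τ p.1) + 1 / latPt τ p.1 + z / latPt τ p.1 ^ 2)

/-- The Weierstrass sigma function `σ(z|τ)`. -/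
def wsigma (τ z : ℂ) : ℂ :=
  z * ∏' p : {p : ℤ × ℤ // p ≠ 0},
    ((1 - z / latPt τ p.1) * Complex.exp (z / latPt τ p.1 + z ^ 2 / (2 * latPt τ p.1 ^ 2)))

/-- The periods `ω₀ = 0, ω₁ = 1, ω₂ = τ, ω₃ = 1 + τ`. -/
def per (τ : ℂ) : ℕ → ℂ
  | 0 => 0
  | 1 => 1
  | 2 => τ
  | 3 => 1 + τ
  | _ => 0

/-- `e_k(τ) = ℘(ω_k/2|τ)`. -/
def eper (τ : ℂ) (k : ℕ) : ℂ := wp τ (per τ k / 2)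

/-- The quasi-period `η₁(τ) = 2ζ(1/2|τ)`. -/
def eta1 (τ : ℂ) : ℂ := 2 * wzeta τ (1 / 2)

/-- The quasi-period `η₂(τ) = 2ζ(τ/2|τ)`. -/
def eta2 (τ : ℂ) : ℂ := 2 * wzeta τ (τ / 2)

/-- `η_k(τ)`, with `η₃ = η₁ + η₂`. -/
def etaq (τ : ℂ) : ℕ → ℂ
  | 1 => eta1 τ
  | 2 => eta2 τ
  | 3 => eta1 τ + eta2 τ
  | _ => 0

/-- The Hecke form `Z(r,s,τ) = ζ(r+sτ|τ) - r η₁(τ) - s η₂(τ)`. -/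
def heckeZ (r s τ : ℂ) : ℂ := wzeta τ (r + s * τ) - r * eta1 τ - s * eta2 τ

/-- The pre-modular form `Z^{(𝐦_k)}(r,s,τ) = Z(r,s,τ)² - ℘(r+sτ|τ) + e_k(τ)`. -/
def heckeZm (k : ℕ) (r s τ : ℂ) : ℂ := heckeZ r s τ ^ 2 - wp τ (r + s * τ) + eper τ k

/-- First component of `(r_k, s_k)`. -/
def rkr (k : ℕ) (r : ℂ) : ℂ := if k = 2 then r else r + 1 / 2

/-- Second component of `(r_k, s_k)`. -/
def rks (k : ℕ) (s : ℂ) : ℂ := if k = 1 then s else s + 1 / 2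

/-- `(r,s)` is a half-integer pair, i.e. belongs to `(1/2)ℤ²`. -/
def IsHalfIntPair (r s : ℂ) : Prop := ∃ m n : ℤ, r = (m : ℂ) / 2 ∧ s = (n : ℂ) / 2

/-- The singular set of the curvature equation: lattice translates of the points `ω_k/2`
with `m_k ≥ 1`. -/
def singSet (τ : ℂ) (m : Fin 4 → ℕ) : Set ℂ :=
  {z | ∃ k : Fin 4, 1 ≤ m k ∧ ∃ l ∈ lat τ, z = per τ (k : ℕ) / 2 + l}

/-- The Laplacian of a real-valued function on `ℂ ≃ ℝ²`. -/
def lapl (u : ℂ → ℝ) (z : ℂ) : ℝ :=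
  fderiv ℝ (fun w => fderiv ℝ u w (1 : ℂ)) z (1 : ℂ) +
  fderiv ℝ (fun w => fderiv ℝ u w Complex.I) z Complex.I

/-- `u` is a solution of the curvature equation `Δu + e^u = 8π Σ m_k δ_{ω_k/2}` on `E_τ`. -/
def IsCurvatureSolution (τ : ℂ) (m : Fin 4 → ℕ) (u : ℂ → ℝ) : Prop :=
  (∀ z, u (z + 1) = u z) ∧ (∀ z, u (z + τ) = u z) ∧
  (∀ z ∉ singSet τ m, (∀ n : ℕ, ContDiffAt ℝ n u z) ∧ lapl u z + Real.exp (u z) = 0) ∧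
  (∀ k : Fin 4, 1 ≤ m k → ∀ l ∈ lat τ,
    ∃ C ε : ℝ, 0 < ε ∧ ∀ z : ℂ, z ≠ per τ (k : ℕ) / 2 + l →
      dist z (per τ (k : ℕ) / 2 + l) < ε →
      |u z - 4 * (m k : ℝ) * Real.log (dist z (per τ (k : ℕ) / 2 + l))| ≤ C)

/-- Multiplicities for equation `(★_k)`: `m₀ = m_k = 1`, the others `0`. -/
def starM (k : ℕ) : Fin 4 → ℕ := fun j => if (j : ℕ) = 0 ∨ (j : ℕ) = k then 1 else 0

/-- `f` is a developing map of `u`: `f` is meromorphic on `ℂ` and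
`u = log (8|f′|²/(1+|f|²)²)` wherever `f` is analytic with nonvanishing derivative. -/
def IsDevelopingMapOf (u : ℂ → ℝ) (f : ℂ → ℂ) : Prop :=
  (∀ z : ℂ, MeromorphicAt f z) ∧
  ∀ z : ℂ, AnalyticAt ℂ f z → deriv f z ≠ 0 →
    u z = Real.log (8 * ‖deriv f z‖ ^ 2 / (1 + ‖f z‖ ^ 2) ^ 2)

/-- `f` satisfies the type II constraint for the torus `E_τ`. -/
def IsTypeII (τ : ℂ) (f : ℂ → ℂ) : Prop :=
  ∃ θ₁ θ₂ : ℝ,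
    (∀ z, f (z + 1) = Complex.exp (2 * Complex.I * (θ₁ : ℂ)) * f z) ∧
    (∀ z, f (z + τ) = Complex.exp (2 * Complex.I * (θ₂ : ℂ)) * f z)

/-- The one-parameter family of solutions generated by the developing map `f`
(with members `u_β` having developing map `e^β f`) contains an even solution. -/
def FamilyHasEven (τ : ℂ) (m : Fin 4 → ℕ) (f : ℂ → ℂ) : Prop :=
  ∃ (β : ℝ) (v : ℂ → ℝ), IsCurvatureSolution τ m v ∧
    IsDevelopingMapOf v (fun z => (Real.exp β : ℂ) * f z) ∧ ∀ z, v (-z) = v z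

/-- `u`, with type II developing map `f`, generates a non-even family of solutions. -/
def GeneratesNonEvenFamily (τ : ℂ) (m : Fin 4 → ℕ) (u : ℂ → ℝ) (f : ℂ → ℂ) : Prop :=
  IsCurvatureSolution τ m u ∧ IsDevelopingMapOf u f ∧ IsTypeII τ f ∧ ¬ FamilyHasEven τ m f

/-- The curvature equation has a non-even family of solutions. -/
def HasNonEvenFamily (τ : ℂ) (m : Fin 4 → ℕ) : Prop :=
  ∃ u f, GeneratesNonEvenFamily τ m u f

/-- The curvature equation has an even family of solutions. -/
def HasEvenFamily (τ : ℂ) (m : Fin 4 → ℕ) : Prop :=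
  ∃ (u : ℂ → ℝ) (f : ℂ → ℂ), IsCurvatureSolution τ m u ∧ IsDevelopingMapOf u f ∧
    IsTypeII τ f ∧ FamilyHasEven τ m f

/-- `y` is a (meromorphic, global) solution of `y″ = q·y` away from the singular set `S`. -/
def SolvesODEOn (q : ℂ → ℂ) (S : Set ℂ) (y : ℂ → ℂ) : Prop :=
  (∀ z : ℂ, MeromorphicAt y z) ∧
  ∀ z ∉ S, AnalyticAt ℂ y z ∧ deriv (deriv y) z = q z * y z

/-- Linear independence of two functions, tested away from the singular set `S`. -/
def LinIndepOn (S : Set ℂ) (y₁ y₂ : ℂ → ℂ) : Prop :=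
  ∀ a b : ℂ, (∀ z ∉ S, a * y₁ z + b * y₂ z = 0) → a = 0 ∧ b = 0

/-- The equation `y″ = q·y` (with singular set `S`) on `E_τ` has unitary monodromy: there is a
fundamental system of solutions whose monodromy matrices w.r.t. `z ↦ z+1` and `z ↦ z+τ`
lie in `SU(2)`. -/
def HasUnitaryMonodromy (q : ℂ → ℂ) (S : Set ℂ) (τ : ℂ) : Prop :=
  ∃ y₁ y₂ : ℂ → ℂ, SolvesODEOn q S y₁ ∧ SolvesODEOn q S y₂ ∧ LinIndepOn S y₁ y₂ ∧
    ∃ M₁ M₂ : Matrix (Fin 2) (Fin 2) ℂ,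
      M₁ ∈ Matrix.unitaryGroup (Fin 2) ℂ ∧ M₁.det = 1 ∧
      M₂ ∈ Matrix.unitaryGroup (Fin 2) ℂ ∧ M₂.det = 1 ∧
      (∀ z, y₁ (z + 1) = M₁ 0 0 * y₁ z + M₁ 0 1 * y₂ z) ∧
      (∀ z, y₂ (z + 1) = M₁ 1 0 * y₁ z + M₁ 1 1 * y₂ z) ∧
      (∀ z, y₁ (z + τ) = M₂ 0 0 * y₁ z + M₂ 0 1 * y₂ z) ∧
      (∀ z, y₂ (z + τ) = M₂ 1 0 * y₁ z + M₂ 1 1 * y₂ z)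

/-- The potential of the Fuchsian equation `L(𝐦_k, T, E, τ)`. -/
def LPot (k : ℕ) (T E τ : ℂ) (z : ℂ) : ℂ :=
  2 * wp τ z + 2 * wp τ (z - per τ k / 2) +
    T * (wzeta τ (z - per τ k / 2) - wzeta τ z) - E

/-- The singular set of `L(𝐦_k, T, E, τ)`: lattice translates of `0` and `ω_k/2`. -/
def LSing (τ : ℂ) (k : ℕ) : Set ℂ := {z | ∃ l ∈ lat τ, z = l ∨ z = per τ k / 2 + l}

/-- The equation `y″ = q·y` is apparent (free of logarithmic singularity) at `p`: there are two
linearly independent single-valued solutions on a punctured neighborhood of `p`, both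
meromorphic at `p`. -/
def ApparentAt (q : ℂ → ℂ) (p : ℂ) : Prop :=
  ∃ (y₁ y₂ : ℂ → ℂ) (ε : ℝ), 0 < ε ∧
    (∀ z ∈ Metric.ball p ε, z ≠ p →
      AnalyticAt ℂ y₁ z ∧ AnalyticAt ℂ y₂ z ∧
      deriv (deriv y₁) z = q z * y₁ z ∧ deriv (deriv y₂) z = q z * y₂ z) ∧
    MeromorphicAt y₁ p ∧ MeromorphicAt y₂ p ∧
    ∀ a b : ℂ, (∀ z ∈ Metric.ball p ε, z ≠ p → a * y₁ z + b * y₂ z = 0) → a = 0 ∧ b = 0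

/-- The translated (even) potential `q_k(z;T,E)` of `L(𝐦_k, T, E, τ)`. -/
def qPot (k : ℕ) (T E τ : ℂ) (z : ℂ) : ℂ :=
  2 * (wp τ (z + per τ k / 4) + wp τ (z - per τ k / 4)) +
    T * (wzeta τ (z + per τ k / 4) - wzeta τ (z - per τ k / 4)) - E

/-- The singular set of the translated potential: lattice translates of `±ω_k/4`. -/
def qSing (τ : ℂ) (k : ℕ) : Set ℂ :=
  {z | ∃ l ∈ lat τ, z = per τ k / 4 + l ∨ z = -(per τ k / 4) + l}

/-- The even elliptic solution `Φ_e(z;T,E)` of the second symmetric product equation. -/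
def PhiE (τ : ℂ) (k : ℕ) (T E : ℂ) (z : ℂ) : ℂ :=
  (wpd τ (per τ k / 4)) ^ 4 / (wp τ z - wp τ (per τ k / 4)) ^ 2 +
  (wpd τ (per τ k / 4)) ^ 2 * (wpd τ (per τ k / 4) * T + wpdd τ (per τ k / 4)) /
      (wp τ z - wp τ (per τ k / 4)) +
  (1 / 4) * (4 * (wpd τ (per τ k / 4)) ^ 2 * E + 3 * (wpd τ (per τ k / 4)) ^ 2 * T ^ 2
    - 8 * wzeta τ (per τ k / 4) * (wpd τ (per τ k / 4)) ^ 2 * T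
    + 32 * wp τ (per τ k / 4) * (wpd τ (per τ k / 4)) ^ 2
    - 3 * (wpdd τ (per τ k / 4)) ^ 2)

/-- For `k ∈ {1,2,3}`, the other two indices, so that `{k, i, i′} = {1,2,3}`. -/
def otherTwo : ℕ → ℕ × ℕ
  | 1 => (2, 3)
  | 2 => (1, 3)
  | 3 => (1, 2)
  | _ => (0, 0)

/-- The Wirtinger derivative `∂_z g = (1/2)(∂_x g - i ∂_y g)`. -/
def wirt (g : ℂ → ℂ) (z : ℂ) : ℂ :=
  (1 / 2) * (fderiv ℝ g z (1 : ℂ) - Complex.I * fderiv ℝ g z Complex.I)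

/-- The potential `q(z) = -(1/2)(u_zz - (1/2) u_z²)` associated with a solution `u`. -/
def uPot (u : ℂ → ℝ) (z : ℂ) : ℂ :=
  -(1 / 2) * (wirt (wirt (fun w => ((u w : ℝ) : ℂ))) z -
    (1 / 2) * (wirt (fun w => ((u w : ℝ) : ℂ)) z) ^ 2)

/-- All lattice translates of the four half-periods. -/
def fullSing (τ : ℂ) : Set ℂ := {z | ∃ k : Fin 4, ∃ l ∈ lat τ, z = per τ (k : ℕ) / 2 + l}

/-- The potential of the general Fuchsian equation (with residues `T₁, T₂, T₃`). -/
def q8 (τ : ℂ) (m : Fin 4 → ℕ) (T₁ T₂ T₃ E : ℂ) (z : ℂ) : ℂ :=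
  (∑ k : Fin 4, (m k : ℂ) * ((m k : ℂ) + 1) * wp τ (z - per τ (k : ℕ) / 2)) +
  T₁ * (wzeta τ (z - per τ 1 / 2) - wzeta τ z) +
  T₂ * (wzeta τ (z - per τ 2 / 2) - wzeta τ z) +
  T₃ * (wzeta τ (z - per τ 3 / 2) - wzeta τ z) - E

/-- The elliptic-of-the-second-kind ansatz built from sigma functions. -/
def sigY (τ : ℂ) (k : ℕ) (a₁ a₂ c : ℂ) (z : ℂ) : ℂ :=
  Complex.exp (c * z) * wsigma τ (z - a₁) * wsigma τ (z - a₂) /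
    (wsigma τ (z - per τ k / 4) * wsigma τ (z + per τ k / 4))

end

open scoped ContDiff ComplexConjugate

/-- The Wirtinger derivative in the conjugate direction. -/
noncomputable def wirtb (g : ℂ → ℂ) (z : ℂ) : ℂ :=
  (1 / 2) * (fderiv ℝ g z (1 : ℂ) + Complex.I * fderiv ℝ g z Complex.I)

lemma fderiv_eq_wirt (g : ℂ → ℂ) (z v : ℂ) :
    fderiv ℝ g z v = wirt g z * v + wirtb g z * conj v := by
  have h : v = v.re • (1 : ℂ) + v.im • Complex.I := by
    apply Complex.ext <;> simp
  have h2 : fderiv ℝ g z v = v.re • fderiv ℝ g z 1 + v.im • fderiv ℝ g z Complex.I := by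
    conv_lhs => rw [h]
    rw [map_add, map_smul, map_smul]
  rw [h2]
  have h3 : (v : ℂ) = v.re + v.im * Complex.I := (Complex.re_add_im v).symm
  have h4 : conj v = v.re - v.im * Complex.I := by
    apply Complex.ext <;> simp
  rw [h4]
  simp only [Complex.real_smul]
  unfold wirt wirtb
  linear_combination (-((1 / 2) * (fderiv ℝ g z (1 : ℂ) - Complex.I * fderiv ℝ g z Complex.I))) * h3
    + (v.im * fderiv ℝ g z Complex.I) * Complex.I_sq

lemma wirt_of_forall {g : ℂ → ℂ} {z a b : ℂ}
    (h : ∀ v : ℂ, fderiv ℝ g z v = a * v + b * conj v) : wirt g z = a ∧ wirtb g z = b := by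
  unfold wirt wirtb
  rw [h 1, h Complex.I]
  simp only [map_one, Complex.conj_I]
  constructor
  · linear_combination (- a / 2 + b / 2) * Complex.I_sq
  · linear_combination ( a / 2 - b / 2) * Complex.I_sq

lemma wirt_congr {f g : ℂ → ℂ} {z : ℂ} (h : f =ᶠ[𝓝 z] g) : wirt f z = wirt g z := by
  unfold wirt; rw [h.fderiv_eq]

lemma wirtb_congr {f g : ℂ → ℂ} {z : ℂ} (h : f =ᶠ[𝓝 z] g) : wirtb f z = wirtb g z := by
  unfold wirtb; rw [h.fderiv_eq]

lemma wirt_mul_aux {f g : ℂ → ℂ} {z : ℂ} (hf : DifferentiableAt ℝ f z)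
    (hg : DifferentiableAt ℝ g z) :
    wirt (fun x => f x * g x) z = wirt f z * g z + f z * wirt g z ∧
    wirtb (fun x => f x * g x) z = wirtb f z * g z + f z * wirtb g z := by
  apply wirt_of_forall
  intro v
  rw [fderiv_fun_mul hf hg]
  simp only [_root_.add_apply, _root_.smul_apply, smul_eq_mul]
  rw [fderiv_eq_wirt f, fderiv_eq_wirt g]
  ring

lemma wirt_add_aux {f g : ℂ → ℂ} {z : ℂ} (hf : DifferentiableAt ℝ f z)
    (hg : DifferentiableAt ℝ g z) :
    wirt (fun x => f x + g x) z = wirt f z + wirt g z ∧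
    wirtb (fun x => f x + g x) z = wirtb f z + wirtb g z := by
  apply wirt_of_forall
  intro v
  rw [fderiv_fun_add hf hg]
  simp only [_root_.add_apply]
  rw [fderiv_eq_wirt f, fderiv_eq_wirt g]
  ring

lemma wirt_sub_aux {f g : ℂ → ℂ} {z : ℂ} (hf : DifferentiableAt ℝ f z)
    (hg : DifferentiableAt ℝ g z) :
    wirt (fun x => f x - g x) z = wirt f z - wirt g z ∧
    wirtb (fun x => f x - g x) z = wirtb f z - wirtb g z := by
  apply wirt_of_forall
  intro v
  rw [fderiv_fun_sub hf hg]
  simp only [_root_.sub_apply]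
  rw [fderiv_eq_wirt f, fderiv_eq_wirt g]
  ring

lemma wirt_conj_aux {f : ℂ → ℂ} {z : ℂ} (hf : DifferentiableAt ℝ f z) :
    wirt (fun x => conj (f x)) z = conj (wirtb f z) ∧
    wirtb (fun x => conj (f x)) z = conj (wirt f z) := by
  apply wirt_of_forall
  intro v
  have h := (Complex.conjCLE.toContinuousLinearMap.hasFDerivAt (x := f z)).comp z hf.hasFDerivAt
  have h2 : fderiv ℝ (fun x => conj (f x)) z = _ := h.fderiv
  rw [h2]
  simp only [ContinuousLinearMap.comp_apply]
  rw [fderiv_eq_wirt f]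
  simp
  ring

lemma wirt_hol_aux {f : ℂ → ℂ} {z : ℂ} (hf : DifferentiableAt ℂ f z) :
    wirt f z = deriv f z ∧ wirtb f z = 0 := by
  apply wirt_of_forall
  intro v
  rw [(hf.hasFDerivAt.restrictScalars ℝ).fderiv]
  simp [mul_comm]

lemma differentiableAt_of_wirtb {f : ℂ → ℂ} {z : ℂ} (hf : DifferentiableAt ℝ f z)
    (h : wirtb f z = 0) : DifferentiableAt ℂ f z := by
  have h2 : HasFDerivAt f (wirt f z • (1 : ℂ →L[ℂ] ℂ)) z := by
    refine hasFDerivAt_of_restrictScalars ℝ hf.hasFDerivAt ?_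
    ext v
    all_goals simp [fderiv_eq_wirt, h]
  exact h2.differentiableAt

lemma smooth_dir {f : ℂ → ℂ} {z : ℂ} (hf : ContDiffAt ℝ ∞ f z) (v : ℂ) :
    ContDiffAt ℝ ∞ (fun x => fderiv ℝ f x v) z :=
  (hf.fderiv_right (m := ∞) (by simp)).clm_apply contDiffAt_const

lemma smooth_wirt {f : ℂ → ℂ} {z : ℂ} (hf : ContDiffAt ℝ ∞ f z) : ContDiffAt ℝ ∞ (wirt f) z :=
  contDiffAt_const.mul ((smooth_dir hf _).sub (contDiffAt_const.mul (smooth_dir hf _)))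

lemma smooth_wirtb {f : ℂ → ℂ} {z : ℂ} (hf : ContDiffAt ℝ ∞ f z) : ContDiffAt ℝ ∞ (wirtb f) z :=
  contDiffAt_const.mul ((smooth_dir hf _).add (contDiffAt_const.mul (smooth_dir hf _)))

lemma smooth_diff {f : ℂ → ℂ} {z : ℂ} (hf : ContDiffAt ℝ ∞ f z) : DifferentiableAt ℝ f z :=
  hf.differentiableAt (by simp)

lemma fderiv_fderiv_apply {f : ℂ → ℂ} {z : ℂ} (hf : ContDiffAt ℝ ∞ f z) (v v' : ℂ) :
    fderiv ℝ (fun x => fderiv ℝ f x v) z v' = fderiv ℝ (fderiv ℝ f) z v' v := by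
  have h : DifferentiableAt ℝ (fderiv ℝ f) z :=
    (hf.fderiv_right (m := ∞) (by simp)).differentiableAt (by simp)
  rw [fderiv_clm_apply h (by fun_prop)]
  simp

lemma fderiv_swap {f : ℂ → ℂ} {z : ℂ} (hf : ContDiffAt ℝ ∞ f z) (v v' : ℂ) :
    fderiv ℝ (fun x => fderiv ℝ f x v) z v' = fderiv ℝ (fun x => fderiv ℝ f x v') z v := by
  rw [fderiv_fderiv_apply hf, fderiv_fderiv_apply hf]
  have := hf.isSymmSndFDerivAt (by simp only [minSmoothness_of_isRCLikeNormedField]; exact WithTop.coe_le_coe.2 le_top)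
  exact this v' v

lemma wirt_wirtb_comm {f : ℂ → ℂ} {z : ℂ} (hf : ContDiffAt ℝ ∞ f z) :
    wirt (wirtb f) z = wirtb (wirt f) z := by
  have h1 := smooth_diff (smooth_dir hf 1)
  have h2 := smooth_diff (smooth_dir hf Complex.I)
  have e1 : ∀ v, fderiv ℝ (wirtb f) z v = (1/2) * (fderiv ℝ (fun x => fderiv ℝ f x 1) z v +
      Complex.I * fderiv ℝ (fun x => fderiv ℝ f x Complex.I) z v) := by
    intro v
    unfold wirtb
    rw [fderiv_const_mul (h1.fun_add (h2.const_mul _)), fderiv_fun_add h1 (h2.const_mul _),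
      fderiv_const_mul h2]
    simp [mul_add]
  have e2 : ∀ v, fderiv ℝ (wirt f) z v = (1/2) * (fderiv ℝ (fun x => fderiv ℝ f x 1) z v -
      Complex.I * fderiv ℝ (fun x => fderiv ℝ f x Complex.I) z v) := by
    intro v
    unfold wirt
    rw [fderiv_const_mul (h1.fun_sub (h2.const_mul _)), fderiv_fun_sub h1 (h2.const_mul _),
      fderiv_const_mul h2]
    simp
  have e3 : wirt (wirtb f) z = (1/2) * (fderiv ℝ (wirtb f) z 1 -
    Complex.I * fderiv ℝ (wirtb f) z Complex.I) := rfl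
  have e4 : wirtb (wirt f) z = (1/2) * (fderiv ℝ (wirt f) z 1 +
    Complex.I * fderiv ℝ (wirt f) z Complex.I) := rfl
  rw [e3, e4, e1, e1, e2, e2, fderiv_swap hf 1 Complex.I]
  ring

/-- four times the mixed derivative is the Laplacian -/
lemma wirt_wirtb_lapl {u : ℂ → ℝ} {z : ℂ} (hu : ContDiffAt ℝ ∞ u z) :
    4 * wirt (wirtb (fun x => (u x : ℂ))) z = (lapl u z : ℂ) := by
  have hf : ContDiffAt ℝ ∞ (fun x => (u x : ℂ)) z :=
    Complex.ofRealCLM.contDiff.contDiffAt.comp z hu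
  have h1 := smooth_diff (smooth_dir hf 1)
  have h2 := smooth_diff (smooth_dir hf Complex.I)
  have e1 : ∀ v, fderiv ℝ (wirtb (fun x => (u x : ℂ))) z v = (1/2) *
     (fderiv ℝ (fun x => fderiv ℝ (fun x => (u x : ℂ)) x 1) z v +
      Complex.I * fderiv ℝ (fun x => fderiv ℝ (fun x => (u x : ℂ)) x Complex.I) z v) := by
    intro v
    unfold wirtb
    rw [fderiv_const_mul (h1.fun_add (h2.const_mul _)), fderiv_fun_add h1 (h2.const_mul _),
      fderiv_const_mul h2]
    simp [mul_add]
  have e3 : wirt (wirtb (fun x => (u x : ℂ))) z = (1/2) *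
    (fderiv ℝ (wirtb (fun x => (u x : ℂ))) z 1 -
    Complex.I * fderiv ℝ (wirtb (fun x => (u x : ℂ))) z Complex.I) := rfl
  have key : ∀ v : ℂ, fderiv ℝ (fun x => fderiv ℝ (fun x => (u x : ℂ)) x v) z v =
      ((fderiv ℝ (fun x => fderiv ℝ u x v) z v : ℝ) : ℂ) := by
    intro v
    have hev : (fun x => fderiv ℝ (fun x => (u x : ℂ)) x v) =ᶠ[𝓝 z]
        fun x => ((fderiv ℝ u x v : ℝ) : ℂ) := by
      have : ∀ᶠ x in 𝓝 z, ContDiffAt ℝ 1 u x := (hu.of_le (by simp)).eventually (by simp)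
      filter_upwards [this] with x hx
      have h := (Complex.ofRealCLM.hasFDerivAt (x := u x)).comp x
        (hx.differentiableAt (by simp)).hasFDerivAt
      have h2 : fderiv ℝ (fun x => (u x : ℂ)) x = _ := h.fderiv
      rw [h2]; simp
    rw [hev.fderiv_eq]
    have hd : DifferentiableAt ℝ (fun x => fderiv ℝ u x v) z :=
      ((hu.fderiv_right (m := ∞) (by simp)).clm_apply contDiffAt_const).differentiableAt (by simp)
    have h := (Complex.ofRealCLM.hasFDerivAt (x := fderiv ℝ u z v)).comp z hd.hasFDerivAt
    have h2 : fderiv ℝ (fun x => ((fderiv ℝ u x v : ℝ) : ℂ)) z = _ := h.fderiv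
    rw [h2]; simp
  rw [e3, e1, e1, fderiv_swap hf 1 Complex.I]
  unfold lapl
  push_cast
  rw [← key, ← key]
  linear_combination (- fderiv ℝ (fun x => fderiv ℝ (fun x => (u x : ℂ)) x Complex.I) z Complex.I)
    * Complex.I_sq

lemma exists_primitive_bound {z₀ : ℂ} {r : ℝ} (g : ℂ → ℂ)
    (hg : DifferentiableOn ℂ g (ball z₀ r)) :
    ∃ G : ℂ → ℂ, G z₀ = 0 ∧ (∀ z ∈ ball z₀ r, HasDerivAt G (g z) z) ∧
      ∀ C, (∀ z ∈ ball z₀ r, ‖g z‖ ≤ C) → ∀ z ∈ ball z₀ r, ‖G z‖ ≤ C * r := by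
  obtain ⟨G, hG0, hG⟩ := hg.isExactOn_ball.with_val_at z₀ 0
  refine ⟨G, hG0, hG, ?_⟩
  intro C hC z hz
  have hr : 0 < r := lt_of_le_of_lt dist_nonneg hz
  have hz0 : z₀ ∈ ball z₀ r := mem_ball_self hr
  have h := (convex_ball z₀ r).norm_image_sub_le_of_norm_hasDerivWithin_le (f := G) (f' := g)
    (fun x hx => (hG x hx).hasDerivWithinAt) hC hz0 hz
  rw [hG0, sub_zero] at h
  refine h.trans ?_
  have hC0 : 0 ≤ C := (norm_nonneg _).trans (hC z₀ hz0)
  have : ‖z - z₀‖ ≤ r := by rw [← dist_eq_norm]; exact le_of_lt hz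
  gcongr

lemma exists_double_primitive {z₀ : ℂ} {r : ℝ} (g : ℂ → ℂ)
    (hg : DifferentiableOn ℂ g (ball z₀ r)) :
    ∃ G : ℂ → ℂ, G z₀ = 0 ∧ deriv G z₀ = 0 ∧ DifferentiableOn ℂ G (ball z₀ r) ∧
      (∀ z ∈ ball z₀ r, deriv (deriv G) z = g z) ∧
      ∀ C, (∀ z ∈ ball z₀ r, ‖g z‖ ≤ C) →
        ∀ z ∈ ball z₀ r, ‖G z‖ ≤ C * r * r ∧ ‖deriv G z‖ ≤ C * r := by
  by_cases hr : 0 < r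
  swap
  · refine ⟨0, by simp, ?_, ?_, ?_, ?_⟩
    · have : (0 : ℂ → ℂ) = fun _ => 0 := rfl
      rw [this]; simp
    · rw [ball_eq_empty.2 (not_lt.1 hr)]; exact differentiableOn_empty
    · rw [ball_eq_empty.2 (not_lt.1 hr)]; simp
    · rw [ball_eq_empty.2 (not_lt.1 hr)]; simp
  obtain ⟨H, hH0, hH, hHb⟩ := exists_primitive_bound g hg
  have hHd : DifferentiableOn ℂ H (ball z₀ r) :=
    fun z hz => (hH z hz).differentiableAt.differentiableWithinAt
  obtain ⟨G, hG0, hG, hGb⟩ := exists_primitive_bound H hHd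
  refine ⟨G, hG0, ?_, ?_, ?_, ?_⟩
  · rw [(hG _ (mem_ball_self hr)).deriv, hH0]
  · exact fun z hz => (hG z hz).differentiableAt.differentiableWithinAt
  · intro z hz
    have : deriv G =ᶠ[𝓝 z] H := by
      filter_upwards [isOpen_ball.mem_nhds hz] with x hx using (hG x hx).deriv
    rw [this.deriv_eq, (hH z hz).deriv]
  · intro C hC z hz
    refine ⟨?_, ?_⟩
    · exact hGb _ (hHb C hC) z hz
    · rw [(hG z hz).deriv]; exact hHb C hC z hz

lemma local_ode_ball {z₀ : ℂ} {r M : ℝ} (hr : 0 < r) (q : ℂ → ℂ)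
    (hq : DifferentiableOn ℂ q (ball z₀ r)) (hM : ∀ z ∈ ball z₀ r, ‖q z‖ ≤ M)
    (hMr : M * r * r ≤ 1 / 2) (a b : ℂ) :
    ∃ y : ℂ → ℂ, DifferentiableOn ℂ y (ball z₀ r) ∧
      (∀ z ∈ ball z₀ r, deriv (deriv y) z = q z * y z) ∧ y z₀ = a ∧ deriv y z₀ = b := by
  set B := ball z₀ r with hB
  have hM0 : 0 ≤ M := (norm_nonneg _).trans (hM z₀ (mem_ball_self hr))
  have key : ∀ g : ℂ → ℂ, DifferentiableOn ℂ g B → ∃ G : ℂ → ℂ, G z₀ = 0 ∧ deriv G z₀ = 0 ∧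
      DifferentiableOn ℂ G B ∧ (∀ z ∈ B, deriv (deriv G) z = q z * g z) ∧
      ∀ C, (∀ z ∈ B, ‖g z‖ ≤ C) → ∀ z ∈ B, ‖G z‖ ≤ C / 2 ∧ ‖deriv G z‖ ≤ C * M * r := by
    intro g hg
    obtain ⟨G, h1, h2, h3, h4, h5⟩ := exists_double_primitive (fun z => q z * g z) (hq.mul hg)
    refine ⟨G, h1, h2, h3, h4, ?_⟩
    intro C hC z hz
    have hC0 : 0 ≤ C := (norm_nonneg _).trans (hC z₀ (mem_ball_self hr))
    obtain ⟨h6, h7⟩ := h5 (M * C) (by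
      intro x hx
      rw [norm_mul]
      have := hM x hx
      have := hC x hx
      gcongr) z hz
    constructor
    · refine h6.trans ?_
      nlinarith
    · refine h7.trans (le_of_eq (by ring))
  choose! T hT0 hT0' hTd hTq hTb using key
  set y0 : ℂ → ℂ := fun z => a + b * (z - z₀) with hy0
  have hy0d : Differentiable ℂ y0 := by rw [hy0]; fun_prop
  set Y : ℕ → ℂ → ℂ := fun n => T^[n] y0 with hY
  have hYs : ∀ n, Y (n+1) = T (Y n) := fun n => Function.iterate_succ_apply' T n y0
  have hYd : ∀ n, DifferentiableOn ℂ (Y n) B := by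
    intro n
    induction n with
    | zero => exact hy0d.differentiableOn
    | succ n ih => rw [hYs]; exact hTd _ ih
  set C0 := ‖a‖ + ‖b‖ * r with hC0
  have hYb : ∀ n, ∀ z ∈ B, ‖Y n z‖ ≤ C0 / 2 ^ n := by
    intro n
    induction n with
    | zero =>
      intro z hz
      have h1 : ‖z - z₀‖ ≤ r := by rw [← dist_eq_norm]; exact le_of_lt hz
      calc ‖a + b * (z - z₀)‖ ≤ ‖a‖ + ‖b * (z - z₀)‖ := norm_add_le _ _
        _ ≤ C0 / 2 ^ 0 := by rw [norm_mul, pow_zero, div_one, hC0]; gcongr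
    | succ n ih =>
      intro z hz
      rw [hYs]
      refine ((hTb _ (hYd n) _ ih z hz).1).trans (le_of_eq ?_)
      rw [pow_succ]; field_simp
  have hC00 : 0 ≤ C0 := by positivity
  have hYb' : ∀ n, ∀ z ∈ B, ‖deriv (Y n) z‖ ≤ (2 * C0 * M * r + ‖b‖) * (1 / 2) ^ n := by
    intro n z hz
    cases n with
    | zero =>
      have : deriv (Y 0) z = b := by
        show deriv y0 z = b
        rw [hy0]; simp
      rw [this, pow_zero, mul_one]
      have : 0 ≤ 2 * C0 * M * r := by positivity
      linarith
    | succ n =>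
      rw [hYs]
      refine ((hTb _ (hYd n) _ (hYb n) z hz).2).trans ?_
      rw [one_div_pow, pow_succ]
      have : 0 ≤ ‖b‖ * (1 / (2 ^ n * 2)) := by positivity
      have e : C0 / 2 ^ n * M * r = (2 * C0 * M * r) * (1 / (2 ^ n * 2)) := by field_simp
      rw [e]; nlinarith
  have hs1 : Summable fun n : ℕ => C0 / 2 ^ n := by
    simpa [div_eq_mul_inv] using (summable_geometric_two.mul_left C0)
  have hs2 : Summable fun n : ℕ => (2 * C0 * M * r + ‖b‖) * (1 / 2 : ℝ) ^ n :=
    summable_geometric_two.mul_left _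
  have hBo : IsOpen B := isOpen_ball
  have hD1 := fun z hz => Complex.hasSum_deriv_of_summable_norm (z := z) hs1 hYd hBo hYb hz
  have hYd' : ∀ n, DifferentiableOn ℂ (deriv (Y n)) B := fun n => (hYd n).deriv hBo
  have hD2 := fun z hz => Complex.hasSum_deriv_of_summable_norm (z := z) hs2 hYd' hBo hYb' hz
  have hz0 : z₀ ∈ B := mem_ball_self hr
  refine ⟨fun z => ∑' n, Y n z, ?_, ?_, ?_, ?_⟩
  · exact Complex.differentiableOn_tsum_of_summable_norm hs1 hYd hBo hYb
  · intro z hz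
    have e1 : deriv (fun z => ∑' n, Y n z) =ᶠ[𝓝 z] fun z => ∑' n, deriv (Y n) z := by
      filter_upwards [hBo.mem_nhds hz] with x hx using (hD1 x hx).tsum_eq.symm
    rw [e1.deriv_eq, ← (hD2 z hz).tsum_eq, ← tsum_mul_left]
    rw [(hD2 z hz).summable.tsum_eq_zero_add]
    have : deriv (deriv (Y 0)) z = 0 := by
      have : deriv (Y 0) = fun _ => b := by
        funext x
        show deriv y0 x = b
        rw [hy0]; simp
      rw [this]; simp
    rw [this, zero_add]
    refine tsum_congr fun n => ?_
    rw [hYs]; exact hTq _ (hYd n) z hz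
  · have hsum : Summable fun n => Y n z₀ := Summable.of_norm_bounded hs1 (fun n => hYb n z₀ hz0)
    show ∑' n, Y n z₀ = a
    rw [hsum.tsum_eq_zero_add]
    have : ∀ n, Y (n+1) z₀ = 0 := fun n => by rw [hYs]; exact hT0 _ (hYd n)
    simp only [this, tsum_zero, add_zero]
    show y0 z₀ = a
    simp [hy0]
  · rw [← (hD1 z₀ hz0).tsum_eq, (hD1 z₀ hz0).summable.tsum_eq_zero_add]
    have : ∀ n, deriv (Y (n+1)) z₀ = 0 := fun n => by rw [hYs]; exact hT0' _ (hYd n)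
    simp only [this, tsum_zero, add_zero]
    show deriv y0 z₀ = b
    rw [hy0]; simp

lemma local_ode {z₀ : ℂ} (q : ℂ → ℂ) (hq : AnalyticAt ℂ q z₀) :
    ∃ r > 0, ∀ a b : ℂ, ∃ y : ℂ → ℂ, DifferentiableOn ℂ y (ball z₀ r) ∧
      (∀ z ∈ ball z₀ r, deriv (deriv y) z = q z * y z) ∧ y z₀ = a ∧ deriv y z₀ = b := by
  have h1 : ∀ᶠ z in 𝓝 z₀, AnalyticAt ℂ q z := hq.eventually_analyticAt
  have h2 : ∀ᶠ z in 𝓝 z₀, ‖q z‖ < ‖q z₀‖ + 1 :=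
    (hq.continuousAt.norm).eventually_lt continuousAt_const (by simp)
  obtain ⟨ε, hε, h⟩ := Metric.eventually_nhds_iff_ball.1 (h1.and h2)
  set M := ‖q z₀‖ + 1
  have hM : 1 ≤ M := by simp [M]
  set r := min ε (1 / (2 * M))
  have hr : 0 < r := by positivity
  refine ⟨r, hr, fun a b => local_ode_ball (M := M) hr q ?_ ?_ ?_ a b⟩
  · exact fun z hz => (h z (ball_subset_ball (min_le_left _ _) hz)).1.differentiableAt.differentiableWithinAt
  · exact fun z hz => (h z (ball_subset_ball (min_le_left _ _) hz)).2.le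
  · have h3 : r ≤ 1 / (2 * M) := min_le_right _ _
    have h4 : M * r ≤ 1 / 2 := by
      calc M * r ≤ M * (1 / (2 * M)) := by gcongr
        _ = 1 / 2 := by field_simp
    have h5 : r ≤ 1 := h3.trans (by rw [div_le_one (by positivity)]; linarith)
    nlinarith

lemma chain_1d {G : ℝ → ℝ → Prop} {a b h : ℝ} (hh : 0 < h)
    (hglue : ∀ s t e, a < s → s < t → t < e → e ≤ b → G a t → G s e → G a e)
    (hshort : ∀ s t, a ≤ s → s < t → t ≤ b → t - s ≤ 2 * h → G s t) (hab : a < b) : G a b := by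
  have key : ∀ n : ℕ, ∀ e, a < e → e ≤ b → e ≤ a + (n + 1) * h → G a e := by
    intro n
    induction n with
    | zero =>
      intro e h1 h2 h3
      exact hshort a e le_rfl h1 h2 (by push_cast at h3; linarith)
    | succ n ih =>
      intro e h1 h2 h3
      push_cast at h3
      by_cases hc : e - a ≤ 2 * h
      · exact hshort a e le_rfl h1 h2 hc
      · push Not at hc
        refine hglue (e - 2 * h) (e - h) e (by linarith) (by linarith) (by linarith) h2
          (ih _ (by linarith) (by linarith) (by linarith)) ?_
        exact hshort _ _ (by linarith) (by linarith) h2 (by linarith)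
  obtain ⟨n, hn⟩ := exists_nat_gt ((b - a) / h)
  refine key n b hab le_rfl ?_
  rw [div_lt_iff₀ hh] at hn
  nlinarith

/-- open rectangle -/
def orect (a b c d : ℝ) : Set ℂ := {z | a < z.re ∧ z.re < b ∧ c < z.im ∧ z.im < d}

lemma orect_open (a b c d : ℝ) : IsOpen (orect a b c d) :=
  (isOpen_lt continuous_const Complex.continuous_re).inter
    ((isOpen_lt Complex.continuous_re continuous_const).inter
      ((isOpen_lt continuous_const Complex.continuous_im).inter
        (isOpen_lt Complex.continuous_im continuous_const)))

lemma orect_convex (a b c d : ℝ) : Convex ℝ (orect a b c d) :=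
  (convex_halfSpace_re_gt a).inter ((convex_halfSpace_re_lt b).inter
    ((convex_halfSpace_im_gt c).inter (convex_halfSpace_im_lt d)))

lemma glue_two {β : Type*} {Q : ℂ → (ℂ → β) → Prop}
    (hloc : ∀ z Y Z, Y =ᶠ[𝓝 z] Z → Q z Y → Q z Z)
    (hext : ∀ (U V : Set ℂ) (Y Z : ℂ → β), IsOpen U → IsOpen V → IsPreconnected (U ∩ V) →
      (U ∩ V).Nonempty → (∀ z ∈ U, Q z Y) → (∀ z ∈ V, Q z Z) →
      ∃ Z', (∀ z ∈ V, Q z Z') ∧ ∀ z ∈ U ∩ V, Z' z = Y z)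
    {U V : Set ℂ} (hU : IsOpen U) (hV : IsOpen V) (hc : IsPreconnected (U ∩ V))
    (hne : (U ∩ V).Nonempty) (h1 : ∃ Y, ∀ z ∈ U, Q z Y) (h2 : ∃ Y, ∀ z ∈ V, Q z Y) :
    ∃ Y, ∀ z ∈ U ∪ V, Q z Y := by
  classical
  obtain ⟨Y, hY⟩ := h1
  obtain ⟨Z, hZ⟩ := h2
  obtain ⟨Z', hZ', hag⟩ := hext U V Y Z hU hV hc hne hY hZ
  refine ⟨fun z => if z ∈ U then Y z else Z' z, ?_⟩
  rintro z (hz | hz)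
  · refine hloc z Y _ ?_ (hY z hz)
    filter_upwards [hU.mem_nhds hz] with x hx
    simp [hx]
  · refine hloc z Z' _ ?_ (hZ' z hz)
    filter_upwards [hV.mem_nhds hz] with x hx
    by_cases hxU : x ∈ U
    · simp [hxU, hag x ⟨hxU, hx⟩]
    · simp [hxU]

lemma glue_rect {β : Type*} {Q : ℂ → (ℂ → β) → Prop}
    (hloc : ∀ z Y Z, Y =ᶠ[𝓝 z] Z → Q z Y → Q z Z)
    (hext : ∀ (U V : Set ℂ) (Y Z : ℂ → β), IsOpen U → IsOpen V → IsPreconnected (U ∩ V) →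
      (U ∩ V).Nonempty → (∀ z ∈ U, Q z Y) → (∀ z ∈ V, Q z Z) →
      ∃ Z', (∀ z ∈ V, Q z Z') ∧ ∀ z ∈ U ∩ V, Z' z = Y z)
    {a b c d : ℝ} (hab : a < b) (hcd : c < d)
    (hex : ∀ z : ℂ, a ≤ z.re → z.re ≤ b → c ≤ z.im → z.im ≤ d → ∃ Y, ∀ᶠ x in 𝓝 z, Q x Y) :
    ∃ Y, ∀ z ∈ orect a b c d, Q z Y := by
  have hK : IsCompact (Icc a b ×ℂ Icc c d) := isCompact_Icc.reProdIm isCompact_Icc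
  let W : ((ℂ → β)) → Set ℂ := fun Y => {z | ∀ᶠ x in 𝓝 z, Q x Y}
  obtain ⟨δ, hδ, hL⟩ := lebesgue_number_lemma_of_metric (c := W) hK
    (fun Y => isOpen_setOf_eventually_nhds) (by
      intro z hz
      rw [Complex.mem_reProdIm] at hz
      obtain ⟨Y, hY⟩ := hex z hz.1.1 hz.1.2 hz.2.1 hz.2.2
      exact mem_iUnion.2 ⟨Y, hY⟩)
  have small : ∀ s t s' t', a ≤ s → s < t → t ≤ b → c ≤ s' → s' < t' → t' ≤ d →
      t - s ≤ 2 * (δ / 4) → t' - s' ≤ 2 * (δ / 4) → ∃ Y, ∀ z ∈ orect s t s' t', Q z Y := by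
    intro s t s' t' h1 h2 h3 h4 h5 h6 h7 h8
    obtain ⟨Y, hY⟩ := hL (⟨s, s'⟩ : ℂ) (by
      rw [Complex.mem_reProdIm]; refine ⟨⟨?_, ?_⟩, ?_, ?_⟩ <;> simp <;> linarith)
    refine ⟨Y, fun z hz => ?_⟩
    have : z ∈ ball (⟨s, s'⟩ : ℂ) δ := by
      rw [mem_ball, dist_eq_norm]
      refine (Complex.norm_le_abs_re_add_abs_im _).trans_lt ?_
      obtain ⟨g1, g2, g3, g4⟩ := hz
      simp only [Complex.sub_re, Complex.sub_im]
      rw [abs_of_pos (by linarith), abs_of_pos (by linarith)]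
      linarith
    exact (hY this).self_of_nhds
  have hrow : ∀ s' t', c ≤ s' → s' < t' → t' ≤ d → t' - s' ≤ 2 * (δ / 4) →
      ∃ Y, ∀ z ∈ orect a b s' t', Q z Y := by
    intro s' t' h1 h2 h3 h4
    refine chain_1d (G := fun s t => ∃ Y, ∀ z ∈ orect s t s' t', Q z Y) (h := δ / 4)
      (by positivity) ?_ ?_ hab
    · intro s t e g1 g2 g3 g4 k1 k2
      have e1 : orect a t s' t' ∩ orect s e s' t' = orect s t s' t' := by
        ext z; simp only [orect, mem_inter_iff, mem_setOf_eq]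
        constructor
        · rintro ⟨⟨_, _, _, _⟩, _, _, _, _⟩; refine ⟨?_, ?_, ?_, ?_⟩ <;> linarith
        · rintro ⟨_, _, _, _⟩; refine ⟨⟨?_, ?_, ?_, ?_⟩, ?_, ?_, ?_, ?_⟩ <;> linarith
      have e2 : orect a e s' t' ⊆ orect a t s' t' ∪ orect s e s' t' := by
        rintro z ⟨q1, q2, q3, q4⟩
        by_cases hz : z.re < t
        · exact Or.inl ⟨q1, hz, q3, q4⟩
        · exact Or.inr ⟨by linarith, q2, q3, q4⟩
      obtain ⟨Y, hY⟩ := glue_two hloc hext (orect_open _ _ _ _) (orect_open _ _ _ _)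
        (by rw [e1]; exact (orect_convex _ _ _ _).isPreconnected)
        (by rw [e1]; exact ⟨⟨(s + t) / 2, (s' + t') / 2⟩, by
          refine ⟨?_, ?_, ?_, ?_⟩ <;> simp <;> linarith⟩) k1 k2
      exact ⟨Y, fun z hz => hY z (e2 hz)⟩
    · intro s t g1 g2 g3 g4
      exact small s t s' t' g1 g2 g3 h1 h2 h3 g4 h4
  refine chain_1d (G := fun s t => ∃ Y, ∀ z ∈ orect a b s t, Q z Y) (h := δ / 4)
      (by positivity) ?_ hrow hcd
  intro s t e g1 g2 g3 g4 k1 k2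
  have e1 : orect a b c t ∩ orect a b s e = orect a b s t := by
    ext z; simp only [orect, mem_inter_iff, mem_setOf_eq]
    constructor
    · rintro ⟨⟨_, _, _, _⟩, _, _, _, _⟩; refine ⟨?_, ?_, ?_, ?_⟩ <;> linarith
    · rintro ⟨_, _, _, _⟩; refine ⟨⟨?_, ?_, ?_, ?_⟩, ?_, ?_, ?_, ?_⟩ <;> linarith
  have e2 : orect a b c e ⊆ orect a b c t ∪ orect a b s e := by
    rintro z ⟨q1, q2, q3, q4⟩
    by_cases hz : z.im < t
    · exact Or.inl ⟨q1, q2, q3, hz⟩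
    · exact Or.inr ⟨q1, q2, by linarith, q4⟩
  obtain ⟨Y, hY⟩ := glue_two hloc hext (orect_open _ _ _ _) (orect_open _ _ _ _)
    (by rw [e1]; exact (orect_convex _ _ _ _).isPreconnected)
    (by rw [e1]; exact ⟨⟨(a + b) / 2, (s + t) / 2⟩, by
      refine ⟨?_, ?_, ?_, ?_⟩ <;> simp <;> linarith⟩) k1 k2
  exact ⟨Y, fun z hz => hY z (e2 hz)⟩

lemma glue_exhaust {β : Type*} {Q : ℂ → (ℂ → β) → Prop}
    (hloc : ∀ z Y Z, Y =ᶠ[𝓝 z] Z → Q z Y → Q z Z)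
    (hext : ∀ (U V : Set ℂ) (Y Z : ℂ → β), IsOpen U → IsOpen V → IsPreconnected (U ∩ V) →
      (U ∩ V).Nonempty → (∀ z ∈ U, Q z Y) → (∀ z ∈ V, Q z Z) →
      ∃ Z', (∀ z ∈ V, Q z Z') ∧ ∀ z ∈ U ∩ V, Z' z = Y z)
    (U : ℕ → Set ℂ) (hUo : ∀ n, IsOpen (U n)) (hUc : ∀ n, IsPreconnected (U n))
    (hUne : ∀ n, (U n).Nonempty) (hUm : Monotone U)
    (hex : ∀ n, ∃ Y, ∀ z ∈ U n, Q z Y) :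
    ∃ Y, ∀ z ∈ ⋃ n, U n, Q z Y := by
  classical
  choose s hs using hex
  have step : ∀ n, ∀ t : {t : ℂ → β // ∀ z ∈ U n, Q z t}, ∃ t' : {t : ℂ → β // ∀ z ∈ U (n+1), Q z t},
      ∀ z ∈ U n, t'.1 z = t.1 z := by
    intro n t
    have e : U n ∩ U (n+1) = U n := inter_eq_left.2 (hUm (Nat.le_succ n))
    obtain ⟨Z', h1, h2⟩ := hext (U n) (U (n+1)) t.1 (s (n+1)) (hUo _) (hUo _)
      (by rw [e]; exact hUc n) (by rw [e]; exact hUne n) t.2 (hs _)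
    exact ⟨⟨Z', h1⟩, fun z hz => h2 z (by rw [e]; exact hz)⟩
  choose f hf using step
  let t : ∀ n, {t : ℂ → β // ∀ z ∈ U n, Q z t} := fun n => Nat.rec ⟨s 0, hs 0⟩ (fun n t => f n t) n
  have ht : ∀ n, ∀ z ∈ U n, (t (n+1)).1 z = (t n).1 z := fun n => hf n (t n)
  have ht2 : ∀ n k, ∀ z ∈ U n, (t (n+k)).1 z = (t n).1 z := by
    intro n k
    induction k with
    | zero => intro z _; rfl
    | succ k ih => intro z hz; rw [← ih z hz]; exact ht (n+k) z (hUm (Nat.le_add_right n k) hz)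
  let Y : ℂ → β := fun z => if h : ∃ n, z ∈ U n then (t (Nat.find h)).1 z else s 0 z
  have hY : ∀ n, ∀ z ∈ U n, Y z = (t n).1 z := by
    intro n z hz
    have h : ∃ n, z ∈ U n := ⟨n, hz⟩
    have h1 : Nat.find h ≤ n := Nat.find_min' h hz
    have : Y z = (t (Nat.find h)).1 z := by simp only [Y]; rw [dif_pos h]
    rw [this]
    obtain ⟨k, hk⟩ := Nat.exists_eq_add_of_le h1
    have := ht2 (Nat.find h) k z (Nat.find_spec h)
    rw [← hk] at this
    exact this.symm
  refine ⟨Y, fun z hz => ?_⟩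
  obtain ⟨n, hn⟩ := mem_iUnion.1 hz
  refine hloc z (t n).1 _ ?_ ((t n).2 z hn)
  filter_upwards [(hUo n).mem_nhds hn] with x hx
  exact (hY n x hx).symm

lemma glue_plane {β : Type*} {Q : ℂ → (ℂ → β) → Prop}
    (hloc : ∀ z Y Z, Y =ᶠ[𝓝 z] Z → Q z Y → Q z Z)
    (hext : ∀ (U V : Set ℂ) (Y Z : ℂ → β), IsOpen U → IsOpen V → IsPreconnected (U ∩ V) →
      (U ∩ V).Nonempty → (∀ z ∈ U, Q z Y) → (∀ z ∈ V, Q z Z) →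
      ∃ Z', (∀ z ∈ V, Q z Z') ∧ ∀ z ∈ U ∩ V, Z' z = Y z)
    (hex : ∀ z : ℂ, ∃ Y, ∀ᶠ x in 𝓝 z, Q x Y) :
    ∃ Y, ∀ z, Q z Y := by
  obtain ⟨Y, hY⟩ := glue_exhaust hloc hext
    (fun n : ℕ => orect (-(n+1)) (n+1) (-(n+1)) (n+1)) (fun n => orect_open _ _ _ _)
    (fun n => (orect_convex _ _ _ _).isPreconnected)
    (fun n => ⟨0, by
      have : (0:ℝ) < n + 1 := by positivity
      refine ⟨?_, ?_, ?_, ?_⟩ <;> simp <;> linarith⟩)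
    (by
      intro n k hnk z ⟨h1, h2, h3, h4⟩
      have : (n:ℝ) ≤ k := by exact_mod_cast hnk
      refine ⟨?_, ?_, ?_, ?_⟩ <;> linarith)
    (fun n => glue_rect hloc hext (by have : (0:ℝ) < n + 1 := by positivity
                                      linarith)
      (by have : (0:ℝ) < n + 1 := by positivity
          linarith) (fun z _ _ _ _ => hex z))
  refine ⟨Y, fun z => hY z ?_⟩
  obtain ⟨n, hn⟩ := exists_nat_gt ‖z‖
  refine mem_iUnion.2 ⟨n, ?_⟩
  have h1 := abs_le.1 (Complex.abs_re_le_norm z)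
  have h2 := abs_le.1 (Complex.abs_im_le_norm z)
  refine ⟨?_, ?_, ?_, ?_⟩ <;> linarith [h1.1, h1.2, h2.1, h2.2]

lemma glue_half {β : Type*} {Q : ℂ → (ℂ → β) → Prop} (c : ℝ)
    (hloc : ∀ z Y Z, Y =ᶠ[𝓝 z] Z → Q z Y → Q z Z)
    (hext : ∀ (U V : Set ℂ) (Y Z : ℂ → β), IsOpen U → IsOpen V → IsPreconnected (U ∩ V) →
      (U ∩ V).Nonempty → (∀ z ∈ U, Q z Y) → (∀ z ∈ V, Q z Z) →
      ∃ Z', (∀ z ∈ V, Q z Z') ∧ ∀ z ∈ U ∩ V, Z' z = Y z)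
    (hex : ∀ z : ℂ, z.re < c → ∃ Y, ∀ᶠ x in 𝓝 z, Q x Y) :
    ∃ Y, ∀ z : ℂ, z.re < c → Q z Y := by
  have hp : ∀ n : ℕ, (1:ℝ) / (n + 1) ≤ 1 ∧ 0 < (1:ℝ) / (n + 1) := fun n =>
    ⟨by rw [div_le_one (by positivity)]; linarith [(Nat.cast_nonneg n : (0:ℝ) ≤ n)], by positivity⟩
  obtain ⟨Y, hY⟩ := glue_exhaust hloc hext
    (fun n : ℕ => orect (c - (n+2)) (c - 1 / (n + 1)) (-(n+1)) (n+1)) (fun n => orect_open _ _ _ _)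
    (fun n => (orect_convex _ _ _ _).isPreconnected)
    (fun n => ⟨⟨c - 3/2, 0⟩, by
      have : (0:ℝ) < n + 1 := by positivity
      have := hp n
      refine ⟨?_, ?_, ?_, ?_⟩ <;> simp only <;> linarith [(Nat.cast_nonneg n : (0:ℝ) ≤ n)]⟩)
    (by
      intro n k hnk z ⟨h1, h2, h3, h4⟩
      have : (n:ℝ) ≤ k := by exact_mod_cast hnk
      have h5 : (1:ℝ) / (k + 1) ≤ 1 / (n + 1) := by gcongr
      refine ⟨?_, ?_, ?_, ?_⟩ <;> linarith)
    (fun n => glue_rect hloc hext (by have := hp n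
                                      linarith [(Nat.cast_nonneg n : (0:ℝ) ≤ n)])
      (by have : (0:ℝ) < n + 1 := by positivity
          linarith) (fun z _ h _ _ => hex z (by have := hp n; linarith)))
  refine ⟨Y, fun z hz => hY z ?_⟩
  obtain ⟨n, hn⟩ := exists_nat_gt (|c| + ‖z‖)
  obtain ⟨k, hk⟩ := exists_nat_one_div_lt (sub_pos.2 hz)
  refine mem_iUnion.2 ⟨max n k, ?_⟩
  have h1 := abs_le.1 (Complex.abs_re_le_norm z)
  have h2 := abs_le.1 (Complex.abs_im_le_norm z)
  have h3 := le_abs_self c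
  have h6 := abs_nonneg c
  have h4 : (n:ℝ) ≤ (max n k : ℕ) := by exact_mod_cast le_max_left n k
  have h4' : (k:ℝ) ≤ (max n k : ℕ) := by exact_mod_cast le_max_right n k
  have h5 : (1:ℝ) / ((max n k : ℕ) + 1) ≤ 1 / (k + 1) := by gcongr
  refine ⟨?_, ?_, ?_, ?_⟩ <;> linarith [h1.1, h1.2, h2.1, h2.2]

lemma ball_diff_preconnected {S : Set ℂ} (hS : S.Countable) (x : ℂ) {r : ℝ} (hr : 0 < r) :
    IsPreconnected (ball x r \ S) := by
  have h1 : 1 < Module.rank ℝ ℂ := Module.one_lt_rank_of_one_lt_finrank (by simp)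
  let φ := OpenPartialHomeomorph.univBall (E := ℂ) x r
  have hinj : Function.Injective φ := by
    have := φ.injOn
    rw [OpenPartialHomeomorph.univBall_source] at this
    exact injOn_univ.1 this
  have hc : (φ ⁻¹' S).Countable := hS.preimage hinj
  have h2 := (hc.isConnected_compl_of_one_lt_rank h1).isPreconnected
  have h3 := h2.image φ (OpenPartialHomeomorph.continuous_univBall x r).continuousOn
  have h4 : φ '' (φ ⁻¹' S)ᶜ = ball x r \ S := by
    have ht : φ.target = ball x r := OpenPartialHomeomorph.univBall_target x hr
    ext z
    constructor
    · rintro ⟨y, hy, rfl⟩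
      refine ⟨?_, hy⟩
      rw [← ht]
      exact φ.map_source (by rw [OpenPartialHomeomorph.univBall_source]; trivial)
    · rintro ⟨hz, hzS⟩
      rw [← ht] at hz
      refine ⟨φ.symm z, ?_, φ.right_inv hz⟩
      show φ (φ.symm z) ∉ S
      rw [φ.right_inv hz]; exact hzS
  rwa [h4] at h3

lemma const_off {U S : Set ℂ} (hU : IsOpen U) (hUc : IsPreconnected U) (hS : S.Countable)
    (hSc : IsClosed S) (h : ℂ → ℂ) (hd : ∀ z ∈ U, z ∉ S → DifferentiableAt ℂ h z)
    (hd0 : ∀ z ∈ U, z ∉ S → deriv h z = 0) :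
    ∀ x ∈ U, x ∉ S → ∀ y ∈ U, y ∉ S → h x = h y := by
  have hdense : Dense Sᶜ := hS.dense_compl ℂ
  have hne : ∀ x, (𝓝[Sᶜ] x).NeBot := fun x => mem_closure_iff_nhdsWithin_neBot.1 (hdense x)
  have hloc : ∀ x ∈ U, ∃ r > 0, ball x r ⊆ U ∧ ∃ v, ∀ y ∈ ball x r \ S, h y = v := by
    intro x hx
    obtain ⟨r, hr, hb⟩ := Metric.isOpen_iff.1 hU x hx
    refine ⟨r, hr, hb, ?_⟩
    have hp := ball_diff_preconnected hS x hr
    have ho : IsOpen (ball x r \ S) := isOpen_ball.sdiff hSc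
    by_cases hemp : (ball x r \ S).Nonempty
    · obtain ⟨p, hp'⟩ := hemp
      refine ⟨h p, fun y hy => ?_⟩
      exact ho.is_const_of_deriv_eq_zero hp
        (fun z hz => (hd z (hb hz.1) hz.2).differentiableWithinAt)
        (fun z hz => hd0 z (hb hz.1) hz.2) hy hp'
    · exact ⟨0, fun y hy => (hemp ⟨y, hy⟩).elim⟩
  have hev : ∀ x ∈ U, ∃ v, ∀ᶠ y in 𝓝 x, ∀ᶠ t in 𝓝[Sᶜ] y, h t = v := by
    intro x hx
    obtain ⟨r, hr, hb, v, hv⟩ := hloc x hx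
    refine ⟨v, ?_⟩
    filter_upwards [isOpen_ball.mem_nhds (mem_ball_self hr)] with y hy
    filter_upwards [mem_nhdsWithin_of_mem_nhds (isOpen_ball.mem_nhds hy), self_mem_nhdsWithin]
      with t ht ht'
    exact hv t ⟨ht, ht'⟩
  have hP := fun {x y : ℂ} => hUc.induction₂ (x := x) (y := y)
    (fun x y => ∃ v, (∀ᶠ t in 𝓝[Sᶜ] x, h t = v) ∧ (∀ᶠ t in 𝓝[Sᶜ] y, h t = v))
    (by
      intro x hx
      obtain ⟨v, hv⟩ := hev x hx
      have := hv.self_of_nhds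
      filter_upwards [mem_nhdsWithin_of_mem_nhds hv] with y hy
      exact ⟨v, this, hy⟩)
    (by
      rintro x y z - - - ⟨v, h1, h2⟩ ⟨v', h3, h4⟩
      obtain ⟨t, ht, ht'⟩ := (@Filter.Eventually.exists _ _ _ (hne y) (h2.and h3))
      exact ⟨v, h1, by rw [← ht, ht']; exact h4⟩)
    (by rintro x y - - ⟨v, h1, h2⟩; exact ⟨v, h2, h1⟩)
  have hself : ∀ x ∉ S, ∀ v, (∀ᶠ t in 𝓝[Sᶜ] x, h t = v) → h x = v := fun x hx v hv =>
    hv.self_of_nhdsWithin hx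
  intro x hx hxS y hy hyS
  obtain ⟨v, h1, h2⟩ := hP hx hy
  rw [hself x hxS v h1, hself y hyS v h2]

/-- a local pair -/
def PairAt (w : ℂ → ℝ) (Y Z : ℂ → ℂ) (z : ℂ) : Prop :=
  AnalyticAt ℂ Y z ∧ AnalyticAt ℂ Z z ∧ ∀ᶠ x in 𝓝 z,
    Y x * deriv Z x - deriv Y x * Z x = 1 ∧ (w x : ℂ) = Y x * conj (Y x) + Z x * conj (Z x)

lemma PairAt.eventually {w : ℂ → ℝ} {Y Z : ℂ → ℂ} {z : ℂ} (h : PairAt w Y Z z) :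
    ∀ᶠ x in 𝓝 z, PairAt w Y Z x := by
  filter_upwards [h.1.eventually_analyticAt, h.2.1.eventually_analyticAt,
    eventually_eventually_nhds.2 h.2.2] with x h1 h2 h3
  exact ⟨h1, h2, h3⟩

lemma PairAt.congr {w : ℂ → ℝ} {Y Z Y' Z' : ℂ → ℂ} {z : ℂ} (h : PairAt w Y Z z)
    (hY : Y =ᶠ[𝓝 z] Y') (hZ : Z =ᶠ[𝓝 z] Z') : PairAt w Y' Z' z := by
  refine ⟨h.1.congr hY, h.2.1.congr hZ, ?_⟩
  filter_upwards [h.2.2, hY.eventuallyEq_nhds, hZ.eventuallyEq_nhds] with x h1 h2 h3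
  rw [← h2.deriv_eq, ← h3.deriv_eq, ← h2.eq_of_nhds, ← h3.eq_of_nhds]
  exact h1

lemma PairAt.congr_w {w w' : ℂ → ℝ} {Y Z : ℂ → ℂ} {z : ℂ} (h : PairAt w Y Z z)
    (hw : w =ᶠ[𝓝 z] w') : PairAt w' Y Z z := by
  refine ⟨h.1, h.2.1, ?_⟩
  filter_upwards [h.2.2, hw] with x h1 h2
  rw [← h2]; exact h1

lemma wirt_hconj {f g : ℂ → ℂ} {z : ℂ} (hf : AnalyticAt ℂ f z) (hg : AnalyticAt ℂ g z) :
    DifferentiableAt ℝ (fun x => f x * conj (g x)) z ∧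
    wirt (fun x => f x * conj (g x)) z = deriv f z * conj (g z) ∧
    wirtb (fun x => f x * conj (g x)) z = f z * conj (deriv g z) := by
  have hf' : DifferentiableAt ℝ f z := hf.differentiableAt.restrictScalars ℝ
  have hg' : DifferentiableAt ℝ g z := hg.differentiableAt.restrictScalars ℝ
  have hg'' : DifferentiableAt ℝ (fun x => conj (g x)) z :=
    Complex.conjCLE.toContinuousLinearMap.differentiableAt.comp z hg'
  have h1 := wirt_mul_aux hf' hg''
  have h2 := wirt_conj_aux hg'
  have h3 := wirt_hol_aux hf.differentiableAt
  have h4 := wirt_hol_aux hg.differentiableAt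
  refine ⟨hf'.mul hg'', ?_, ?_⟩
  · rw [h1.1, h2.1, h3.1, h4.2]; simp
  · rw [h1.2, h2.2, h3.2, h4.1]; simp

lemma wirt_pairsum {f g f' g' : ℂ → ℂ} {z : ℂ} (hf : AnalyticAt ℂ f z) (hg : AnalyticAt ℂ g z)
    (hf' : AnalyticAt ℂ f' z) (hg' : AnalyticAt ℂ g' z) :
    wirt (fun x => f x * conj (g x) + f' x * conj (g' x)) z =
      deriv f z * conj (g z) + deriv f' z * conj (g' z) ∧
    wirtb (fun x => f x * conj (g x) + f' x * conj (g' x)) z =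
      f z * conj (deriv g z) + f' z * conj (deriv g' z) := by
  have h1 := wirt_hconj hf hg
  have h2 := wirt_hconj hf' hg'
  have h3 := wirt_add_aux h1.1 h2.1
  rw [h3.1, h3.2, h1.2.1, h1.2.2, h2.2.1, h2.2.2]
  exact ⟨rfl, rfl⟩

/-- complexification -/
def cw (w : ℂ → ℝ) : ℂ → ℂ := fun x => (w x : ℂ)

lemma PairAt.wirt {w : ℂ → ℝ} {Y Z : ℂ → ℂ} {z : ℂ} (h : PairAt w Y Z z) :
    wirt (cw w) z = deriv Y z * conj (Y z) + deriv Z z * conj (Z z) ∧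
    wirtb (cw w) z = Y z * conj (deriv Y z) + Z z * conj (deriv Z z) := by
  have e : cw w =ᶠ[𝓝 z] fun x => Y x * conj (Y x) + Z x * conj (Z x) := by
    filter_upwards [h.2.2] with x hx using hx.2
  rw [wirt_congr e, wirtb_congr e]
  exact wirt_pairsum h.1 h.1 h.2.1 h.2.1

lemma PairAt.wirt2 {w : ℂ → ℝ} {Y Z : ℂ → ℂ} {z : ℂ} (h : PairAt w Y Z z) :
    _root_.wirt (_root_.wirt (cw w)) z = deriv (deriv Y) z * conj (Y z) + deriv (deriv Z) z * conj (Z z) ∧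
    wirtb (_root_.wirt (cw w)) z =
      deriv Y z * conj (deriv Y z) + deriv Z z * conj (deriv Z z) := by
  have e : _root_.wirt (cw w) =ᶠ[𝓝 z] fun x => deriv Y x * conj (Y x) + deriv Z x * conj (Z x) := by
    filter_upwards [h.eventually] with x hx using hx.wirt.1
  rw [wirt_congr e, wirtb_congr e]
  exact wirt_pairsum h.1.deriv h.1 h.2.1.deriv h.2.1

lemma PairAt.wr {w : ℂ → ℝ} {Y Z : ℂ → ℂ} {z : ℂ} (h : PairAt w Y Z z) :
    Y z * deriv (deriv Z) z = deriv (deriv Y) z * Z z := by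
  have e : (fun x => Y x * deriv Z x - deriv Y x * Z x) =ᶠ[𝓝 z] fun _ => 1 := by
    filter_upwards [h.2.2] with x hx using hx.1
  have h1 := e.deriv_eq
  rw [deriv_fun_sub, deriv_fun_mul, deriv_fun_mul, deriv_const] at h1
  · linear_combination h1
  · exact h.1.deriv.differentiableAt
  · exact h.2.1.differentiableAt
  · exact h.1.differentiableAt
  · exact h.2.1.deriv.differentiableAt
  · exact h.1.differentiableAt.mul h.2.1.deriv.differentiableAt
  · exact h.1.deriv.differentiableAt.mul h.2.1.differentiableAt

lemma PairAt.pos {w : ℂ → ℝ} {Y Z : ℂ → ℂ} {z : ℂ} (h : PairAt w Y Z z) : 0 < w z := by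
  obtain ⟨h1, h2⟩ := h.2.2.self_of_nhds
  have h3 : w z = ‖Y z‖ ^ 2 + ‖Z z‖ ^ 2 := by
    rw [Complex.mul_conj', Complex.mul_conj'] at h2
    exact_mod_cast h2
  have : Y z ≠ 0 ∨ Z z ≠ 0 := by
    by_contra hc
    push Not at hc
    rw [hc.1, hc.2] at h1
    simp at h1
  rw [h3]
  rcases this with h | h
  · have := norm_pos_iff.2 h; positivity
  · have := norm_pos_iff.2 h; positivity

lemma PairAt.ode {w : ℂ → ℝ} {Y Z : ℂ → ℂ} {z : ℂ} (h : PairAt w Y Z z) :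
    deriv (deriv Y) z * (w z : ℂ) = _root_.wirt (_root_.wirt (cw w)) z * Y z ∧
    deriv (deriv Z) z * (w z : ℂ) = _root_.wirt (_root_.wirt (cw w)) z * Z z := by
  rw [h.wirt2.1, h.2.2.self_of_nhds.2]
  have := h.wr
  constructor
  · linear_combination (-conj (Z z)) * this
  · linear_combination (conj (Y z)) * this

lemma su2_alg {y1 y2 y1' y2' z1 z2 z1' z2' p1 p2 p1' p2' s1 s2 s1' s2' : ℂ}
    (hy : y1 * y2' - y1' * y2 = 1) (hs : s1 * s2' - s1' * s2 = 1)
    (h11 : y1 * p1 + y2 * p2 = z1 * s1 + z2 * s2)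
    (h12 : y1' * p1 + y2' * p2 = z1' * s1 + z2' * s2)
    (h21 : y1 * p1' + y2 * p2' = z1 * s1' + z2 * s2')
    (h22 : y1' * p1' + y2' * p2' = z1' * s1' + z2' * s2') :
    z1 * y2' - z1' * y2 = s2' * p1 - s2 * p1' ∧ y1 * z1' - y1' * z1 = s2' * p2 - s2 * p2' := by
  constructor
  · linear_combination (-(s2' * y2')) * h11 + s2 * y2' * h21 + s2' * y2 * h12 - s2 * y2 * h22
      + (s2' * p1 - s2 * p1') * hy - (z1 * y2' - z1' * y2) * hs
  · linear_combination (s2' * y1') * h11 - s2 * y1' * h21 - s2' * y1 * h12 + s2 * y1 * h22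
      + (s2' * p2 - s2 * p2') * hy - (y1 * z1' - y1' * z1) * hs

lemma pair_unique {w : ℂ → ℝ} {U S : Set ℂ} (hU : IsOpen U) (hUc : IsPreconnected U)
    (hUne : U.Nonempty) (hS : S.Countable) (hSc : IsClosed S) {Y1 Y2 Z1 Z2 : ℂ → ℂ}
    (hY : ∀ z ∈ U, z ∉ S → PairAt w Y1 Y2 z) (hZ : ∀ z ∈ U, z ∉ S → PairAt w Z1 Z2 z) :
    ∃ a b : ℂ, a * conj a + b * conj b = 1 ∧ ∀ z ∈ U, z ∉ S →
      Z1 z = a * Y1 z + b * Y2 z ∧ Z2 z = - conj b * Y1 z + conj a * Y2 z := by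
  have key : ∀ F : ℂ → ℂ, (∀ z ∈ U, z ∉ S → AnalyticAt ℂ F z ∧
      deriv (deriv F) z * (w z : ℂ) = wirt (wirt (cw w)) z * F z) →
      ∀ G : ℂ → ℂ, (∀ z ∈ U, z ∉ S → AnalyticAt ℂ G z ∧
      deriv (deriv G) z * (w z : ℂ) = wirt (wirt (cw w)) z * G z) →
      ∀ x ∈ U, x ∉ S → ∀ y ∈ U, y ∉ S →
        F x * deriv G x - deriv F x * G x = F y * deriv G y - deriv F y * G y := by
    intro F hF G hG
    have hd : ∀ z ∈ U, z ∉ S → HasDerivAt (fun x => F x * deriv G x - deriv F x * G x) 0 z := by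
      intro z hz hzS
      obtain ⟨f1, f2⟩ := hF z hz hzS
      obtain ⟨g1, g2⟩ := hG z hz hzS
      have h := (f1.differentiableAt.hasDerivAt.mul g1.deriv.differentiableAt.hasDerivAt).sub
        (f1.deriv.differentiableAt.hasDerivAt.mul g1.differentiableAt.hasDerivAt)
      have h0 : (deriv F z * deriv G z + F z * deriv (deriv G) z -
          (deriv (deriv F) z * G z + deriv F z * deriv G z)) = 0 := ?_
      · rw [h0] at h; exact h
      have hw : (w z : ℂ) ≠ 0 := by exact_mod_cast (hY z hz hzS).pos.ne'
      apply mul_right_cancel₀ hw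
      linear_combination (-G z) * f2 + F z * g2
    exact const_off hU hUc hS hSc (fun x => F x * deriv G x - deriv F x * G x)
      (fun z hz hzS => (hd z hz hzS).differentiableAt) (fun z hz hzS => (hd z hz hzS).deriv)
  have hY1 : ∀ z ∈ U, z ∉ S → AnalyticAt ℂ Y1 z ∧
      deriv (deriv Y1) z * (w z : ℂ) = wirt (wirt (cw w)) z * Y1 z :=
    fun z hz hzS => ⟨(hY z hz hzS).1, (hY z hz hzS).ode.1⟩
  have hY2 : ∀ z ∈ U, z ∉ S → AnalyticAt ℂ Y2 z ∧
      deriv (deriv Y2) z * (w z : ℂ) = wirt (wirt (cw w)) z * Y2 z :=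
    fun z hz hzS => ⟨(hY z hz hzS).2.1, (hY z hz hzS).ode.2⟩
  have hZ1 : ∀ z ∈ U, z ∉ S → AnalyticAt ℂ Z1 z ∧
      deriv (deriv Z1) z * (w z : ℂ) = wirt (wirt (cw w)) z * Z1 z :=
    fun z hz hzS => ⟨(hZ z hz hzS).1, (hZ z hz hzS).ode.1⟩
  have hdense : Dense Sᶜ := hS.dense_compl ℂ
  obtain ⟨p, hpU, hpS⟩ := hdense.inter_open_nonempty U hU hUne
  set a := Z1 p * deriv Y2 p - deriv Z1 p * Y2 p with ha
  set b := Y1 p * deriv Z1 p - deriv Y1 p * Z1 p with hb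
  have hza : ∀ z ∈ U, z ∉ S → Z1 z * deriv Y2 z - deriv Z1 z * Y2 z = a := fun z hz hzS =>
    key _ hZ1 _ hY2 z hz hzS p hpU hpS
  have hzb : ∀ z ∈ U, z ∉ S → Y1 z * deriv Z1 z - deriv Y1 z * Z1 z = b := fun z hz hzS =>
    key _ hY1 _ hZ1 z hz hzS p hpU hpS
  have main : ∀ z ∈ U, z ∉ S → a * conj a + b * conj b = 1 ∧
      Z1 z = a * Y1 z + b * Y2 z ∧ Z2 z = - conj b * Y1 z + conj a * Y2 z := by
    intro z hz hzS
    have y := hY z hz hzS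
    have s := hZ z hz hzS
    have e0 := y.2.2.self_of_nhds
    have e0' := s.2.2.self_of_nhds
    have e1 := y.wirt
    have e1' := s.wirt
    have e2 := y.wirt2.2
    have e2' := s.wirt2.2
    have hy1 := e0.1
    have hs1 := e0'.1
    have hs2 := congrArg conj e0'.1
    simp only [map_sub, map_mul, map_one] at hs2
    have h11 := e0.2.symm.trans e0'.2
    have h12 := e1.1.symm.trans e1'.1
    have h21 := e1.2.symm.trans e1'.2
    have h22 := e2.symm.trans e2'
    obtain ⟨r1, r2⟩ := su2_alg hy1 hs2 h11 h12 h21 h22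
    rw [hza z hz hzS] at r1
    rw [hzb z hz hzS] at r2
    have ha' : conj a = deriv Z2 z * Y1 z - Z2 z * deriv Y1 z := by rw [r1]; simp
    have hb' : conj b = deriv Z2 z * Y2 z - Z2 z * deriv Y2 z := by rw [r2]; simp
    refine ⟨?_, ?_, ?_⟩
    · rw [ha', hb', ← hza z hz hzS, ← hzb z hz hzS]
      linear_combination (Y1 z * deriv Y2 z - deriv Y1 z * Y2 z) * hs1 + hy1
    · rw [← hza z hz hzS, ← hzb z hz hzS]
      linear_combination (-Z1 z) * hy1
    · rw [ha', hb']
      linear_combination (-Z2 z) * hy1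
  exact ⟨a, b, (main p hpU hpS).1, fun z hz hzS => (main z hz hzS).2⟩

lemma PairAt.rot {w : ℂ → ℝ} {Y Z : ℂ → ℂ} {z : ℂ} (h : PairAt w Y Z z) {a b : ℂ}
    (hab : a * conj a + b * conj b = 1) :
    PairAt w (fun x => a * Y x + b * Z x) (fun x => - conj b * Y x + conj a * Z x) z := by
  refine ⟨(analyticAt_const.mul h.1).add (analyticAt_const.mul h.2.1),
    (analyticAt_const.mul h.1).add (analyticAt_const.mul h.2.1), ?_⟩
  filter_upwards [h.eventually] with x hx
  obtain ⟨h1, h2⟩ := hx.2.2.self_of_nhds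
  have d : ∀ c d : ℂ, deriv (fun x => c * Y x + d * Z x) x = c * deriv Y x + d * deriv Z x :=
    fun c d => ((hx.1.differentiableAt.hasDerivAt.const_mul c).add
      (hx.2.1.differentiableAt.hasDerivAt.const_mul d)).deriv
  rw [d, d, h2]
  simp only [map_add, map_mul, map_neg, Complex.conj_conj]
  constructor
  · linear_combination (a * conj a + b * conj b) * h1 + hab
  · linear_combination (-(Y x * conj (Y x) + Z x * conj (Z x))) * hab

/-- germ condition for gluing -/
def QQ (w : ℂ → ℝ) (S : Set ℂ) (z : ℂ) (Y : ℂ → ℂ × ℂ) : Prop :=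
  (z ∉ S → PairAt w (fun x => (Y x).1) (fun x => (Y x).2) z) ∧ (z ∈ S → Y z = 0) ∧
  MeromorphicAt (fun x => (Y x).1) z ∧ MeromorphicAt (fun x => (Y x).2) z

lemma QQ_loc (w : ℂ → ℝ) (S : Set ℂ) : ∀ z Y Z, Y =ᶠ[𝓝 z] Z → QQ w S z Y → QQ w S z Z := by
  intro z Y Z h ⟨h1, h2, h3, h4⟩
  have e1 : (fun x => (Y x).1) =ᶠ[𝓝 z] (fun x => (Z x).1) := by
    filter_upwards [h] with x hx; rw [hx]
  have e2 : (fun x => (Y x).2) =ᶠ[𝓝 z] (fun x => (Z x).2) := by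
    filter_upwards [h] with x hx; rw [hx]
  refine ⟨fun hz => (h1 hz).congr e1 e2, fun hz => by rw [← h.eq_of_nhds]; exact h2 hz,
    h3.congr (e1.filter_mono nhdsWithin_le_nhds), h4.congr (e2.filter_mono nhdsWithin_le_nhds)⟩

lemma QQ.rot {w : ℂ → ℝ} {S : Set ℂ} {z : ℂ} {Y : ℂ → ℂ × ℂ} (h : QQ w S z Y) {a b : ℂ}
    (hab : a * conj a + b * conj b = 1) :
    QQ w S z (fun x => (a * (Y x).1 + b * (Y x).2, - conj b * (Y x).1 + conj a * (Y x).2)) := by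
  obtain ⟨h1, h2, h3, h4⟩ := h
  refine ⟨fun hz => (h1 hz).rot hab, fun hz => ?_, ?_, ?_⟩
  · simp [h2 hz]
  · exact ((MeromorphicAt.const a z).mul h3).add ((MeromorphicAt.const b z).mul h4)
  · exact ((MeromorphicAt.const _ z).mul h3).add ((MeromorphicAt.const _ z).mul h4)

lemma QQ_ext (w : ℂ → ℝ) {S : Set ℂ} (hS : S.Countable) (hSc : IsClosed S) :
    ∀ (U V : Set ℂ) (Y Z : ℂ → ℂ × ℂ), IsOpen U → IsOpen V → IsPreconnected (U ∩ V) →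
      (U ∩ V).Nonempty → (∀ z ∈ U, QQ w S z Y) → (∀ z ∈ V, QQ w S z Z) →
      ∃ Z', (∀ z ∈ V, QQ w S z Z') ∧ ∀ z ∈ U ∩ V, Z' z = Y z := by
  intro U V Y Z hU hV hc hne hY hZ
  obtain ⟨a, b, hab, h⟩ := pair_unique (hU.inter hV) hc hne hS hSc
    (fun z hz hzS => (hZ z hz.2).1 hzS) (fun z hz hzS => (hY z hz.1).1 hzS)
  refine ⟨_, fun z hz => (hZ z hz).rot hab, fun z hz => ?_⟩
  by_cases hzS : z ∈ S
  · rw [(hY z hz.1).2.1 hzS]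
    simp [(hZ z hz.2).2.1 hzS]
  · have := h z hz hzS
    exact Prod.ext this.1.symm this.2.symm

/-- the conformal-factor operator -/
noncomputable def KK (w : ℂ → ℝ) (z : ℂ) : ℂ :=
  cw w z * wirtb (wirt (cw w)) z - wirt (cw w) z * wirtb (cw w) z

/-- w attached to u -/
noncomputable def wof (u : ℂ → ℝ) (z : ℂ) : ℝ := Real.sqrt 8 * Real.exp (-(u z) / 2)

lemma KK_wof {u : ℂ → ℝ} {z : ℂ} (hu : ∀ᶠ x in 𝓝 z, ContDiffAt ℝ ∞ u x) :
    KK (wof u) z = -((lapl u z * Real.exp (-(u z)) : ℝ) : ℂ) := by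
  have hU : ∀ x, ContDiffAt ℝ ∞ u x → ContDiffAt ℝ ∞ (cw u) x := fun x hx =>
    Complex.ofRealCLM.contDiff.contDiffAt.comp x hx
  have h1 : ∀ x, ContDiffAt ℝ ∞ u x →
      wirt (cw (wof u)) x = -(1/2) * (wirt (cw u) x * cw (wof u) x) ∧
      wirtb (cw (wof u)) x = -(1/2) * (wirtb (cw u) x * cw (wof u) x) ∧
      DifferentiableAt ℝ (cw (wof u)) x := by
    intro x hx
    have hd : HasFDerivAt u (fderiv ℝ u x) x :=
      (hx.differentiableAt (by simp)).hasFDerivAt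
    have hw : HasFDerivAt (wof u) ((-(1/2) * wof u x) • fderiv ℝ u x) x := by
      have := (((hd.neg.mul_const (1/2)).exp).const_mul (Real.sqrt 8))
      refine HasFDerivAt.congr_fderiv (this.congr_of_eventuallyEq ?_) ?_
      · refine Eventually.of_forall fun y => ?_
        simp [wof, div_eq_mul_inv]
      · ext <;> simp [wof, div_eq_mul_inv] <;> ring
    have hcw := (Complex.ofRealCLM.hasFDerivAt (x := wof u x)).comp x hw
    have hcu := (Complex.ofRealCLM.hasFDerivAt (x := u x)).comp x hd
    have e1 : fderiv ℝ (cw (wof u)) x = _ := hcw.fderiv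
    have e2 : fderiv ℝ (cw u) x = _ := hcu.fderiv
    have e3 : ∀ v, fderiv ℝ (cw (wof u)) x v = (-(1/2) * cw (wof u) x) * fderiv ℝ (cw u) x v := by
      intro v
      rw [e1, e2]
      simp [cw]
    have := wirt_of_forall (g := cw (wof u)) (z := x) (a := -(1/2) * (wirt (cw u) x * cw (wof u) x))
      (b := -(1/2) * (wirtb (cw u) x * cw (wof u) x)) (by
        intro v; rw [e3, fderiv_eq_wirt (cw u)]; ring)
    exact ⟨this.1, this.2, hcw.differentiableAt⟩
  have hz := hu.self_of_nhds
  have e : wirt (cw (wof u)) =ᶠ[𝓝 z] fun x => -(1/2) * (wirt (cw u) x * cw (wof u) x) := by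
    filter_upwards [hu] with x hx using (h1 x hx).1
  have d1 : DifferentiableAt ℝ (wirt (cw u)) z := smooth_diff (smooth_wirt (hU z hz))
  have d2 := (h1 z hz).2.2
  have e2 : wirtb (wirt (cw (wof u))) z = -(1/2) * (wirtb (wirt (cw u)) z * cw (wof u) z +
      wirt (cw u) z * wirtb (cw (wof u)) z) := by
    rw [wirtb_congr e]
    have := (wirt_mul_aux (f := fun _ => -(1/2 : ℂ)) (differentiableAt_const _) (d1.mul d2)).2
    have h0 : wirtb (fun _ => -(1/2 : ℂ)) z = 0 := (wirt_hol_aux (differentiableAt_const _)).2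
    rw [h0] at this
    refine this.trans ?_
    have h3 := (wirt_mul_aux d1 d2).2
    simp only [zero_mul, zero_add]
    congr 1
  unfold KK
  rw [e2, (h1 z hz).1, (h1 z hz).2.1]
  have h4 := wirt_wirtb_lapl hz
  rw [show (fun x => (u x : ℂ)) = cw u from rfl, wirt_wirtb_comm (hU z hz)] at h4
  have h5 : cw (wof u) z * cw (wof u) z = 8 * ((Real.exp (-(u z)) : ℝ) : ℂ) := by
    simp only [cw, wof]
    rw [← Complex.ofReal_mul]
    have : Real.sqrt 8 * Real.exp (-(u z) / 2) * (Real.sqrt 8 * Real.exp (-(u z) / 2)) =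
        8 * Real.exp (-(u z)) := by
      have h6 : Real.exp (-(u z)) = Real.exp (-(u z) / 2) * Real.exp (-(u z) / 2) := by
        rw [← Real.exp_add]; congr 1; ring
      rw [h6]
      linear_combination (Real.exp (-(u z) / 2) * Real.exp (-(u z) / 2)) *
        (Real.mul_self_sqrt (show (0:ℝ) ≤ 8 by norm_num))
    rw [this]; push_cast; ring
  push_cast at h5 ⊢
  linear_combination (-(1/2) * wirtb (wirt (cw u)) z) * h5 - Complex.exp (-(u z : ℂ)) * h4

lemma PairAt.KK {w : ℂ → ℝ} {Y Z : ℂ → ℂ} {z : ℂ} (h : PairAt w Y Z z) : KK w z = 1 := by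
  obtain ⟨h1, h2⟩ := h.2.2.self_of_nhds
  unfold _root_.KK
  rw [h.wirt2.2, h.wirt.1, h.wirt.2, show cw w z = (w z : ℂ) from rfl, h2]
  have h3 := congrArg conj h1
  simp only [map_sub, map_mul, map_one] at h3
  linear_combination (conj (Y z) * conj (deriv Z z) - conj (deriv Y z) * conj (Z z)) * h1 + h3

lemma wirt_A3 {A f g : ℂ → ℂ} {z : ℂ} (hA : DifferentiableAt ℝ A z) (hf : AnalyticAt ℂ f z)
    (hg : AnalyticAt ℂ g z) :
    DifferentiableAt ℝ (fun x => A x * (f x * conj (g x))) z ∧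
    wirt (fun x => A x * (f x * conj (g x))) z =
      wirt A z * (f z * conj (g z)) + A z * (deriv f z * conj (g z)) ∧
    wirtb (fun x => A x * (f x * conj (g x))) z =
      wirtb A z * (f z * conj (g z)) + A z * (f z * conj (deriv g z)) := by
  have h1 := wirt_hconj hf hg
  have h2 := wirt_mul_aux hA h1.1
  rw [h1.2.1, h1.2.2] at h2
  exact ⟨hA.mul h1.1, h2⟩

lemma wirt_div {N W : ℂ → ℂ} {z : ℂ} (hN : ContDiffAt ℝ ∞ N z) (hW : ContDiffAt ℝ ∞ W z)
    (h0 : W z ≠ 0) (h : wirtb N z * W z = N z * wirtb W z) :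
    DifferentiableAt ℂ (fun x => N x / W x) z := by
  have hq : DifferentiableAt ℝ (fun x => N x / W x) z :=
    smooth_diff (hN.mul (hW.inv h0))
  refine differentiableAt_of_wirtb hq ?_
  have h1 := (wirt_mul_aux hq (smooth_diff hW)).2
  have e : (fun x => N x / W x * W x) =ᶠ[𝓝 z] N := by
    filter_upwards [hW.continuousAt.eventually_ne h0] with x hx
    exact div_mul_cancel₀ _ hx
  rw [wirtb_congr e] at h1
  have h2 : wirtb (fun x => N x / W x) z * (W z * W z) = 0 := by
    have : N z / W z * W z = N z := div_mul_cancel₀ _ h0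
    linear_combination (-W z) * h1 + h - wirtb W z * this
  rcases mul_eq_zero.1 h2 with h3 | h3
  · exact h3
  · exact absurd h3 (mul_ne_zero h0 h0)

/-- local goodness -/
def GoodAt (w : ℂ → ℝ) (z : ℂ) : Prop :=
  ∀ᶠ x in 𝓝 z, ContDiffAt ℝ ∞ (cw w) x ∧ 0 < w x ∧ KK w x = 1

lemma wirtb_real {w : ℂ → ℝ} {z : ℂ} (h : DifferentiableAt ℝ (cw w) z) :
    wirtb (cw w) z = conj (wirt (cw w) z) := by
  have h1 := (wirt_conj_aux h).2
  have e : (fun x => conj (cw w x)) = cw w := by funext x; simp [cw]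
  rw [e] at h1
  exact h1

lemma local_pair {w : ℂ → ℝ} {z₀ : ℂ} (hg : GoodAt w z₀) : ∃ Y Z, PairAt w Y Z z₀ := by
  set W := cw w with hW
  set P := wirt W with hP
  set Pb := wirtb W with hPb
  set N := wirt P with hN
  set L := wirtb P with hL
  have hg2 := eventually_eventually_nhds.2 hg
  -- basic identity
  have fact : ∀ x, GoodAt w x → ContDiffAt ℝ ∞ W x ∧ W x ≠ 0 ∧ Pb x = conj (P x) ∧
      wirt Pb x = L x ∧ wirt L x * W x = N x * Pb x ∧ wirtb N x * W x = N x * Pb x := by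
    intro x hx
    have hx' := hx.self_of_nhds
    have s1 : ContDiffAt ℝ ∞ W x := hx'.1
    have h0 : W x ≠ 0 := by simp only [hW, cw]; exact_mod_cast hx'.2.1.ne'
    have h1 : wirt Pb x = L x := wirt_wirtb_comm s1
    have h2 : wirt L x = wirtb N x := wirt_wirtb_comm (smooth_wirt s1)
    have e : (fun y => W y * L y - P y * Pb y) =ᶠ[𝓝 x] fun _ => 1 := by
      filter_upwards [hx] with y hy using hy.2.2
    have sW := smooth_diff s1
    have sP := smooth_diff (smooth_wirt s1)
    have sPb := smooth_diff (smooth_wirtb s1)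
    have sL := smooth_diff (smooth_wirtb (smooth_wirt s1))
    have h3 := wirt_congr e
    rw [(wirt_sub_aux (f := fun y => W y * L y) (g := fun y => P y * Pb y)
      (sW.mul sL) (sP.mul sPb)).1] at h3
    have h4 : wirt (fun _ => (1:ℂ)) x = 0 := by
      rw [(wirt_hol_aux (differentiableAt_const _)).1]; simp
    have h5 := (wirt_mul_aux sW sL).1
    have h6 := (wirt_mul_aux sP sPb).1
    have h7 : wirt L x * W x = N x * Pb x := by
      have : wirt (fun x => W x * L x) x - wirt (fun x => P x * Pb x) x = 0 := h3.trans h4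
      rw [h5, h6, h1] at this
      simp only [← hP, ← hN] at this
      linear_combination this
    exact ⟨s1, h0, wirtb_real sW, h1, h7, h2 ▸ h7⟩
  have hqa : AnalyticAt ℂ (fun x => N x / W x) z₀ := by
    rw [Complex.analyticAt_iff_eventually_differentiableAt]
    filter_upwards [hg2] with x hx
    obtain ⟨s1, h0, _, _, _, h⟩ := fact x hx
    exact wirt_div (smooth_wirt (smooth_wirt s1)) s1 h0 h
  obtain ⟨r0, hr0, hode⟩ := local_ode _ hqa
  obtain ⟨r1, hr1, hball⟩ := Metric.eventually_nhds_iff_ball.1 hg2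
  set r := min r0 r1
  have hr : 0 < r := lt_min hr0 hr1
  have hz0 : z₀ ∈ ball z₀ r := mem_ball_self hr
  obtain ⟨f1, f2, f3, f4, f5, _⟩ := fact z₀ hg2.self_of_nhds
  set s : ℂ := ((Real.sqrt (w z₀) : ℝ) : ℂ) with hs
  have hwpos : 0 < w z₀ := hg.self_of_nhds.2.1
  have hs2 : s * s = W z₀ := by
    rw [hs, ← Complex.ofReal_mul, Real.mul_self_sqrt hwpos.le]; rfl
  have hs0 : s ≠ 0 := by
    intro h; rw [h, zero_mul] at hs2; exact f2 hs2.symm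
  have hsc : conj s = s := Complex.conj_ofReal _
  obtain ⟨y1, hy1d, hy1o, hy1v, hy1v'⟩ := hode s (P z₀ / s)
  obtain ⟨y2, hy2d, hy2o, hy2v, hy2v'⟩ := hode 0 (1 / s)
  have an : ∀ y : ℂ → ℂ, DifferentiableOn ℂ y (ball z₀ r0) → ∀ x ∈ ball z₀ r, AnalyticAt ℂ y x :=
    fun y hy x hx => hy.analyticAt (isOpen_ball.mem_nhds (ball_subset_ball (min_le_left _ _) hx))
  have Qzero : ∀ f g : ℂ → ℂ, DifferentiableOn ℂ f (ball z₀ r0) →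
      DifferentiableOn ℂ g (ball z₀ r0) →
      (∀ z ∈ ball z₀ r0, deriv (deriv f) z = N z / W z * f z) →
      (∀ z ∈ ball z₀ r0, deriv (deriv g) z = N z / W z * g z) →
      ∀ x ∈ ball z₀ r,
        W x * (deriv f x * conj (deriv g x)) - P x * (f x * conj (deriv g x))
          - Pb x * (deriv f x * conj (g x)) + L x * (f x * conj (g x)) =
        W z₀ * (deriv f z₀ * conj (deriv g z₀)) - P z₀ * (f z₀ * conj (deriv g z₀))
          - Pb z₀ * (deriv f z₀ * conj (g z₀)) + L z₀ * (f z₀ * conj (g z₀)) := by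
    intro f g hf hgd hfo hgo
    have hder : ∀ x ∈ ball z₀ r, DifferentiableAt ℝ (fun x => W x * (deriv f x * conj (deriv g x)) -
          P x * (f x * conj (deriv g x))
          - Pb x * (deriv f x * conj (g x)) + L x * (f x * conj (g x))) x ∧
        fderiv ℝ (fun x => W x * (deriv f x * conj (deriv g x)) -
          P x * (f x * conj (deriv g x))
          - Pb x * (deriv f x * conj (g x)) + L x * (f x * conj (g x))) x = 0 := by
      intro x hx
      have hx0 : x ∈ ball z₀ r0 := ball_subset_ball (min_le_left _ _) hx
      obtain ⟨s1, h0, h1, h2, h3, h4⟩ := fact x (hball x (ball_subset_ball (min_le_right _ _) hx))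
      have af := an f hf x hx
      have ag := an g hgd x hx
      have sW := smooth_diff s1
      have sP : DifferentiableAt ℝ P x := smooth_diff (smooth_wirt s1)
      have sPb : DifferentiableAt ℝ Pb x := smooth_diff (smooth_wirtb s1)
      have sL : DifferentiableAt ℝ L x := smooth_diff (smooth_wirtb (smooth_wirt s1))
      have t1 := wirt_A3 sW af.deriv ag.deriv
      have t2 := wirt_A3 sP af ag.deriv
      have t3 := wirt_A3 sPb af.deriv ag
      have t4 := wirt_A3 sL af ag
      have u1 := wirt_sub_aux t1.1 t2.1
      have u2 := wirt_sub_aux (t1.1.sub t2.1) t3.1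
      have u3 := wirt_add_aux ((t1.1.sub t2.1).sub t3.1) t4.1
      have d := (((t1.1.sub t2.1).sub t3.1).add t4.1)
      refine ⟨d, ?_⟩
      have hPx : wirt W x = P x := rfl
      have hPbx : wirtb W x = Pb x := rfl
      have hNx : wirt P x = N x := rfl
      have hLx : wirtb P x = L x := rfl
      have hqx : N x / W x * W x = N x := div_mul_cancel₀ _ h0
      -- wirtb Pb = conj N
      have hPbb : wirtb Pb x = conj (N x) := by
        have e : Pb =ᶠ[𝓝 x] fun y => conj (P y) := by
          filter_upwards [eventually_eventually_nhds.2
            (hball x (ball_subset_ball (min_le_right _ _) hx))] with y hy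
          exact (fact y hy).2.2.1
        rw [wirtb_congr e, (wirt_conj_aux sP).2]
      have hLb : conj (L x) = L x := by
        have hx' := (hball x (ball_subset_ball (min_le_right _ _) hx)).self_of_nhds.2.2
        have hk : W x * L x - P x * Pb x = 1 := hx'
        have hk2 := congrArg conj hk
        simp only [map_sub, map_mul, map_one] at hk2
        have hWc : conj (W x) = W x := by simp [hW, cw]
        rw [hWc, h1] at hk2
        rw [h1] at hk
        simp only [Complex.conj_conj] at hk2
        apply mul_left_cancel₀ h0
        linear_combination hk2 - hk
      have hLz : wirtb L x * W x = conj (N x) * P x := by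
        have e : L =ᶠ[𝓝 x] fun y => conj (L y) := by
          filter_upwards [eventually_eventually_nhds.2
            (hball x (ball_subset_ball (min_le_right _ _) hx))] with y hy
          have hk : W y * L y - P y * Pb y = 1 := hy.self_of_nhds.2.2
          have hk2 := congrArg conj hk
          simp only [map_sub, map_mul, map_one] at hk2
          have hWc : conj (W y) = W y := by simp [hW, cw]
          rw [hWc, (fact y hy).2.2.1] at hk2
          rw [(fact y hy).2.2.1] at hk
          simp only [Complex.conj_conj] at hk2
          apply mul_left_cancel₀ (fact y hy).2.1
          linear_combination hk - hk2
        rw [wirtb_congr e, (wirt_conj_aux sL).2]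
        have := congrArg conj h3
        simp only [map_mul, h1, Complex.conj_conj] at this
        have hWc : conj (W x) = W x := by simp [hW, cw]
        rwa [hWc] at this
      have w1 : wirt (fun x => W x * (deriv f x * conj (deriv g x)) -
          P x * (f x * conj (deriv g x))
          - Pb x * (deriv f x * conj (g x)) + L x * (f x * conj (g x))) x = 0 := by
        refine u3.1.trans ?_
        rw [t4.2.1]
        refine (congrArg (· + _) (u2.1.trans (congrArg₂ (· - ·) (u1.1.trans
          (congrArg₂ (· - ·) t1.2.1 t2.2.1)) t3.2.1))).trans ?_
        simp only [hPx, hNx, h2, hfo x hx0]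
        have h3' : wirt L x = N x / W x * Pb x := by field_simp; exact h3
        rw [h3']
        linear_combination (f x * conj (deriv g x)) * hqx
      have w2 : wirtb (fun x => W x * (deriv f x * conj (deriv g x)) -
          P x * (f x * conj (deriv g x))
          - Pb x * (deriv f x * conj (g x)) + L x * (f x * conj (g x))) x = 0 := by
        refine u3.2.trans ?_
        rw [t4.2.2]
        refine (congrArg (· + _) (u2.2.trans (congrArg₂ (· - ·) (u1.2.trans
          (congrArg₂ (· - ·) t1.2.2 t2.2.2)) t3.2.2))).trans ?_
        simp only [hPbx, hLx, hPbb, hgo x hx0, map_mul, map_div₀]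
        have hWc : conj (W x) = W x := by simp [hW, cw]
        have h3' : wirtb L x = conj (N x) / W x * P x := by field_simp; exact hLz
        have hqc : conj (N x) / W x * W x = conj (N x) := div_mul_cancel₀ _ h0
        rw [h3', hWc]
        linear_combination (deriv f x * conj (g x)) * hqc
      ext
      all_goals simp [fderiv_eq_wirt, w1, w2]
    intro x hx
    exact isOpen_ball.is_const_of_fderiv_eq_zero (𝕜 := ℝ) isPreconnected_ball
      (fun y hy => (hder y hy).1.differentiableWithinAt) (fun y hy => (hder y hy).2) hx hz0
  have wr : ∀ x ∈ ball z₀ r, y1 x * deriv y2 x - deriv y1 x * y2 x = 1 := by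
    have hder : ∀ x ∈ ball z₀ r, HasDerivAt (fun x => y1 x * deriv y2 x - deriv y1 x * y2 x) 0 x := by
      intro x hx
      have hx0 : x ∈ ball z₀ r0 := ball_subset_ball (min_le_left _ _) hx
      have a1 := an y1 hy1d x hx
      have a2 := an y2 hy2d x hx
      have h := (a1.differentiableAt.hasDerivAt.mul a2.deriv.differentiableAt.hasDerivAt).sub
        (a1.deriv.differentiableAt.hasDerivAt.mul a2.differentiableAt.hasDerivAt)
      have h0 : (deriv y1 x * deriv y2 x + y1 x * deriv (deriv y2) x -
          (deriv (deriv y1) x * y2 x + deriv y1 x * deriv y2 x)) = 0 := by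
        rw [hy1o x hx0, hy2o x hx0]; ring
      rw [h0] at h; exact h
    intro x hx
    have h := isOpen_ball.is_const_of_deriv_eq_zero isPreconnected_ball
      (fun y hy => (hder y hy).differentiableAt.differentiableWithinAt)
      (fun y hy => (hder y hy).deriv) hx hz0
    refine h.trans ?_
    simp only [hy1v, hy1v', hy2v, hy2v']
    field_simp
    ring
  have hK0 : W z₀ * L z₀ - P z₀ * Pb z₀ = 1 := hg.self_of_nhds.2.2
  refine ⟨y1, y2, an y1 hy1d z₀ hz0, an y2 hy2d z₀ hz0, ?_⟩
  filter_upwards [isOpen_ball.mem_nhds hz0] with x hx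
  refine ⟨wr x hx, ?_⟩
  have q11 := Qzero y1 y1 hy1d hy1d hy1o hy1o x hx
  have q12 := Qzero y1 y2 hy1d hy2d hy1o hy2o x hx
  have q21 := Qzero y2 y1 hy2d hy1d hy2o hy1o x hx
  have q22 := Qzero y2 y2 hy2d hy2d hy2o hy2o x hx
  rw [hy1v, hy1v'] at q11
  rw [hy1v, hy1v', hy2v, hy2v'] at q12 q21
  rw [hy2v, hy2v'] at q22
  have v11 : W z₀ * (P z₀ / s * conj (P z₀ / s)) - P z₀ * (s * conj (P z₀ / s))
      - Pb z₀ * (P z₀ / s * conj s) + L z₀ * (s * conj s) = 1 := by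
    rw [← hK0, map_div₀, hsc, ← f3, ← hs2]; field_simp; ring
  have v12 : W z₀ * (P z₀ / s * conj (1 / s)) - P z₀ * (s * conj (1 / s))
      - Pb z₀ * (P z₀ / s * conj 0) + L z₀ * (s * conj 0) = 0 := by
    rw [map_div₀, map_one, map_zero, hsc, ← hs2]; field_simp; ring
  have v21 : W z₀ * (1 / s * conj (P z₀ / s)) - P z₀ * (0 * conj (P z₀ / s))
      - Pb z₀ * (1 / s * conj s) + L z₀ * (0 * conj s) = 0 := by
    rw [map_div₀, hsc, ← f3, ← hs2]; field_simp; ring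
  have v22 : W z₀ * (1 / s * conj (1 / s)) - P z₀ * (0 * conj (1 / s))
      - Pb z₀ * (1 / s * conj 0) + L z₀ * (0 * conj 0) = 1 := by
    rw [map_div₀, map_one, map_zero, hsc, ← hs2]; field_simp; ring
  rw [v11] at q11
  rw [v12] at q12
  rw [v21] at q21
  rw [v22] at q22
  have hw1 := wr x hx
  have hw2 := congrArg conj hw1
  simp only [map_sub, map_mul, map_one] at hw2
  show W x = _
  linear_combination (y2 x * conj (y2 x)) * q11 - (y2 x * conj (y1 x)) * q12
    - (y1 x * conj (y2 x)) * q21 + (y1 x * conj (y1 x)) * q22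
    - W x * (conj (y1 x) * conj (deriv y2 x) - conj (deriv y1 x) * conj (y2 x)) * hw1 - W x * hw2

lemma PairAt.comp {w : ℂ → ℝ} {Y Z φ ψ : ℂ → ℂ} {z : ℂ} (hφ : AnalyticAt ℂ φ z)
    (hψ : AnalyticAt ℂ ψ z) (h : ∀ᶠ x in 𝓝 z, ψ x ^ 2 * deriv φ x = 1)
    (hp : PairAt w Y Z (φ z)) :
    PairAt (fun x => ‖ψ x‖ ^ 2 * w (φ x)) (fun x => ψ x * Y (φ x)) (fun x => ψ x * Z (φ x)) z := by
  refine ⟨hψ.mul (hp.1.comp hφ), hψ.mul (hp.2.1.comp hφ), ?_⟩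
  have h1 := hφ.continuousAt.eventually hp.eventually
  filter_upwards [h, h1, hφ.eventually_analyticAt, hψ.eventually_analyticAt] with x hx hx1 hx2 hx3
  obtain ⟨ha, hb, hc⟩ := hx1
  have dY : HasDerivAt (fun x => ψ x * Y (φ x)) (deriv ψ x * Y (φ x) +
      ψ x * (deriv Y (φ x) * deriv φ x)) x :=
    hx3.differentiableAt.hasDerivAt.mul
      (ha.differentiableAt.hasDerivAt.comp x hx2.differentiableAt.hasDerivAt)
  have dZ : HasDerivAt (fun x => ψ x * Z (φ x)) (deriv ψ x * Z (φ x) +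
      ψ x * (deriv Z (φ x) * deriv φ x)) x :=
    hx3.differentiableAt.hasDerivAt.mul
      (hb.differentiableAt.hasDerivAt.comp x hx2.differentiableAt.hasDerivAt)
  obtain ⟨h1, h2⟩ := hc.self_of_nhds
  rw [dY.deriv, dZ.deriv]
  constructor
  · linear_combination (ψ x ^ 2 * deriv φ x) * h1 + hx
  · push_cast
    rw [h2]
    simp only [map_mul]
    have : ((‖ψ x‖ : ℂ)) ^ 2 = ψ x * conj (ψ x) := by
      rw [Complex.mul_conj, Complex.normSq_eq_norm_sq]; push_cast; rfl
    rw [this]; ring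

/-- diagonalisation of an `SU(2)` matrix -/
lemma su2_diag {a b : ℂ} (hab : a * conj a + b * conj b = 1) :
    ∃ c d μ : ℂ, c * conj c + d * conj d = 1 ∧ μ * conj μ = 1 ∧
      c * a - d * conj b = μ * c ∧ c * b + d * conj a = μ * d := by
  by_cases hb : b = 0
  · subst hb
    refine ⟨1, 0, a, by simp, by simpa using hab, by simp, by simp⟩
  · have hsq : a.re ^ 2 ≤ 1 := by
      have h := congrArg Complex.re hab
      simp at h
      nlinarith [sq_nonneg a.im, sq_nonneg b.re, sq_nonneg b.im]
    set β := Real.sqrt (1 - a.re ^ 2) with hβ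
    have hβ2 : β * β = 1 - a.re ^ 2 := Real.mul_self_sqrt (by linarith)
    set μ : ℂ := ⟨a.re, β⟩ with hμ
    have hμ1 : μ * conj μ = 1 := by
      apply Complex.ext <;> simp [hμ] <;> nlinarith
    have hμ2 : μ ^ 2 = (a + conj a) * μ - 1 := by
      apply Complex.ext <;> simp [hμ, pow_two] <;> nlinarith
    set N := Complex.normSq b + Complex.normSq (a - μ) with hN
    have hNp : 0 < N := by
      have := Complex.normSq_pos.2 hb
      have := Complex.normSq_nonneg (a - μ)
      linarith
    set s : ℂ := ((Real.sqrt N : ℝ) : ℂ) with hs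
    have hs2 : s * s = N := by rw [hs, ← Complex.ofReal_mul, Real.mul_self_sqrt hNp.le]
    have hs0 : s ≠ 0 := by
      rw [hs]; exact_mod_cast (Real.sqrt_pos.2 hNp).ne'
    have hsc : conj s = s := Complex.conj_ofReal _
    have hN2 : (N : ℂ) = b * conj b + (a - μ) * conj (a - μ) := by
      rw [hN]; push_cast; rw [Complex.mul_conj, Complex.mul_conj]
    refine ⟨conj b / s, (a - μ) / s, μ, ?_, hμ1, ?_, ?_⟩
    · simp only [map_div₀, hsc, Complex.conj_conj]
      field_simp
      rw [pow_two, hs2, hN2]; ring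
    · field_simp; ring
    · field_simp
      linear_combination hab + hμ2

lemma unit_exp {μ : ℂ} (h : μ * conj μ = 1) : ∃ α : ℝ, μ = Complex.exp (Complex.I * α) := by
  have hn : ‖μ‖ = 1 := by
    rw [Complex.mul_conj, Complex.normSq_eq_norm_sq] at h
    have h2 : ‖μ‖ ^ 2 = 1 := by exact_mod_cast h
    nlinarith [norm_nonneg μ]
  refine ⟨μ.arg, ?_⟩
  have := Complex.norm_mul_exp_arg_mul_I μ
  rw [hn] at this
  rw [mul_comm Complex.I]
  simpa using this.symm

/-- descending along exp -/
lemma descend {F : ℂ → ℂ} {c : ℝ} (p : ℂ)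
    (hper : ∀ s : ℂ, s.re < c → F (s + 2 * Real.pi * Complex.I) = F s) :
    ∀ s : ℂ, s.re < c → F (Complex.log (p + Complex.exp s - p)) = F s := by
  have hn : ∀ (n : ℕ) (s : ℂ), s.re < c → F (s + n * (2 * Real.pi * Complex.I)) = F s := by
    intro n
    induction n with
    | zero => intro s hs; simp
    | succ n ih =>
      intro s hs
      have : (s + (n * (2 * Real.pi * Complex.I))).re < c := by simpa using hs
      have h := hper _ this
      rw [ih s hs] at h
      rw [← h]; push_cast; ring_nf
  intro s hs
  rw [add_sub_cancel_left]
  obtain ⟨n, hn'⟩ := Complex.exp_eq_exp_iff_exists_int.1 (Complex.exp_log (Complex.exp_ne_zero s))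
  rw [hn']
  rcases Int.eq_nat_or_neg n with ⟨k, rfl | rfl⟩
  · exact_mod_cast hn k s hs
  · have : (s + ((-(k:ℤ):ℤ):ℂ) * (2 * Real.pi * Complex.I)).re < c := by
      simpa using hs
    have h := hn k _ this
    rw [← h]; push_cast; ring_nf

/-- local inverse of `s ↦ p + exp s` -/
lemma loc_log (p s : ℂ) : ∃ L : ℂ → ℂ, AnalyticAt ℂ L (p + Complex.exp s) ∧ L (p + Complex.exp s) = s ∧
    ∀ᶠ z in 𝓝 (p + Complex.exp s), p + Complex.exp (L z) = z ∧ 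
      deriv L z = Complex.exp (- L z) := by
  have h1 : (fun z => (z - p) / Complex.exp s) (p + Complex.exp s) = 1 := by
    simp [Complex.exp_ne_zero]
  have hA : ∀ z, AnalyticAt ℂ (fun z => (z - p) / Complex.exp s) z := fun z =>
    (analyticAt_id.sub analyticAt_const).div analyticAt_const (Complex.exp_ne_zero _)
  have hsl : ∀ᶠ z in 𝓝 (p + Complex.exp s), (z - p) / Complex.exp s ∈ Complex.slitPlane := by
    refine (hA _).continuousAt.eventually_mem ?_
    refine (congrArg (fun t => Complex.slitPlane ∈ 𝓝 t) h1).mpr ?_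
    exact Complex.isOpen_slitPlane.mem_nhds (by simp)
  refine ⟨fun z => s + Complex.log ((z - p) / Complex.exp s), ?_, ?_, ?_⟩
  · exact analyticAt_const.add ((hA _).clog hsl.self_of_nhds)
  · simp [Complex.exp_ne_zero]
  · filter_upwards [hsl] with z hz
    have h0 : (z - p) / Complex.exp s ≠ 0 := Complex.slitPlane_ne_zero hz
    have he : Complex.exp (s + Complex.log ((z - p) / Complex.exp s)) = z - p := by
      rw [Complex.exp_add, Complex.exp_log h0]
      field_simp
    constructor
    · rw [he]; ring
    · have d : HasDerivAt (fun z => (z - p) / Complex.exp s) (1 / Complex.exp s) z :=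
        ((hasDerivAt_id z).sub_const p).div_const _
      have d2 := (d.clog hz).const_add s
      rw [d2.deriv, Complex.exp_neg, he]
      have : z - p ≠ 0 := fun h => h0 (by rw [h]; simp)
      field_simp

lemma mero_of_bound {G : ℂ → ℂ} {p : ℂ} (N : ℕ) (C : ℝ)
    (h : ∀ᶠ z in 𝓝[≠] p, AnalyticAt ℂ G z ∧ ‖G z‖ * ‖z - p‖ ^ N ≤ C) : MeromorphicAt G p := by
  refine ⟨N + 1, ?_⟩
  refine Complex.analyticAt_of_differentiable_on_punctured_nhds_of_continuousAt ?_ ?_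
  · filter_upwards [h] with z hz
    exact ((analyticAt_id.sub analyticAt_const).pow _ |>.smul hz.1).differentiableAt
  · rw [continuousAt_iff_punctured_nhds]
    simp only [sub_self, ne_eq, Nat.add_eq_zero_iff, one_ne_zero, and_false, not_false_eq_true,
      zero_pow, zero_smul]
    have ht : Tendsto (fun z => C * ‖z - p‖) (𝓝[≠] p) (𝓝 0) := by
      have : Tendsto (fun z : ℂ => C * ‖z - p‖) (𝓝 p) (𝓝 (C * ‖p - p‖)) :=
        (Continuous.tendsto (by fun_prop) p)
      simp only [sub_self, norm_zero, mul_zero] at this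
      exact this.mono_left nhdsWithin_le_nhds
    refine squeeze_zero_norm' ?_ ht
    filter_upwards [h] with z hz
    rw [norm_smul, norm_pow, pow_succ]
    nlinarith [hz.2, norm_nonneg (z - p)]

lemma expo_one {G : ℂ → ℂ} {p : ℂ} (hG : MeromorphicAt G p) (e c C : ℝ)
    (h : ∀ᶠ z in 𝓝[≠] p, ‖z - p‖ ^ e * ‖G z‖ ^ 2 ≤ C * ‖z - p‖ ^ c) :
    Tendsto (fun z => ‖z - p‖ ^ (e - c) * ‖G z‖ ^ 2) (𝓝[≠] p) (𝓝 0) ∨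
    ∃ (k : ℤ) (g : ℂ → ℂ), AnalyticAt ℂ g p ∧ g p ≠ 0 ∧
      (∀ᶠ z in 𝓝[≠] p, G z = (z - p) ^ k * g z) ∧ c = e + 2 * k := by
  have hr : Tendsto (fun z => ‖z - p‖) (𝓝[≠] p) (𝓝[>] 0) := by
    refine tendsto_nhdsWithin_iff.2 ⟨?_, ?_⟩
    · have : Tendsto (fun z : ℂ => ‖z - p‖) (𝓝 p) (𝓝 (‖p - p‖)) :=
        (Continuous.tendsto (by fun_prop) p)
      simp only [sub_self, norm_zero] at this
      exact this.mono_left nhdsWithin_le_nhds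
    · filter_upwards [self_mem_nhdsWithin] with z hz
      exact norm_pos_iff.2 (sub_ne_zero.2 hz)
  have hpos : ∀ᶠ z in 𝓝[≠] p, 0 < ‖z - p‖ := (tendsto_nhdsWithin_iff.1 hr).2
  by_cases ht : meromorphicOrderAt G p = ⊤
  · left
    rw [meromorphicOrderAt_eq_top_iff] at ht
    refine Tendsto.congr' ?_ tendsto_const_nhds
    filter_upwards [ht] with z hz
    simp [hz]
  · obtain ⟨g, hg, hg0, hGg⟩ := (meromorphicOrderAt_ne_top_iff hG).1 ht
    set k := (meromorphicOrderAt G p).untop₀ with hk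
    have key : ∀ᶠ z in 𝓝[≠] p, ‖z - p‖ ^ (e - c) * ‖G z‖ ^ 2 =
        ‖z - p‖ ^ (e + 2 * k - c) * ‖g z‖ ^ 2 := by
      filter_upwards [hGg, hpos] with z hz hz0
      rw [hz, norm_smul, norm_zpow, mul_pow, ← mul_assoc]
      congr 1
      rw [← zpow_natCast, ← zpow_mul, ← Real.rpow_intCast, ← Real.rpow_add hz0]
      congr 1; push_cast; ring
    have hgt : Tendsto (fun z => ‖g z‖ ^ 2) (𝓝[≠] p) (𝓝 (‖g p‖ ^ 2)) :=
      (hg.continuousAt.norm.pow 2).tendsto.mono_left nhdsWithin_le_nhds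
    rcases lt_trichotomy (e + 2 * k - c) 0 with h1 | h1 | h1
    · exfalso
      have t1 : Tendsto (fun z => ‖z - p‖ ^ (e + 2 * k - c)) (𝓝[≠] p) atTop :=
        (tendsto_rpow_neg_nhdsGT_zero h1).comp hr
      have t2 := t1.atTop_mul_pos (by positivity) hgt
      obtain ⟨z, hz1, hz2, hz3, hz4⟩ := ((t2.eventually_gt_atTop C).and (h.and (key.and hpos))).exists
      rw [← hz3] at hz1
      have : ‖z - p‖ ^ e = ‖z - p‖ ^ (e - c) * ‖z - p‖ ^ c := by
        rw [← Real.rpow_add hz4]; congr 1; ring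
      rw [this] at hz2
      have := Real.rpow_pos_of_pos hz4 c
      nlinarith
    · right
      refine ⟨k, g, hg, hg0, ?_, by linarith⟩
      filter_upwards [hGg] with z hz
      rw [hz, smul_eq_mul]
    · left
      have t1 : Tendsto (fun z => ‖z - p‖ ^ (e + 2 * k - c)) (𝓝[≠] p) (𝓝 0) := by
        have := (Real.continuousAt_rpow_const 0 (e + 2 * k - c) (Or.inr h1.le)).tendsto
        rw [Real.zero_rpow h1.ne'] at this
        exact this.comp (hr.mono_right nhdsWithin_le_nhds)
      have t2 := t1.mul hgt
      rw [zero_mul] at t2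
      refine t2.congr' ?_
      filter_upwards [key] with z hz
      rw [hz]

lemma expo {G₁ G₂ : ℂ → ℂ} {p : ℂ} (h₁ : MeromorphicAt G₁ p) (h₂ : MeromorphicAt G₂ p)
    (e₁ e₂ c C₁ C₂ : ℝ) (hC : 0 < C₁)
    (h : ∀ᶠ z in 𝓝[≠] p, C₁ * ‖z - p‖ ^ c ≤ ‖z - p‖ ^ e₁ * ‖G₁ z‖ ^ 2 + ‖z - p‖ ^ e₂ * ‖G₂ z‖ ^ 2 ∧
      ‖z - p‖ ^ e₁ * ‖G₁ z‖ ^ 2 + ‖z - p‖ ^ e₂ * ‖G₂ z‖ ^ 2 ≤ C₂ * ‖z - p‖ ^ c) :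
    (∃ (k : ℤ) (g : ℂ → ℂ), AnalyticAt ℂ g p ∧ g p ≠ 0 ∧
      (∀ᶠ z in 𝓝[≠] p, G₁ z = (z - p) ^ k * g z) ∧ c = e₁ + 2 * k) ∨
    (∃ (k : ℤ) (g : ℂ → ℂ), AnalyticAt ℂ g p ∧ g p ≠ 0 ∧
      (∀ᶠ z in 𝓝[≠] p, G₂ z = (z - p) ^ k * g z) ∧ c = e₂ + 2 * k) := by
  rcases expo_one h₁ e₁ c C₂ (h.mono fun z hz => by
    have : 0 ≤ ‖z - p‖ ^ e₂ * ‖G₂ z‖ ^ 2 := by positivity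
    linarith) with t1 | h1
  · rcases expo_one h₂ e₂ c C₂ (h.mono fun z hz => by
      have : 0 ≤ ‖z - p‖ ^ e₁ * ‖G₁ z‖ ^ 2 := by positivity
      linarith) with t2 | h2
    · exfalso
      have t := t1.add t2
      rw [add_zero] at t
      obtain ⟨z, hz1, hz2, hz3⟩ := ((t.eventually_lt_const hC).and (h.and self_mem_nhdsWithin)).exists
      have hz0 : 0 < ‖z - p‖ := norm_pos_iff.2 (sub_ne_zero.2 hz3)
      have e1 : ∀ e : ℝ, ‖z - p‖ ^ e = ‖z - p‖ ^ (e - c) * ‖z - p‖ ^ c := by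
        intro e
        rw [← Real.rpow_add hz0]; congr 1; ring
      have h3 := hz2.1
      rw [e1 e₁, e1 e₂] at h3
      have := Real.rpow_pos_of_pos hz0 c
      nlinarith
    · exact Or.inr h2
  · exact Or.inl h1

lemma desc_ev {F G : ℂ → ℂ} {c : ℝ} {p s : ℂ} (hs : s.re < c)
    (hG : ∀ x : ℂ, x.re < c → G (p + Complex.exp x) = F x) {L : ℂ → ℂ}
    (hL : AnalyticAt ℂ L (p + Complex.exp s)) (hLs : L (p + Complex.exp s) = s)
    (hLe : ∀ᶠ z in 𝓝 (p + Complex.exp s), p + Complex.exp (L z) = z) :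
    (fun z => F (L z)) =ᶠ[𝓝 (p + Complex.exp s)] G := by
  have h1 : ∀ᶠ z in 𝓝 (p + Complex.exp s), (L z).re < c := by
    have : ContinuousAt (fun z => (L z).re) (p + Complex.exp s) :=
      Complex.continuous_re.continuousAt.comp hL.continuousAt
    exact this.eventually_lt_const (by simpa only [hLs] using hs)
  filter_upwards [h1, hLe] with z hz hz2
  rw [← hG _ hz, hz2]

lemma PairAt.norm_eq {w : ℂ → ℝ} {Y Z : ℂ → ℂ} {z : ℂ} (h : PairAt w Y Z z) :
    ‖Y z‖ ^ 2 + ‖Z z‖ ^ 2 = w z := by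
  have h2 := h.2.2.self_of_nhds.2
  rw [Complex.mul_conj, Complex.mul_conj, Complex.normSq_eq_norm_sq,
    Complex.normSq_eq_norm_sq] at h2
  exact_mod_cast h2.symm

lemma le_of_sq_le' {x C : ℝ} (hx : 0 ≤ x) (h : x ^ 2 ≤ C) : x ≤ C + 1 := by
  nlinarith [sq_nonneg (x - 1)]

lemma norm_exp_half (s : ℂ) (t : ℝ) : ‖Complex.exp (t * s)‖ ^ 2 = Real.exp s.re ^ (2 * t) := by
  rw [Complex.norm_exp, ← Real.exp_mul, ← Real.exp_nat_mul]
  congr 1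
  simp
  ring

lemma pt_log {p z : ℂ} {ε : ℝ} (hz : z ∈ ball p ε) (hne : z ≠ p) :
    ∃ s : ℂ, s.re < Real.log ε ∧ p + Complex.exp s = z ∧ Real.exp s.re = ‖z - p‖ := by
  have h0 : z - p ≠ 0 := sub_ne_zero.2 hne
  have hn : 0 < ‖z - p‖ := norm_pos_iff.2 h0
  rw [mem_ball, dist_eq_norm] at hz
  refine ⟨Complex.log (z - p), ?_, ?_, ?_⟩
  · rw [Complex.log_re]; exact Real.log_lt_log hn hz
  · rw [Complex.exp_log h0]; ring
  · rw [Complex.log_re, Real.exp_log hn]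

lemma sing_pair {w : ℂ → ℝ} {p : ℂ} {c₁ c₂ ε : ℝ} (m : ℕ) (hε : 0 < ε) (hc₁ : 0 < c₁)
    (hg : ∀ z ∈ ball p ε, z ≠ p → GoodAt w z)
    (hb : ∀ z ∈ ball p ε, z ≠ p → c₁ * ‖z - p‖ ^ (-2 * (m : ℝ)) ≤ w z ∧
      w z ≤ c₂ * ‖z - p‖ ^ (-2 * (m : ℝ))) :
    ∃ Y Z, (∀ z ∈ ball p ε, z ≠ p → PairAt w Y Z z) ∧ MeromorphicAt Y p ∧ MeromorphicAt Z p := by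
  set c := Real.log ε with hc
  set wt : ℂ → ℝ := fun s => ‖Complex.exp (-s / 2)‖ ^ 2 * w (p + Complex.exp s) with hwt
  have hmem : ∀ s : ℂ, s.re < c → p + Complex.exp s ∈ ball p ε ∧ p + Complex.exp s ≠ p := by
    intro s hs
    refine ⟨?_, by simp [Complex.exp_ne_zero]⟩
    rw [mem_ball, dist_eq_norm, add_sub_cancel_left, Complex.norm_exp]
    rw [hc] at hs
    exact (Real.lt_log_iff_exp_lt hε).1 hs
  have hloc : ∀ s : ℂ, s.re < c → ∃ Y Z, PairAt wt Y Z s := by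
    intro s hs
    obtain ⟨h1, h2⟩ := hmem s hs
    obtain ⟨Y, Z, hYZ⟩ := local_pair (hg _ h1 h2)
    have ha : AnalyticAt ℂ (fun s => p + Complex.exp s) s := by fun_prop
    have hb : AnalyticAt ℂ (fun s : ℂ => Complex.exp (-s / 2)) s := by fun_prop
    refine ⟨_, _, PairAt.comp (φ := fun s => p + Complex.exp s)
      (ψ := fun s => Complex.exp (-s / 2)) ha hb ?_ hYZ⟩
    refine Eventually.of_forall fun x => ?_
    have : deriv (fun s => p + Complex.exp s) x = Complex.exp x := by simp
    rw [this, ← Complex.exp_nat_mul, ← Complex.exp_add]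
    rw [show ((2 : ℕ) : ℂ) * (-x / 2) + x = 0 by push_cast; ring, Complex.exp_zero]
  obtain ⟨Y, hY⟩ := glue_half c (QQ_loc wt ∅) (QQ_ext wt countable_empty isClosed_empty) (by
    intro s hs
    obtain ⟨Y, Z, hYZ⟩ := hloc s hs
    refine ⟨fun x => (Y x, Z x), ?_⟩
    filter_upwards [hYZ.eventually] with x hx
    exact ⟨fun _ => hx, fun h => absurd h (notMem_empty _), hx.1.meromorphicAt,
      hx.2.1.meromorphicAt⟩)
  set A : ℂ → ℂ := fun s => (Y s).1
  set B : ℂ → ℂ := fun s => (Y s).2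
  have hAB : ∀ s : ℂ, s.re < c → PairAt wt A B s := fun s hs => (hY s hs).1 (notMem_empty _)
  have hwper : ∀ s, wt (s + 2 * Real.pi * Complex.I) = wt s := by
    intro s
    simp only [hwt, Complex.exp_periodic s, Complex.norm_exp]
    simp
  have hsh : ∀ s : ℂ, s.re < c → PairAt wt (fun s => A (s + 2 * Real.pi * Complex.I))
      (fun s => B (s + 2 * Real.pi * Complex.I)) s := by
    intro s hs
    have h1 : (s + 2 * Real.pi * Complex.I).re < c := by simpa using hs
    have h2 := PairAt.comp (φ := fun s => s + 2 * Real.pi * Complex.I) (ψ := fun _ => 1) (z := s)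
      (by fun_prop) (by fun_prop) (Eventually.of_forall fun x => by simp) (hAB _ h1)
    simp only [norm_one, one_pow, one_mul, hwper] at h2
    exact h2
  have hHo : IsOpen {s : ℂ | s.re < c} := isOpen_lt Complex.continuous_re continuous_const
  have hHc : IsPreconnected {s : ℂ | s.re < c} := (convex_halfSpace_re_lt c).isPreconnected
  obtain ⟨a, b, hab, huniq⟩ := pair_unique hHo hHc ⟨((c - 1 : ℝ) : ℂ), by simp⟩ countable_empty
    isClosed_empty (fun z hz _ => hAB z hz) (fun z hz _ => hsh z hz)
  obtain ⟨k, d, μ, hkd, hμ, he1, he2⟩ := su2_diag hab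
  set X₁ : ℂ → ℂ := fun s => k * A s + d * B s with hX₁
  set X₂ : ℂ → ℂ := fun s => - conj d * A s + conj k * B s with hX₂
  have hX : ∀ s : ℂ, s.re < c → PairAt wt X₁ X₂ s := fun s hs => (hAB s hs).rot hkd
  have hX1 : ∀ s : ℂ, s.re < c → X₁ (s + 2 * Real.pi * Complex.I) = μ * X₁ s := by
    intro s hs
    obtain ⟨h1, h2⟩ := huniq s hs (notMem_empty _)
    simp only [hX₁]
    rw [h1, h2]
    linear_combination (A s) * he1 + (B s) * he2
  have hX2 : ∀ s : ℂ, s.re < c → X₂ (s + 2 * Real.pi * Complex.I) = conj μ * X₂ s := by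
    intro s hs
    obtain ⟨h1, h2⟩ := huniq s hs (notMem_empty _)
    simp only [hX₂]
    rw [h1, h2]
    have f1 := congrArg conj he1
    have f2 := congrArg conj he2
    simp only [map_mul, map_sub, map_add, Complex.conj_conj] at f1 f2
    linear_combination (B s) * f1 - (A s) * f2
  -- exponents
  obtain ⟨β, hβ⟩ := unit_exp hμ
  set α : ℝ := β / (2 * Real.pi) with hα
  have hβα : β = 2 * Real.pi * α := by rw [hα]; field_simp
  have hμe : μ = Complex.exp (α * (2 * Real.pi * Complex.I)) := by
    rw [hβ, hβα]; congr 1; push_cast; ring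
  have hμe' : conj μ = Complex.exp (-α * (2 * Real.pi * Complex.I)) := by
    rw [hμe, ← Complex.exp_conj]; congr 1
    simp only [map_mul, Complex.conj_ofReal, Complex.conj_I, Complex.conj_ofNat]; ring
  -- general descent
  have hdesc : ∀ (X : ℂ → ℂ) (t : ℝ) (ν : ℂ), (∀ s : ℂ, s.re < c → AnalyticAt ℂ X s) →
      (∀ s : ℂ, s.re < c → X (s + 2 * Real.pi * Complex.I) = ν * X s) →
      Complex.exp (t * (2 * Real.pi * Complex.I)) * ν = 1 →
      ∃ G : ℂ → ℂ, ∀ s : ℂ, s.re < c → G (p + Complex.exp s) = Complex.exp (t * s) * X s ∧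
        AnalyticAt ℂ G (p + Complex.exp s) := by
    intro X t ν hXa hXs hν
    refine ⟨fun z => Complex.exp (t * Complex.log (z - p)) * X (Complex.log (z - p)), ?_⟩
    have h1 : ∀ s : ℂ, s.re < c → (fun z => Complex.exp (t * Complex.log (z - p)) *
        X (Complex.log (z - p))) (p + Complex.exp s) = Complex.exp (t * s) * X s := by
      refine descend (F := fun s => Complex.exp (t * s) * X s) p ?_
      intro s hs
      rw [hXs s hs, mul_add, Complex.exp_add]
      linear_combination (Complex.exp (t * s) * X s) * hν
    intro s hs
    refine ⟨h1 s hs, ?_⟩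
    obtain ⟨L, hL, hLs, hLe⟩ := loc_log p s
    have h2 := desc_ev (F := fun s => Complex.exp (t * s) * X s)
      (G := fun z => Complex.exp (t * Complex.log (z - p)) * X (Complex.log (z - p))) hs h1 hL hLs
      (hLe.mono fun _ h => h.1)
    refine AnalyticAt.congr ?_ h2
    have hA : AnalyticAt ℂ (fun s => Complex.exp (t * s) * X s) (L (p + Complex.exp s)) := by
      rw [hLs]
      have := hXa s hs
      fun_prop
    exact hA.comp hL
  have hev : ∀ᶠ z in 𝓝[≠] p, z ∈ ball p ε ∧ z ≠ p ∧ ‖z - p‖ ≤ 1 := by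
    have h1 : ∀ᶠ z in 𝓝[≠] p, z ∈ ball p ε := nhdsWithin_le_nhds (ball_mem_nhds p hε)
    have h2 : ∀ᶠ z in 𝓝[≠] p, z ∈ ball p 1 := nhdsWithin_le_nhds (ball_mem_nhds p one_pos)
    filter_upwards [h1, h2, self_mem_nhdsWithin] with z a1 a2 a3
    refine ⟨a1, a3, ?_⟩
    rw [mem_ball, dist_eq_norm] at a2
    exact a2.le
  have hnu1 : Complex.exp (((-α : ℝ) : ℂ) * (2 * Real.pi * Complex.I)) * μ = 1 := by
    rw [hμe, ← Complex.exp_add]; push_cast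
    rw [show -(α:ℂ) * (2 * Real.pi * Complex.I) + α * (2 * Real.pi * Complex.I) = 0 by ring,
      Complex.exp_zero]
  have hnu2 : Complex.exp ((α : ℂ) * (2 * Real.pi * Complex.I)) * conj μ = 1 := by
    rw [hμe', ← Complex.exp_add]
    rw [show (α:ℂ) * (2 * Real.pi * Complex.I) + -α * (2 * Real.pi * Complex.I) = 0 by ring,
      Complex.exp_zero]
  obtain ⟨G₁, hG₁⟩ := hdesc X₁ (-α) μ (fun s hs => (hX s hs).1) hX1 hnu1
  obtain ⟨G₂, hG₂⟩ := hdesc X₂ α (conj μ) (fun s hs => (hX s hs).2.1) hX2 hnu2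
  have hwts : ∀ s : ℂ, wt s = Real.exp s.re ^ (-1 : ℝ) * w (p + Complex.exp s) := by
    intro s
    have := norm_exp_half s (-1/2)
    simp only [hwt]
    rw [show -s / 2 = ((-1 / 2 : ℝ) : ℂ) * s by push_cast; ring, this]
    congr 2; norm_num
  have hsum : ∀ z ∈ ball p ε, z ≠ p → ‖z - p‖ ^ (2 * α) * ‖G₁ z‖ ^ 2 +
      ‖z - p‖ ^ (-2 * α) * ‖G₂ z‖ ^ 2 = ‖z - p‖ ^ (-1 : ℝ) * w z := by
    intro z hz hne
    obtain ⟨s, hs, rfl, hr⟩ := pt_log hz hne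
    have h1 := (hX s hs).norm_eq
    have hpos := Real.exp_pos s.re
    rw [(hG₁ s hs).1, (hG₂ s hs).1, norm_mul, norm_mul, mul_pow, mul_pow, norm_exp_half,
      norm_exp_half, ← hr, ← mul_assoc, ← mul_assoc, ← Real.rpow_add hpos, ← Real.rpow_add hpos]
    rw [show 2 * α + 2 * -α = 0 by ring, show -2 * α + 2 * α = 0 by ring, Real.rpow_zero, one_mul,
      one_mul, h1, hwts]
  have hbd : ∀ (N : ℕ), |α| + m + 1 ≤ N → ∀ z, (z ∈ ball p ε ∧ z ≠ p ∧ ‖z - p‖ ≤ 1) →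
      ∀ (G : ℂ → ℂ) (σ : ℝ), |σ| = |α| → ‖z - p‖ ^ (2 * σ) * ‖G z‖ ^ 2 ≤ ‖z - p‖ ^ (-1 : ℝ) * w z →
      ‖G z‖ * ‖z - p‖ ^ N ≤ c₂ + 1 := by
    intro N hN z hz G σ hσ hle
    have hpos : 0 < ‖z - p‖ := norm_pos_iff.2 (sub_ne_zero.2 hz.2.1)
    refine le_of_sq_le' (by positivity) ?_
    have h1 := (hb z hz.1 hz.2.1).2
    have h2 : ‖z - p‖ ^ (2 * σ) * ‖G z‖ ^ 2 ≤ ‖z - p‖ ^ (-1 : ℝ) * (c₂ * ‖z - p‖ ^ (-2 * (m : ℝ))) :=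
      hle.trans (mul_le_mul_of_nonneg_left h1 (by positivity))
    have h3 : (‖G z‖ * ‖z - p‖ ^ N) ^ 2 = (‖z - p‖ ^ (2 * σ) * ‖G z‖ ^ 2) *
        ‖z - p‖ ^ (2 * N - 2 * σ) := by
      have : (‖z - p‖ ^ N) ^ 2 = ‖z - p‖ ^ (2 * σ) * ‖z - p‖ ^ (2 * N - 2 * σ) := by
        rw [← Real.rpow_add hpos, ← pow_mul, ← Real.rpow_natCast]
        congr 1; push_cast; ring
      rw [mul_pow, this]; ring
    have hc2 : 0 ≤ c₂ := by
      have ha := hb z hz.1 hz.2.1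
      have hq : 0 < ‖z - p‖ ^ (-2 * (m : ℝ)) := by positivity
      by_contra hcon
      push Not at hcon
      nlinarith [ha.1, ha.2]
    calc _ = _ := h3
      _ ≤ (‖z - p‖ ^ (-1 : ℝ) * (c₂ * ‖z - p‖ ^ (-2 * (m : ℝ)))) * ‖z - p‖ ^ (2 * N - 2 * σ) :=
        mul_le_mul_of_nonneg_right h2 (by positivity)
      _ = c₂ * ‖z - p‖ ^ (-1 + -2 * (m : ℝ) + (2 * N - 2 * σ)) := by
        rw [Real.rpow_add hpos, Real.rpow_add hpos]; ring
      _ ≤ c₂ * 1 := by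
        refine mul_le_mul_of_nonneg_left ?_ hc2
        refine Real.rpow_le_one hpos.le hz.2.2 ?_
        have := le_abs_self σ
        linarith [hN, hσ, abs_nonneg α]
      _ = c₂ := mul_one _
  obtain ⟨N, hN⟩ := exists_nat_ge (|α| + m + 1)
  have hanal : ∀ G : ℂ → ℂ, (∀ s : ℂ, s.re < c → AnalyticAt ℂ G (p + Complex.exp s)) →
      ∀ z ∈ ball p ε, z ≠ p → AnalyticAt ℂ G z := by
    intro G hG z hz hne
    obtain ⟨s, hs, rfl, hr⟩ := pt_log hz hne
    exact hG s hs
  have mG₁ : MeromorphicAt G₁ p := by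
    refine mero_of_bound N (c₂ + 1) ?_
    filter_upwards [hev] with z hz
    refine ⟨hanal G₁ (fun s hs => (hG₁ s hs).2) z hz.1 hz.2.1, hbd N hN z hz G₁ α rfl ?_⟩
    rw [← hsum z hz.1 hz.2.1]
    have : 0 ≤ ‖z - p‖ ^ (-2 * α) * ‖G₂ z‖ ^ 2 := by positivity
    linarith
  have mG₂ : MeromorphicAt G₂ p := by
    refine mero_of_bound N (c₂ + 1) ?_
    filter_upwards [hev] with z hz
    refine ⟨hanal G₂ (fun s hs => (hG₂ s hs).2) z hz.1 hz.2.1, hbd N hN z hz G₂ (-α) (abs_neg _) ?_⟩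
    rw [← hsum z hz.1 hz.2.1, show 2 * -α = -2 * α by ring]
    have : 0 ≤ ‖z - p‖ ^ (2 * α) * ‖G₁ z‖ ^ 2 := by positivity
    linarith
  have hα2 : ∃ n : ℤ, 2 * α = 2 * n + 1 := by
    have hex := expo mG₁ mG₂ (2 * α) (-2 * α) (-1 + -2 * m) c₁ c₂ hc₁ (by
      filter_upwards [hev] with z hz
      have hpos : 0 < ‖z - p‖ := norm_pos_iff.2 (sub_ne_zero.2 hz.2.1)
      rw [hsum z hz.1 hz.2.1, Real.rpow_add hpos]
      have h1 := hb z hz.1 hz.2.1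
      have h2 : 0 < ‖z - p‖ ^ (-1 : ℝ) := by positivity
      constructor <;> nlinarith [mul_le_mul_of_nonneg_left h1.1 h2.le,
        mul_le_mul_of_nonneg_left h1.2 h2.le])
    rcases hex with ⟨k, -, -, -, -, h⟩ | ⟨k, -, -, -, -, h⟩
    · refine ⟨-m - k - 1, ?_⟩
      push_cast; linarith
    · refine ⟨m + k, ?_⟩
      push_cast; linarith
  have hμ1 : μ = -1 := by
    obtain ⟨n, hn⟩ := hα2
    rw [hμe, show (α : ℂ) * (2 * Real.pi * Complex.I) = ((2 * α : ℝ) : ℂ) * (Real.pi * Complex.I) by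
      push_cast; ring, hn]
    rw [show ((2 * n + 1 : ℝ) : ℂ) * (Real.pi * Complex.I) =
      Real.pi * Complex.I + n * (2 * Real.pi * Complex.I) by push_cast; ring, Complex.exp_add,
      Complex.exp_int_mul_two_pi_mul_I, Complex.exp_pi_mul_I, mul_one]
  have hnu3 : Complex.exp (((1/2 : ℝ) : ℂ) * (2 * Real.pi * Complex.I)) * (-1) = 1 := by
    rw [show ((1/2 : ℝ) : ℂ) * (2 * Real.pi * Complex.I) = Real.pi * Complex.I by push_cast; ring,
      Complex.exp_pi_mul_I]; norm_num
  rw [hμ1] at hX1 hX2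
  simp only [map_neg, map_one] at hX2
  obtain ⟨y₁, hy₁⟩ := hdesc X₁ (1/2) (-1) (fun s hs => (hX s hs).1) hX1 hnu3
  obtain ⟨y₂, hy₂⟩ := hdesc X₂ (1/2) (-1) (fun s hs => (hX s hs).2.1) hX2 hnu3
  have hpair : ∀ z ∈ ball p ε, z ≠ p → PairAt w y₁ y₂ z := by
    intro z hz hne
    obtain ⟨s, hs, rfl, hr⟩ := pt_log hz hne
    obtain ⟨L, hL, hLs, hLe⟩ := loc_log p s
    have hXL : PairAt wt X₁ X₂ (L (p + Complex.exp s)) := by rw [hLs]; exact hX s hs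
    have h1 := PairAt.comp (φ := L) (ψ := fun z => Complex.exp (((1/2 : ℝ) : ℂ) * L z)) hL
      (by fun_prop) (by
        filter_upwards [hLe] with z hz
        rw [hz.2, ← Complex.exp_nat_mul, ← Complex.exp_add]
        rw [show ((2:ℕ):ℂ) * (((1/2 : ℝ) : ℂ) * L z) + - L z = 0 by push_cast; ring, Complex.exp_zero])
      hXL
    have e1 := desc_ev (F := fun s => Complex.exp (((1/2 : ℝ) : ℂ) * s) * X₁ s) hs
      (fun x hx => (hy₁ x hx).1) hL hLs (hLe.mono fun _ h => h.1)
    have e2 := desc_ev (F := fun s => Complex.exp (((1/2 : ℝ) : ℂ) * s) * X₂ s) hs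
      (fun x hx => (hy₂ x hx).1) hL hLs (hLe.mono fun _ h => h.1)
    refine (h1.congr e1 e2).congr_w ?_
    filter_upwards [hLe] with z hz
    rw [hwts, norm_exp_half, hz.1, ← mul_assoc, ← Real.rpow_add (Real.exp_pos _)]
    norm_num
  have mero : ∀ y : ℂ → ℂ, (∀ z ∈ ball p ε, z ≠ p → AnalyticAt ℂ y z ∧ ‖y z‖ ^ 2 ≤ w z) →
      MeromorphicAt y p := by
    intro y hy
    refine mero_of_bound m (c₂ + 1) ?_
    filter_upwards [hev] with z hz
    obtain ⟨h1, h2⟩ := hy z hz.1 hz.2.1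
    refine ⟨h1, le_of_sq_le' (by positivity) ?_⟩
    have hpos : 0 < ‖z - p‖ := norm_pos_iff.2 (sub_ne_zero.2 hz.2.1)
    have h3 := h2.trans (hb z hz.1 hz.2.1).2
    have e : (‖z - p‖ ^ m) ^ 2 = ‖z - p‖ ^ (2 * (m : ℝ)) := by
      rw [← pow_mul, ← Real.rpow_natCast]; congr 1; push_cast; ring
    rw [mul_pow, e]
    calc _ ≤ (c₂ * ‖z - p‖ ^ (-2 * (m : ℝ))) * ‖z - p‖ ^ (2 * (m : ℝ)) :=
          mul_le_mul_of_nonneg_right h3 (by positivity)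
      _ = c₂ := by
        rw [mul_assoc, ← Real.rpow_add hpos, show -2 * (m : ℝ) + 2 * m = 0 by ring, Real.rpow_zero,
          mul_one]
  refine ⟨y₁, y₂, hpair, mero _ fun z hz hne => ?_, mero _ fun z hz hne => ?_⟩
  · have h := hpair z hz hne
    refine ⟨h.1, ?_⟩
    have := h.norm_eq
    nlinarith [sq_nonneg ‖y₂ z‖]
  · have h := hpair z hz hne
    refine ⟨h.2.1, ?_⟩
    have := h.norm_eq
    nlinarith [sq_nonneg ‖y₁ z‖]

noncomputable def hp (τ : ℂ) (a : ℤ × ℤ) : ℂ := ((a.1 : ℂ) + a.2 * τ) / 2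

lemma half_closed {τ : ℂ} (hτ : 0 < τ.im) {S : Set ℂ} (h : S ⊆ range (hp τ)) : IsClosed S := by
  set φ : ℂ → ℝ × ℝ := fun z => (2 * (z.re - z.im / τ.im * τ.re), 2 * (z.im / τ.im)) with hφ
  have hφc : Continuous φ := by
    apply Continuous.prodMk
    · exact continuous_const.mul (Complex.continuous_re.sub
        ((Complex.continuous_im.div_const _).mul continuous_const))
    · exact continuous_const.mul (Complex.continuous_im.div_const _)
  have hφi : ∀ z z', φ z = φ z' → z = z' := by
    intro z z' he
    simp only [hφ, Prod.mk.injEq] at he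
    obtain ⟨h1, h2⟩ := he
    have h3 : z.im = z'.im := by
      have : z.im / τ.im = z'.im / τ.im := by linarith
      exact (div_left_inj' hτ.ne').1 this
    apply Complex.ext _ h3
    rw [h3] at h1; linarith
  have hφh : ∀ a, φ (hp τ a) = Prod.map (Int.cast : ℤ → ℝ) (Int.cast : ℤ → ℝ) a := by
    intro a
    simp only [hφ, hp, Prod.map]
    have e1 : (((a.1 : ℂ) + a.2 * τ) / 2).im = a.2 * τ.im / 2 := by
      simp [Complex.div_ofNat_im]
    have e2 : (((a.1 : ℂ) + a.2 * τ) / 2).re = (a.1 + a.2 * τ.re) / 2 := by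
      simp [Complex.div_ofNat_re]
    rw [e1, e2]
    ext
    · simp only; field_simp; ring
    · simp only; field_simp
  have hcl : IsClosedMap (Prod.map (Int.cast : ℤ → ℝ) (Int.cast : ℤ → ℝ)) :=
    (Int.isClosedEmbedding_coe_real.prodMap Int.isClosedEmbedding_coe_real).isClosedMap
  have : S = φ ⁻¹' (Prod.map (Int.cast : ℤ → ℝ) (Int.cast : ℤ → ℝ) '' {a | hp τ a ∈ S}) := by
    ext z
    constructor
    · intro hz
      obtain ⟨a, rfl⟩ := h hz
      exact ⟨a, hz, (hφh a).symm⟩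
    · rintro ⟨a, ha, he⟩
      rw [← hφh] at he
      rw [← hφi _ _ he]; exact ha
  rw [this]
  exact (hcl _ (isClosed_discrete _)).preimage hφc

lemma half_countable {τ : ℂ} {S : Set ℂ} (h : S ⊆ range (hp τ)) : S.Countable :=
  (countable_range _).mono h

lemma fullSing_sub (τ : ℂ) : fullSing τ ⊆ range (hp τ) := by
  rintro z ⟨k, l, ⟨a, b, rfl⟩, rfl⟩
  fin_cases k
  · exact ⟨(2 * a, 2 * b), by simp [hp, per]; ring⟩
  · exact ⟨(2 * a + 1, 2 * b), by simp [hp, per]; ring⟩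
  · exact ⟨(2 * a, 2 * b + 1), by simp [hp, per]; ring⟩
  · exact ⟨(2 * a + 1, 2 * b + 1), by simp [hp, per]; ring⟩

lemma singSet_sub (τ : ℂ) (m : Fin 4 → ℕ) : singSet τ m ⊆ fullSing τ := by
  rintro z ⟨k, _, l, hl, rfl⟩
  exact ⟨k, l, hl, rfl⟩

lemma lat_sub (τ : ℂ) : lat τ ⊆ fullSing τ := by
  intro z hz
  exact ⟨0, z, hz, by simp [per]⟩

lemma isolated {τ : ℂ} (hτ : 0 < τ.im) {S : Set ℂ} (h : S ⊆ range (hp τ)) (p : ℂ) :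
    ∀ᶠ z in 𝓝[≠] p, z ∉ S := by
  have h1 : IsClosed (S \ {p}) := half_closed hτ (sdiff_subset.trans h)
  have h2 : ∀ᶠ z in 𝓝[≠] p, z ∉ S \ {p} := nhdsWithin_le_nhds (h1.isOpen_compl.mem_nhds (by simp))
  filter_upwards [h2, self_mem_nhdsWithin] with z hz hz2 hz3
  exact hz ⟨hz3, hz2⟩

lemma lat_add {τ a b : ℂ} (ha : a ∈ lat τ) (hb : b ∈ lat τ) : a + b ∈ lat τ := by
  obtain ⟨m, n, rfl⟩ := ha
  obtain ⟨m', n', rfl⟩ := hb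
  exact ⟨m + m', n + n', by push_cast; ring⟩

lemma lat_neg {τ a : ℂ} (ha : a ∈ lat τ) : -a ∈ lat τ := by
  obtain ⟨m, n, rfl⟩ := ha
  exact ⟨-m, -n, by push_cast; ring⟩

lemma lat_one (τ : ℂ) : 1 ∈ lat τ := ⟨1, 0, by simp⟩
lemma lat_tau (τ : ℂ) : τ ∈ lat τ := ⟨0, 1, by simp⟩
lemma lat_zero (τ : ℂ) : 0 ∈ lat τ := ⟨0, 0, by simp⟩

lemma singSet_shift {τ t : ℂ} {m : Fin 4 → ℕ} (ht : t ∈ lat τ) (z : ℂ) :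
    z + t ∈ singSet τ m ↔ z ∈ singSet τ m := by
  constructor
  · rintro ⟨k, hk, l, hl, h⟩
    exact ⟨k, hk, l + -t, lat_add hl (lat_neg ht), by linear_combination h⟩
  · rintro ⟨k, hk, l, hl, h⟩
    exact ⟨k, hk, l + t, lat_add hl ht, by linear_combination h⟩

lemma fullSing_shift {τ t : ℂ} (ht : t ∈ lat τ) (z : ℂ) :
    z + t ∈ fullSing τ ↔ z ∈ fullSing τ := by
  constructor
  · rintro ⟨k, l, hl, h⟩
    exact ⟨k, l + -t, lat_add hl (lat_neg ht), by linear_combination h⟩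
  · rintro ⟨k, l, hl, h⟩
    exact ⟨k, l + t, lat_add hl ht, by linear_combination h⟩

lemma good_of_sol {τ : ℂ} (hτ : 0 < τ.im) {m : Fin 4 → ℕ} {u : ℂ → ℝ}
    (hu : IsCurvatureSolution τ m u) {z : ℂ} (hz : z ∉ singSet τ m) : GoodAt (wof u) z := by
  have hcl : IsClosed (singSet τ m) := half_closed hτ ((singSet_sub τ m).trans (fullSing_sub τ))
  have hsm : ∀ x ∉ singSet τ m, ContDiffAt ℝ ∞ u x := fun x hx =>
    contDiffAt_infty.2 (hu.2.2.1 x hx).1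
  have hev : ∀ x ∉ singSet τ m, ∀ᶠ y in 𝓝 x, y ∉ singSet τ m := fun x hx =>
    hcl.isOpen_compl.mem_nhds hx
  filter_upwards [hev z hz] with x hx
  have h1 : ContDiffAt ℝ ∞ (wof u) x :=
    contDiffAt_const.mul (((hsm x hx).neg.div_const 2).exp)
  refine ⟨Complex.ofRealCLM.contDiff.contDiffAt.comp x h1, ?_, ?_⟩
  · unfold wof; positivity
  · rw [KK_wof ((hev x hx).mono hsm)]
    have h2 := (hu.2.2.1 x hx).2
    have h3 : lapl u x = - Real.exp (u x) := by linarith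
    rw [h3, neg_mul, ← Real.exp_add]
    simp

lemma wof_bounds {τ : ℂ} {m : Fin 4 → ℕ} {u : ℂ → ℝ}
    (hu : IsCurvatureSolution τ m u) {p : ℂ} {k : Fin 4} (hk : 1 ≤ m k) {l : ℂ} (hl : l ∈ lat τ)
    (hp : p = per τ (k : ℕ) / 2 + l) :
    ∃ c₁ c₂ ε : ℝ, 0 < c₁ ∧ 0 < ε ∧ ∀ z ∈ ball p ε, z ≠ p →
      c₁ * ‖z - p‖ ^ (-2 * (m k : ℝ)) ≤ wof u z ∧ wof u z ≤ c₂ * ‖z - p‖ ^ (-2 * (m k : ℝ)) := by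
  obtain ⟨C, ε, hε, h⟩ := hu.2.2.2 k hk l hl
  rw [← hp] at h
  refine ⟨Real.sqrt 8 * Real.exp (-C / 2), Real.sqrt 8 * Real.exp (C / 2), ε, by positivity, hε, ?_⟩
  intro z hz hne
  have h1 := abs_le.1 (h z hne hz)
  rw [dist_eq_norm] at h1
  have hpos : 0 < ‖z - p‖ := norm_pos_iff.2 (sub_ne_zero.2 hne)
  rw [Real.rpow_def_of_pos hpos, mul_assoc, mul_assoc, ← Real.exp_add, ← Real.exp_add]
  unfold wof
  constructor
  · refine mul_le_mul_of_nonneg_left (Real.exp_le_exp.2 ?_) (Real.sqrt_nonneg _)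
    linarith [h1.1, h1.2]
  · refine mul_le_mul_of_nonneg_left (Real.exp_le_exp.2 ?_) (Real.sqrt_nonneg _)
    linarith [h1.1, h1.2]

lemma shift_rel {w : ℂ → ℝ} {S : Set ℂ} {Y Z : ℂ → ℂ} (hS : S.Countable) (hSc : IsClosed S)
    (hp : ∀ z ∉ S, PairAt w Y Z z) (h0 : ∀ z ∈ S, Y z = 0 ∧ Z z = 0) {t : ℂ}
    (hw : ∀ z, w (z + t) = w z) (hSt : ∀ z, z + t ∈ S ↔ z ∈ S) :
    ∃ a b : ℂ, a * conj a + b * conj b = 1 ∧ ∀ z, Y (z + t) = a * Y z + b * Z z ∧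
      Z (z + t) = - conj b * Y z + conj a * Z z := by
  obtain ⟨a, b, hab, h⟩ := pair_unique (w := w) (U := univ) (S := S) isOpen_univ
    isPreconnected_univ univ_nonempty hS hSc (Y1 := Y) (Y2 := Z) (Z1 := fun z => Y (z + t))
    (Z2 := fun z => Z (z + t)) (fun z _ hz => hp z hz) (fun z _ hz => by
      have h2 := PairAt.comp (φ := fun s => s + t) (ψ := fun _ => 1) (z := z)
        (by fun_prop) (by fun_prop) (Eventually.of_forall fun x => by simp)
        (hp _ (fun h => hz ((hSt z).1 h)))
      simp only [norm_one, one_pow, one_mul, hw] at h2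
      exact h2)
  refine ⟨a, b, hab, fun z => ?_⟩
  by_cases hz : z ∈ S
  · have := h0 z hz
    have := h0 (z + t) ((hSt z).2 hz)
    simp [*]
  · exact h z (mem_univ _) hz

lemma PairAt.snd_ne {w : ℂ → ℝ} {Y Z : ℂ → ℂ} {z : ℂ} (h : PairAt w Y Z z) :
    ¬ ∀ᶠ x in 𝓝 z, Z x = 0 := by
  intro h0
  have h1 : Z =ᶠ[𝓝 z] fun _ => 0 := h0
  have h2 := h.2.2.self_of_nhds.1
  rw [h1.deriv_eq, h1.self_of_nhds] at h2
  simp at h2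

lemma PairAt.fst_ne {w : ℂ → ℝ} {Y Z : ℂ → ℂ} {z : ℂ} (h : PairAt w Y Z z) :
    ¬ ∀ᶠ x in 𝓝 z, Y x = 0 := by
  intro h0
  have h1 : Y =ᶠ[𝓝 z] fun _ => 0 := h0
  have h2 := h.2.2.self_of_nhds.1
  rw [h1.deriv_eq, h1.self_of_nhds] at h2
  simp at h2

lemma exists_not_sing {S : Set ℂ} (hS : S.Countable) : ∃ z, z ∉ S := by
  by_contra h
  push Not at h
  have : S = univ := eq_univ_of_forall h
  rw [this] at hS
  have h2 : (univ : Set ℂ).Countable := hS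
  exact not_countable_complex h2

/-- rotate to make the shift by `t` diagonal -/
lemma rot_diag {Y Z : ℂ → ℂ} {a b t : ℂ} (hab : a * conj a + b * conj b = 1)
    (h : ∀ z, Y (z + t) = a * Y z + b * Z z ∧ Z (z + t) = - conj b * Y z + conj a * Z z) :
    ∃ c d μ : ℂ, c * conj c + d * conj d = 1 ∧ μ * conj μ = 1 ∧
      ∀ z, c * Y (z + t) + d * Z (z + t) = μ * (c * Y z + d * Z z) ∧
        - conj d * Y (z + t) + conj c * Z (z + t) = conj μ * (- conj d * Y z + conj c * Z z) := by
  obtain ⟨c, d, μ, hcd, hμ, he1, he2⟩ := su2_diag hab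
  refine ⟨c, d, μ, hcd, hμ, fun z => ?_⟩
  rw [(h z).1, (h z).2]
  have f1 := congrArg conj he1
  have f2 := congrArg conj he2
  simp only [map_mul, map_sub, map_add, Complex.conj_conj] at f1 f2
  constructor
  · linear_combination (Y z) * he1 + (Z z) * he2
  · linear_combination (Z z) * f1 - (Y z) * f2

theorem global_pair {τ : ℂ} (hτ : 0 < τ.im) {m : Fin 4 → ℕ} {u : ℂ → ℝ}
    (hu : IsCurvatureSolution τ m u) : ∃ (Y Z : ℂ → ℂ) (μ ν : ℂ),
      (∀ z, MeromorphicAt Y z ∧ MeromorphicAt Z z) ∧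
      (∀ z ∉ singSet τ m, PairAt (wof u) Y Z z) ∧ (∀ z ∈ singSet τ m, Y z = 0 ∧ Z z = 0) ∧
      μ * conj μ = 1 ∧ ν * conj ν = 1 ∧
      (∀ z, Y (z + 1) = μ * Y z ∧ Z (z + 1) = conj μ * Z z) ∧
      (∀ z, Y (z + τ) = ν * Y z ∧ Z (z + τ) = conj ν * Z z) := by
  have hsub := (singSet_sub τ m).trans (fullSing_sub τ)
  have hcl : IsClosed (singSet τ m) := half_closed hτ hsub
  have hct : (singSet τ m).Countable := half_countable hsub
  set S := singSet τ m with hS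
  set w := wof u with hw
  obtain ⟨Y, hY⟩ := glue_plane (QQ_loc w S) (QQ_ext w hct hcl) (by
    intro z
    by_cases hz : z ∈ S
    · obtain ⟨k, hk, l, hl, hzp⟩ := hz
      obtain ⟨c₁, c₂, ε, hc₁, hε, hb⟩ := wof_bounds hu hk hl hzp
      obtain ⟨ε', hε', hiso⟩ := Metric.eventually_nhds_iff_ball.1
        (eventually_nhdsWithin_iff.1 (isolated hτ hsub z))
      have hr : 0 < min ε ε' := lt_min hε hε'
      obtain ⟨A, B, hAB, mA, mB⟩ := sing_pair (w := w) (p := z) (c₁ := c₁) (c₂ := c₂) (m k) hr hc₁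
        (fun x hx hne => good_of_sol hτ hu
          (hiso x (ball_subset_ball (min_le_right _ _) hx) hne))
        (fun x hx hne => hb x (ball_subset_ball (min_le_left _ _) hx) hne)
      classical
      refine ⟨fun x => if x = z then 0 else (A x, B x), ?_⟩
      have hev : ∀ x, x ≠ z → (fun x => if x = z then (0 : ℂ × ℂ) else (A x, B x)) =ᶠ[𝓝 x]
          fun x => (A x, B x) := by
        intro x hx
        filter_upwards [isOpen_compl_singleton.mem_nhds hx] with y hy
        rw [if_neg (show ¬ y = _ from hy)]
      filter_upwards [ball_mem_nhds z hr] with x hx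
      by_cases hxz : x = z
      · subst hxz
        have hz : x ∈ S := ⟨k, hk, l, hl, hzp⟩
        refine ⟨fun h => absurd hz h, fun _ => by simp, ?_, ?_⟩
        · refine mA.congr ?_
          filter_upwards [self_mem_nhdsWithin] with y hy
          rw [if_neg (show ¬ y = _ from hy)]
        · refine mB.congr ?_
          filter_upwards [self_mem_nhdsWithin] with y hy
          rw [if_neg (show ¬ y = _ from hy)]
      · have hp := hAB x hx hxz
        refine QQ_loc w S x _ _ (hev x hxz).symm ⟨fun _ => hp, fun h => ?_, hp.1.meromorphicAt,
          hp.2.1.meromorphicAt⟩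
        exact absurd h (hiso x (ball_subset_ball (min_le_right _ _) hx) hxz)
    · obtain ⟨A, B, hAB⟩ := local_pair (good_of_sol hτ hu hz)
      refine ⟨fun x => (A x, B x), ?_⟩
      filter_upwards [hAB.eventually, hcl.isOpen_compl.mem_nhds hz] with x hx hxS
      exact ⟨fun _ => hx, fun h => absurd h hxS, hx.1.meromorphicAt, hx.2.1.meromorphicAt⟩)
  set A : ℂ → ℂ := fun s => (Y s).1
  set B : ℂ → ℂ := fun s => (Y s).2
  have hAB : ∀ s ∉ S, PairAt w A B s := fun s hs => (hY s).1 hs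
  have hAB0 : ∀ s ∈ S, A s = 0 ∧ B s = 0 := fun s hs => by
    have := (hY s).2.1 hs
    simp only [A, B, this]; simp
  have hABm : ∀ s, MeromorphicAt A s ∧ MeromorphicAt B s := fun s => (hY s).2.2
  have hw1 : ∀ z, w (z + 1) = w z := fun z => by simp only [hw, wof, hu.1 z]
  have hw2 : ∀ z, w (z + τ) = w z := fun z => by simp only [hw, wof, hu.2.1 z]
  obtain ⟨a, b, hab, hsh⟩ := shift_rel hct hcl hAB hAB0 hw1 (singSet_shift (lat_one τ))
  obtain ⟨c, d, μ, hcd, hμ, hdiag⟩ := rot_diag hab hsh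
  set A' : ℂ → ℂ := fun z => c * A z + d * B z with hA'
  set B' : ℂ → ℂ := fun z => - conj d * A z + conj c * B z with hB'
  have rotm : ∀ (A B : ℂ → ℂ), (∀ s, MeromorphicAt A s ∧ MeromorphicAt B s) → ∀ c d : ℂ,
      ∀ s, MeromorphicAt (fun z => c * A z + d * B z) s := by
    intro A B h c d s
    exact ((MeromorphicAt.const c s).mul (h s).1).add ((MeromorphicAt.const d s).mul (h s).2)
  have hAB' : ∀ s ∉ S, PairAt w A' B' s := fun s hs => (hAB s hs).rot hcd
  have hAB0' : ∀ s ∈ S, A' s = 0 ∧ B' s = 0 := fun s hs => by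
    simp [hA', hB', hAB0 s hs]
  have hABm' : ∀ s, MeromorphicAt A' s ∧ MeromorphicAt B' s := fun s =>
    ⟨rotm A B hABm _ _ s, rotm A B hABm _ _ s⟩
  obtain ⟨a₂, b₂, hab₂, hsh₂⟩ := shift_rel hct hcl hAB' hAB0' hw2 (singSet_shift (lat_tau τ))
  by_cases hμμ : μ = conj μ
  · obtain ⟨c₂, d₂, ν, hcd₂, hν, hdiag₂⟩ := rot_diag hab₂ hsh₂
    refine ⟨fun z => c₂ * A' z + d₂ * B' z, fun z => - conj d₂ * A' z + conj c₂ * B' z, μ, ν,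
      fun s => ⟨rotm A' B' hABm' _ _ s, rotm A' B' hABm' _ _ s⟩,
      fun z hz => (hAB' z hz).rot hcd₂, fun z hz => by simp [hAB0' z hz], hμ, hν,
      fun z => ?_, hdiag₂⟩
    have h1 : A' (z + 1) = μ * A' z := (hdiag z).1
    have h2 : B' (z + 1) = conj μ * B' z := (hdiag z).2
    rw [← hμμ] at h2 ⊢
    simp only
    rw [h1, h2]
    constructor <;> ring
  · have hb : b₂ = 0 := by
      by_contra hb
      obtain ⟨z₀, hz₀⟩ := exists_not_sing hct
      refine (hAB' z₀ hz₀).snd_ne (Eventually.of_forall fun z => ?_)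
      have e1 := (hdiag (z + τ)).1
      have e2 := (hsh₂ (z + 1)).1
      have e3 := (hsh₂ z).1
      have e4 : A' (z + 1) = μ * A' z := (hdiag z).1
      have e5 : B' (z + 1) = conj μ * B' z := (hdiag z).2
      have e6 : A' (z + τ + 1) = μ * A' (z + τ) := e1
      rw [show z + τ + 1 = z + 1 + τ by ring, e2, e3, e4, e5] at e6
      have e7 : (b₂ * (conj μ - μ)) * B' z = 0 := by linear_combination e6
      rcases mul_eq_zero.1 e7 with h | h
      · rcases mul_eq_zero.1 h with h | h
        · exact absurd h hb
        · exact absurd (sub_eq_zero.1 h).symm hμμ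
      · exact h
    subst hb
    refine ⟨A', B', μ, a₂, hABm', hAB', hAB0', hμ, by simpa using hab₂, hdiag, fun z => ?_⟩
    have := hsh₂ z
    simpa using this

lemma wof_log (u : ℂ → ℝ) (z : ℂ) : u z = Real.log (8 / (wof u z) ^ 2) := by
  unfold wof
  rw [mul_pow, Real.sq_sqrt (by norm_num), ← Real.exp_nat_mul,
    show (8 : ℝ) / (8 * Real.exp (((2 : ℕ) : ℝ) * (-u z / 2))) = Real.exp (u z) by
      push_cast
      rw [show (2 : ℝ) * (-u z / 2) = - u z by ring, Real.exp_neg]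
      field_simp, Real.log_exp]

lemma dev_formula {u : ℂ → ℝ} {Y Z : ℂ → ℂ} {x : ℂ} (h : PairAt (wof u) Y Z x) (hZ : Z x ≠ 0) :
    u x = Real.log (8 * ‖deriv (fun z => Y z / Z z) x‖ ^ 2 / (1 + ‖Y x / Z x‖ ^ 2) ^ 2) := by
  have hw := h.norm_eq
  have hd := (h.1.differentiableAt.hasDerivAt.div h.2.1.differentiableAt.hasDerivAt hZ).deriv
  have hW := h.2.2.self_of_nhds.1
  have e1 : deriv (fun z => Y z / Z z) x = - 1 / Z x ^ 2 := by
    refine hd.trans ?_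
    congr 1
    linear_combination - hW
  have hn : 0 < ‖Z x‖ := norm_pos_iff.2 hZ
  rw [wof_log u x, e1, ← hw]
  congr 1
  rw [norm_div, norm_neg, norm_one, norm_pow, norm_div]
  have : 0 < ‖Y x‖ ^ 2 + ‖Z x‖ ^ 2 := by positivity
  field_simp
  ring

theorem typeII {τ : ℂ} (hτ : 0 < τ.im) {m : Fin 4 → ℕ} {u : ℂ → ℝ}
    (hu : IsCurvatureSolution τ m u) : ∃ f : ℂ → ℂ, IsDevelopingMapOf u f ∧ IsTypeII τ f := by
  obtain ⟨Y, Z, μ, ν, hmer, hp, h0, hμ, hν, hs1, hs2⟩ := global_pair hτ hu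
  have hsub := (singSet_sub τ m).trans (fullSing_sub τ)
  have hcl : IsClosed (singSet τ m) := half_closed hτ hsub
  refine ⟨fun z => Y z / Z z, ⟨fun z => (hmer z).1.div (hmer z).2, ?_⟩, ?_⟩
  · intro z hf hf'
    have hiso := isolated hτ hsub z
    have hZ : ∀ᶠ x in 𝓝[≠] z, Z x ≠ 0 := by
      rcases (hmer z).2.eventually_eq_zero_or_eventually_ne_zero with h | h
      · exfalso
        have h2 := (eventually_eventually_nhdsWithin.2 h)
        obtain ⟨x, hx, hx2, hx3⟩ := (h2.and (hiso.and self_mem_nhdsWithin)).exists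
        have h4 : 𝓝[≠] z ⊔ 𝓝[≠] x ≥ 𝓝[≠] x := le_sup_right
        obtain ⟨r, hr, hb⟩ := Metric.mem_nhdsWithin_iff.1 h
        refine (hp x hx2).snd_ne ?_
        have hx3' : x ≠ z := hx3
        rw [eventually_nhdsWithin_iff, ] at h
        have h5 := eventually_eventually_nhdsWithin.2 (eventually_nhdsWithin_iff.2 h)
        rw [nhdsWithin_eq_nhds.2 (isOpen_compl_singleton.mem_nhds hx3')] at hx
        exact hx
      · exact h
    have hform : ∀ᶠ x in 𝓝[≠] z, u x = Real.log (8 * ‖deriv (fun z => Y z / Z z) x‖ ^ 2 /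
        (1 + ‖Y x / Z x‖ ^ 2) ^ 2) := by
      filter_upwards [hiso, hZ] with x hx hx2
      exact dev_formula (hp x hx) hx2
    have hct : Tendsto (fun x => Real.log (8 * ‖deriv (fun z => Y z / Z z) x‖ ^ 2 /
        (1 + ‖Y x / Z x‖ ^ 2) ^ 2)) (𝓝[≠] z) (𝓝 (Real.log (8 * ‖deriv (fun z => Y z / Z z) z‖ ^ 2 /
        (1 + ‖Y z / Z z‖ ^ 2) ^ 2))) := by
      refine Tendsto.mono_left ?_ nhdsWithin_le_nhds
      have c1 : ContinuousAt (fun x => 8 * ‖deriv (fun z => Y z / Z z) x‖ ^ 2 /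
        (1 + ‖Y x / Z x‖ ^ 2) ^ 2) z :=
        (continuousAt_const.mul (hf.deriv.continuousAt.norm.pow 2)).div
          ((continuousAt_const.add (hf.continuousAt.norm.pow 2)).pow 2) (by positivity)
      refine c1.tendsto.log ?_
      have : 0 < ‖deriv (fun z => Y z / Z z) z‖ := norm_pos_iff.2 hf'
      positivity
    have htu := hct.congr' (hform.mono fun x hx => hx.symm)
    by_cases hz : z ∈ singSet τ m
    · exfalso
      obtain ⟨k, hk, l, hl, hzp⟩ := hz
      obtain ⟨C, ε, hε, hb⟩ := hu.2.2.2 k hk l hl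
      rw [← hzp] at hb
      have hr : Tendsto (fun x => ‖x - z‖) (𝓝[≠] z) (𝓝[≠] 0) := by
        refine tendsto_nhdsWithin_iff.2 ⟨?_, ?_⟩
        · have : Tendsto (fun x : ℂ => ‖x - z‖) (𝓝 z) (𝓝 (‖z - z‖)) :=
            (Continuous.tendsto (by fun_prop) z)
          simp only [sub_self, norm_zero] at this
          exact this.mono_left nhdsWithin_le_nhds
        · filter_upwards [self_mem_nhdsWithin] with x hx
          exact (norm_pos_iff.2 (sub_ne_zero.2 hx)).ne'
      have hlog := Real.tendsto_log_nhdsNE_zero.comp hr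
      have hk' : (0 : ℝ) < 4 * (m k : ℝ) := by
        have : (1 : ℝ) ≤ m k := by exact_mod_cast hk
        linarith
      have hbot : Tendsto u (𝓝[≠] z) atBot := by
        refine tendsto_atBot_mono' _ ?_
          (tendsto_atBot_add_const_right _ C (hlog.const_mul_atBot hk'))
        have : ∀ᶠ x in 𝓝[≠] z, x ∈ ball z ε := nhdsWithin_le_nhds (ball_mem_nhds z hε)
        filter_upwards [this, self_mem_nhdsWithin] with x hx hne
        have := (abs_le.1 (hb x hne hx)).2
        rw [dist_eq_norm] at this
        simp only [Function.comp]
        linarith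
      exact not_tendsto_nhds_of_tendsto_atBot hbot _ htu
    · have hcu : ContinuousAt u z := ((hu.2.2.1 z hz).1 0).continuousAt
      exact tendsto_nhds_unique (hcu.tendsto.mono_left nhdsWithin_le_nhds) htu
  · obtain ⟨θ₁, h1⟩ := unit_exp hμ
    obtain ⟨θ₂, h2⟩ := unit_exp hν
    have key : ∀ (μ : ℂ) (θ : ℝ), μ * conj μ = 1 → μ = Complex.exp (Complex.I * θ) → ∀ A B : ℂ,
        μ * A / (conj μ * B) = Complex.exp (2 * Complex.I * θ) * (A / B) := by
      intro μ θ hμ he A B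
      have hc : conj μ ≠ 0 := fun h => by rw [h] at hμ; simp at hμ
      have : Complex.exp (2 * Complex.I * θ) = μ / conj μ := by
        rw [eq_div_iff hc, show 2 * Complex.I * (θ : ℂ) = Complex.I * θ + Complex.I * θ by ring,
          Complex.exp_add, ← he, mul_assoc, hμ, mul_one]
      rw [this, mul_div_mul_comm]
    refine ⟨θ₁, θ₂, fun z => ?_, fun z => ?_⟩
    · simp only
      rw [(hs1 z).1, (hs1 z).2, key μ θ₁ hμ h1]
    · simp only
      rw [(hs2 z).1, (hs2 z).2, key ν θ₂ hν h2]

noncomputable def LP (τ : ℂ) (hτ : 0 < τ.im) : PeriodPair where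
  ω₁ := 1
  ω₂ := τ
  indep := by
    rw [LinearIndependent.pair_iff]
    intro s t h
    have h2 := congrArg Complex.im h
    have h1 := congrArg Complex.re h
    simp at h1 h2
    rcases h2 with h2 | h2
    · subst h2; simpa using h1
    · exact absurd h2 hτ.ne'

lemma LP_lat {τ : ℂ} (hτ : 0 < τ.im) (z : ℂ) : z ∈ (LP τ hτ).lattice ↔ z ∈ lat τ := by
  rw [PeriodPair.mem_lattice]
  constructor
  · rintro ⟨a, b, h⟩
    exact ⟨a, b, by rw [← h]; simp [LP]⟩
  · rintro ⟨a, b, h⟩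
    exact ⟨a, b, by rw [h]; simp [LP]⟩

lemma LP_symm {τ : ℂ} (hτ : 0 < τ.im) (p : ℤ × ℤ) :
    (((LP τ hτ).latticeEquivProd.symm p : (LP τ hτ).lattice) : ℂ) = latPt τ p := by
  rw [PeriodPair.latticeEquiv_symm_apply]
  simp [LP, latPt]

lemma latPt_ne {τ : ℂ} (hτ : 0 < τ.im) {p : ℤ × ℤ} (h : p ≠ 0) : latPt τ p ≠ 0 := by
  intro h0
  rw [← LP_symm hτ] at h0
  apply h
  have : (LP τ hτ).latticeEquivProd.symm p = 0 := Subtype.ext h0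
  simpa using this

lemma latPt_mem (τ : ℂ) (p : ℤ × ℤ) : latPt τ p ∈ lat τ := ⟨p.1, p.2, rfl⟩

lemma sum_inv3 {τ : ℂ} (hτ : 0 < τ.im) :
    Summable fun p : {p : ℤ × ℤ // p ≠ 0} => ‖latPt τ p.1‖⁻¹ ^ 3 := by
  have h := ZLattice.summable_norm_pow_inv (LP τ hτ).lattice 3 (by simp)
  have h2 := (Equiv.summable_iff (LP τ hτ).latticeEquivProd.symm.toEquiv).2 h
  have h3 := h2.subtype {p | p ≠ 0}
  refine h3.congr fun p => ?_
  have := LP_symm hτ p.1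
  rw [← this]
  rfl

lemma wp_eq {τ : ℂ} (hτ : 0 < τ.im) (z : ℂ) : wp τ z = (LP τ hτ).weierstrassP z := by
  have h := (LP τ hτ).hasSum_weierstrassP z
  have h2 := ((Equiv.hasSum_iff (LP τ hτ).latticeEquivProd.symm.toEquiv).2 h)
  have h3 := h2.summable.tsum_eq_add_tsum_ite (0 : ℤ × ℤ)
  rw [h2.tsum_eq] at h3
  rw [h3]
  unfold wp
  congr 1
  · have := LP_symm hτ 0
    simp
  · refine (tsum_subtype {p : ℤ × ℤ | p ≠ 0} (fun p => 1 / (z - latPt τ p) ^ 2 - 1 / latPt τ p ^ 2)).trans ?_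
    congr 1
    ext p
    have := LP_symm hτ p
    simp only [Set.indicator, mem_setOf_eq, ne_eq]
    rw [← this]
    by_cases h0 : p = 0
    · simp [h0]
    · simp [h0]

lemma wp_periodic {τ : ℂ} (hτ : 0 < τ.im) {l : ℂ} (hl : l ∈ lat τ) (z : ℂ) :
    wp τ (z + l) = wp τ z := by
  rw [wp_eq hτ, wp_eq hτ]
  exact (LP τ hτ).weierstrassP_add_coe z ⟨l, (LP_lat hτ l).2 hl⟩

noncomputable def zz (τ z : ℂ) : ℂ := ∑' p : {p : ℤ × ℤ // p ≠ 0},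
    (1 / (z - latPt τ p.1) + 1 / latPt τ p.1 + z / latPt τ p.1 ^ 2)

lemma wzeta_zz (τ z : ℂ) : wzeta τ z = 1 / z + zz τ z := rfl

lemma zz_diff {τ : ℂ} (hτ : 0 < τ.im) {z₀ : ℂ} (h0 : z₀ ∉ lat τ \ {0}) :
    ∃ δ > 0, DifferentiableOn ℂ (zz τ) (ball z₀ δ) ∧
      ∀ z ∈ ball z₀ δ, deriv (zz τ) z = - ∑' p : {p : ℤ × ℤ // p ≠ 0},
        (1 / (z - latPt τ p.1) ^ 2 - 1 / latPt τ p.1 ^ 2) := by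
  have hcl : IsClosed (lat τ \ {0}) := half_closed hτ (sdiff_subset.trans ((lat_sub τ).trans (fullSing_sub τ)))
  obtain ⟨ε, hε, hb⟩ := Metric.isOpen_iff.1 hcl.isOpen_compl z₀ h0
  set δ := ε / 2 with hδ
  have hδ0 : 0 < δ := by positivity
  set R := ‖z₀‖ + δ with hR
  have hR0 : 0 < R := by positivity
  set c := min (1 / 2) (δ / (2 * R)) with hc
  have hc0 : 0 < c := by positivity
  have key : ∀ (p : {p : ℤ × ℤ // p ≠ 0}) (z : ℂ), z ∈ ball z₀ δ → c * ‖latPt τ p.1‖ ≤ ‖z - latPt τ p.1‖ := by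
    intro p z hz
    have hzn : ‖z‖ ≤ R := by
      have h1 : ‖z - z₀‖ < δ := by simpa [dist_eq_norm] using hz
      have h2 : ‖z‖ ≤ ‖z₀‖ + ‖z - z₀‖ := by
        have := norm_add_le z₀ (z - z₀); simpa using this
      linarith
    by_cases hw : ‖latPt τ p.1‖ ≤ 2 * R
    · have hd : δ ≤ ‖z - latPt τ p.1‖ := by
        by_contra hlt
        push Not at hlt
        have : latPt τ p.1 ∈ ball z₀ ε := by
          rw [mem_ball, dist_eq_norm]
          have h1 : ‖z - z₀‖ < δ := by simpa [dist_eq_norm] using hz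
          have : latPt τ p.1 - z₀ = (z - z₀) - (z - latPt τ p.1) := by ring
          rw [this]
          have := norm_sub_le (z - z₀) (z - latPt τ p.1)
          linarith
        exact hb this ⟨latPt_mem _ _, latPt_ne hτ p.2⟩
      calc c * ‖latPt τ p.1‖ ≤ δ / (2 * R) * (2 * R) := by
            gcongr
            exact min_le_right _ _
        _ = δ := by field_simp
        _ ≤ _ := hd
    · push Not at hw
      have h1 : ‖latPt τ p.1‖ - ‖z‖ ≤ ‖z - latPt τ p.1‖ := by
        rw [norm_sub_rev]; exact norm_sub_norm_le _ _
      have h2 : c * ‖latPt τ p.1‖ ≤ 1 / 2 * ‖latPt τ p.1‖ := by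
        gcongr; exact min_le_left _ _
      linarith
  have hne : ∀ (p : {p : ℤ × ℤ // p ≠ 0}) (z : ℂ), z ∈ ball z₀ δ → z - latPt τ p.1 ≠ 0 := by
    intro p z hz h
    have := key p z hz
    rw [h, norm_zero] at this
    have h2 : 0 < ‖latPt τ p.1‖ := norm_pos_iff.2 (latPt_ne hτ p.2)
    nlinarith
  have hder : ∀ (p : {p : ℤ × ℤ // p ≠ 0}) (z : ℂ), z ∈ ball z₀ δ →
      HasDerivAt (fun z => 1 / (z - latPt τ p.1) + 1 / latPt τ p.1 + z / latPt τ p.1 ^ 2)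
        (-(1 / (z - latPt τ p.1) ^ 2 - 1 / latPt τ p.1 ^ 2)) z := by
    intro p z hz
    have h1 := ((hasDerivAt_id z).sub_const (latPt τ p.1)).inv (hne p z hz)
    have h2 := (h1.add_const (1 / latPt τ p.1)).add ((hasDerivAt_id z).div_const (latPt τ p.1 ^ 2))
    have h3 : (-1 / (id z - latPt τ p.1) ^ 2 + 1 / latPt τ p.1 ^ 2) = -(1 / (z - latPt τ p.1) ^ 2 - 1 / latPt τ p.1 ^ 2) := by
      simp only [id]; ring
    rw [h3] at h2
    refine h2.congr_of_eventuallyEq (Eventually.of_forall fun w => ?_)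
    simp [Pi.inv_apply]
  have hu : Summable fun p : {p : ℤ × ℤ // p ≠ 0} => R ^ 2 / c * ‖latPt τ p.1‖⁻¹ ^ 3 :=
    (sum_inv3 hτ).mul_left _
  have hbd : ∀ (p : {p : ℤ × ℤ // p ≠ 0}) (z : ℂ), z ∈ ball z₀ δ →
      ‖1 / (z - latPt τ p.1) + 1 / latPt τ p.1 + z / latPt τ p.1 ^ 2‖ ≤ R ^ 2 / c * ‖latPt τ p.1‖⁻¹ ^ 3 := by
    intro p z hz
    have hzn : ‖z‖ ≤ R := by
      have h1 : ‖z - z₀‖ < δ := by simpa [dist_eq_norm] using hz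
      have h2 : ‖z‖ ≤ ‖z₀‖ + ‖z - z₀‖ := by
        have := norm_add_le z₀ (z - z₀); simpa using this
      linarith
    have hn := hne p z hz
    have hl := latPt_ne hτ p.2
    have e : 1 / (z - latPt τ p.1) + 1 / latPt τ p.1 + z / latPt τ p.1 ^ 2
        = z ^ 2 / (latPt τ p.1 ^ 2 * (z - latPt τ p.1)) := by
      field_simp; ring
    have h2 : 0 < ‖latPt τ p.1‖ := norm_pos_iff.2 hl
    rw [e, norm_div, norm_mul, norm_pow, norm_pow]
    calc ‖z‖ ^ 2 / (‖latPt τ p.1‖ ^ 2 * ‖z - latPt τ p.1‖)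
        ≤ R ^ 2 / (‖latPt τ p.1‖ ^ 2 * (c * ‖latPt τ p.1‖)) := by
          gcongr
          exact key p z hz
      _ = _ := by field_simp
  refine ⟨δ, hδ0, ?_, ?_⟩
  · exact Complex.differentiableOn_tsum_of_summable_norm hu
      (fun p z hz => (hder p z hz).differentiableAt.differentiableWithinAt) isOpen_ball hbd
  · intro z hz
    have := Complex.hasSum_deriv_of_summable_norm hu
      (fun p z hz => (hder p z hz).differentiableAt.differentiableWithinAt) isOpen_ball hbd hz
    rw [← tsum_neg]
    rw [show deriv (zz τ) z = _ from this.tsum_eq.symm]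
    congr 1
    ext p
    exact (hder p z hz).deriv

lemma zz_an0 {τ : ℂ} (hτ : 0 < τ.im) : AnalyticAt ℂ (zz τ) 0 := by
  obtain ⟨δ, hδ, h1, h2⟩ := zz_diff hτ (z₀ := 0) (by simp)
  exact h1.analyticAt (ball_mem_nhds _ hδ)

lemma wp_zz {τ : ℂ} (hτ : 0 < τ.im) : ∀ᶠ z in 𝓝 0, wp τ z = 1 / z ^ 2 - deriv (zz τ) z := by
  obtain ⟨δ, hδ, h1, h2⟩ := zz_diff hτ (z₀ := 0) (by simp)
  filter_upwards [ball_mem_nhds _ hδ] with z hz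
  rw [h2 z hz]; simp [wp]

lemma wzeta_an {τ : ℂ} (hτ : 0 < τ.im) {z : ℂ} (hz : z ∉ lat τ) :
    AnalyticAt ℂ (wzeta τ) z ∧ deriv (wzeta τ) z = - wp τ z := by
  have hz0 : z ≠ 0 := by rintro rfl; exact hz (lat_zero τ)
  obtain ⟨δ, hδ, h1, h2⟩ := zz_diff hτ (z₀ := z) (fun h => hz h.1)
  have ha := h1.analyticAt (ball_mem_nhds _ hδ)
  have e : wzeta τ = fun z => z⁻¹ + zz τ z := by ext; simp [wzeta_zz]
  rw [e]
  refine ⟨(analyticAt_id.inv hz0).add ha, ?_⟩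
  have h3 := (hasDerivAt_inv hz0).add ha.differentiableAt.hasDerivAt
  rw [show deriv (fun z => z⁻¹ + zz τ z) z = _ from h3.deriv, h2 z (mem_ball_self hδ)]
  simp [wp]; ring

lemma wp_an {τ : ℂ} (hτ : 0 < τ.im) {z : ℂ} (hz : z ∉ lat τ) : AnalyticAt ℂ (wp τ) z := by
  have hcl : IsClosed (lat τ) := half_closed hτ ((lat_sub τ).trans (fullSing_sub τ))
  have h := (wzeta_an hτ hz).1.deriv.neg
  refine h.congr ?_
  filter_upwards [hcl.isOpen_compl.mem_nhds hz] with w hw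
  simp [(wzeta_an hτ hw).2]

lemma wzeta_odd (τ z : ℂ) : wzeta τ (-z) = - wzeta τ z := by
  unfold wzeta
  rw [neg_add, ← tsum_neg]
  congr 1
  · simp [div_neg]
  · let e : {p : ℤ × ℤ // p ≠ 0} ≃ {p : ℤ × ℤ // p ≠ 0} :=
      (Equiv.neg (ℤ × ℤ)).subtypeEquiv (by intro a; simp)
    rw [← e.tsum_eq]
    congr 1
    ext p
    have : latPt τ (e p).1 = - latPt τ p.1 := by simp [e, latPt]; ring
    rw [this]
    have h1 : -z - -latPt τ p.1 = -(z - latPt τ p.1) := by ring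
    rw [h1, div_neg, div_neg, neg_sq]; ring

lemma lat_closed {τ : ℂ} (hτ : 0 < τ.im) : IsClosed (lat τ) :=
  half_closed hτ ((lat_sub τ).trans (fullSing_sub τ))
lemma lat_countable (τ : ℂ) : (lat τ).Countable :=
  half_countable ((lat_sub τ).trans (fullSing_sub τ))

lemma wzeta_qp {τ : ℂ} (hτ : 0 < τ.im) {l : ℂ} (hl : l ∈ lat τ) :
    ∃ η, ∀ z ∉ lat τ, wzeta τ (z + l) = wzeta τ z + η := by
  have hsh : ∀ z, z ∉ lat τ → z + l ∉ lat τ := by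
    intro z hz h
    apply hz
    have := lat_add h (lat_neg hl)
    simpa using this
  have hd : ∀ z ∉ lat τ, HasDerivAt (fun z => wzeta τ (z + l) - wzeta τ z) 0 z := by
    intro z hz
    have h1 := (wzeta_an hτ (hsh z hz))
    have h2 := wzeta_an hτ hz
    have h3 := (h1.1.differentiableAt.hasDerivAt.comp_add_const z l).sub h2.1.differentiableAt.hasDerivAt
    rw [h1.2, h2.2, wp_periodic hτ hl] at h3
    rw [sub_self] at h3
    exact h3
  obtain ⟨z₁, hz₁⟩ : ∃ z, z ∉ lat τ := by
    by_contra h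
    push Not at h
    have : (univ : Set ℂ).Countable := (lat_countable τ).mono (fun z _ => h z)
    exact not_countable_complex this
  refine ⟨wzeta τ (z₁ + l) - wzeta τ z₁, fun z hz => ?_⟩
  have := const_off (U := univ) (S := lat τ) isOpen_univ isPreconnected_univ (lat_countable τ)
    (lat_closed hτ) (fun z => wzeta τ (z + l) - wzeta τ z) (fun z _ h => (hd z h).differentiableAt)
    (fun z _ h => (hd z h).deriv) z trivial hz z₁ trivial hz₁
  linear_combination this

def ExtAt (F : ℂ → ℂ) (p : ℂ) : Prop := ∃ g, AnalyticAt ℂ g p ∧ ∀ᶠ z in 𝓝[≠] p, F z = g z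

lemma ExtAt.of_an {F : ℂ → ℂ} {p : ℂ} (h : AnalyticAt ℂ F p) : ExtAt F p :=
  ⟨F, h, Eventually.of_forall fun _ => rfl⟩

lemma ExtAt.add {F G : ℂ → ℂ} {p : ℂ} (h : ExtAt F p) (h' : ExtAt G p) :
    ExtAt (fun z => F z + G z) p := by
  obtain ⟨f, hf, e⟩ := h
  obtain ⟨g, hg, e'⟩ := h'
  exact ⟨fun z => f z + g z, hf.add hg, by filter_upwards [e, e'] with z a b; rw [a, b]⟩

lemma ExtAt.cmul {F : ℂ → ℂ} {p : ℂ} (h : ExtAt F p) (c : ℂ) : ExtAt (fun z => c * F z) p := by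
  obtain ⟨f, hf, e⟩ := h
  exact ⟨fun z => c * f z, analyticAt_const.mul hf, by filter_upwards [e] with z a; rw [a]⟩

lemma ExtAt.congr {F G : ℂ → ℂ} {p : ℂ} (h : ExtAt F p) (h' : ∀ᶠ z in 𝓝[≠] p, G z = F z) :
    ExtAt G p := by
  obtain ⟨f, hf, e⟩ := h
  exact ⟨f, hf, by filter_upwards [e, h'] with z a b; rw [b, a]⟩

lemma punct_shift {P : ℂ → Prop} {p c : ℂ} (h : ∀ᶠ z in 𝓝[≠] (p + c), P z) :
    ∀ᶠ z in 𝓝[≠] p, P (z + c) := by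
  rw [eventually_nhdsWithin_iff] at h ⊢
  have hc : Tendsto (fun z : ℂ => z + c) (𝓝 p) (𝓝 (p + c)) :=
    (continuous_id.add continuous_const).tendsto p
  filter_upwards [hc.eventually h] with z hz hne
  exact hz (by simpa using hne)

lemma an_shift {g : ℂ → ℂ} {p c : ℂ} (h : AnalyticAt ℂ g (p + c)) :
    AnalyticAt ℂ (fun z => g (z + c)) p :=
  AnalyticAt.fun_comp (f := fun z => z + c) h (analyticAt_id.add analyticAt_const)

lemma ExtAt.shift {F : ℂ → ℂ} {p c : ℂ} (h : ExtAt F (p + c)) : ExtAt (fun z => F (z + c)) p := by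
  obtain ⟨f, hf, e⟩ := h
  exact ⟨fun z => f (z + c), an_shift hf, punct_shift e⟩

lemma ext_entire {F : ℂ → ℂ} (h : ∀ p, ExtAt F p) :
    ∃ G : ℂ → ℂ, Differentiable ℂ G ∧ ∀ z, AnalyticAt ℂ F z → G z = F z := by
  choose g hg e using h
  have key : ∀ p, ∀ᶠ z in 𝓝 p, g z z = g p z := by
    intro p
    have h1 : ∀ᶠ z in 𝓝[≠] p, g z z = g p z := by
      have e2 : ∀ᶠ z in 𝓝[≠] p, ∀ᶠ x in 𝓝[≠] z, F x = g p x := by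
        have := eventually_eventually_nhdsWithin.2 (e p)
        filter_upwards [this, self_mem_nhdsWithin] with z hz hne
        rw [isOpen_compl_singleton.nhdsWithin_eq hne] at hz
        exact nhdsWithin_le_nhds hz
      have e3 : ∀ᶠ z in 𝓝[≠] p, AnalyticAt ℂ (g p) z :=
        nhdsWithin_le_nhds (hg p).eventually_analyticAt
      filter_upwards [e2, e3] with z h2 h3
      have t1 : Tendsto (g z) (𝓝[≠] z) (𝓝 (g z z)) :=
        (hg z).continuousAt.tendsto.mono_left nhdsWithin_le_nhds
      have t2 : Tendsto (g p) (𝓝[≠] z) (𝓝 (g p z)) :=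
        h3.continuousAt.tendsto.mono_left nhdsWithin_le_nhds
      refine tendsto_nhds_unique (t1.congr' ?_) t2
      filter_upwards [e z, h2] with x a b
      rw [← a, b]
    rw [eventually_nhdsWithin_iff] at h1
    filter_upwards [h1] with z hz
    by_cases hp : z = p
    · rw [hp]
    · exact hz hp
  refine ⟨fun z => g z z, fun p => ?_, fun z hz => ?_⟩
  · exact ((hg p).congr (f := g p) (g := fun z => g z z)
      (by filter_upwards [key p] with z hz using hz.symm)).differentiableAt
  · have t1 : Tendsto (g z) (𝓝[≠] z) (𝓝 (g z z)) :=
      (hg z).continuousAt.tendsto.mono_left nhdsWithin_le_nhds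
    have t2 : Tendsto F (𝓝[≠] z) (𝓝 (F z)) :=
      hz.continuousAt.tendsto.mono_left nhdsWithin_le_nhds
    refine tendsto_nhds_unique (t1.congr' ?_) t2
    filter_upwards [e z] with x a
    rw [a]

lemma eq_off {F G : ℂ → ℂ} (hF : Continuous F) (hG : Continuous G) {S : Set ℂ} (hS : S.Countable)
    (h : ∀ z ∉ S, F z = G z) : F = G :=
  Continuous.ext_on (hS.dense_compl ℂ) hF hG h

lemma per_bounded {τ : ℂ} (hτ : 0 < τ.im) {F : ℂ → ℂ} (hF : Continuous F)
    (h1 : ∀ z, F (z + 1) = F z) (h2 : ∀ z, F (z + τ) = F z) : Bornology.IsBounded (range F) := by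
  have hK : IsCompact ((fun x : ℝ × ℝ => F ((x.1 : ℂ) + x.2 * τ)) '' (Icc 0 1 ×ˢ Icc 0 1)) := by
    apply (isCompact_Icc.prod isCompact_Icc).image
    fun_prop
  refine hK.isBounded.subset ?_
  rintro _ ⟨z, rfl⟩
  set b := z.im / τ.im
  set a := z.re - b * τ.re
  have hz : z = (a : ℂ) + b * τ := by
    apply Complex.ext
    · simp [a]
    · simp [b]; field_simp
  have p1 : Function.Periodic F 1 := h1
  have p2 : Function.Periodic F τ := h2
  refine ⟨(Int.fract a, Int.fract b), ⟨⟨Int.fract_nonneg a, (Int.fract_lt_one a).le⟩,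
    ⟨Int.fract_nonneg b, (Int.fract_lt_one b).le⟩⟩, ?_⟩
  have e : z = (((Int.fract a : ℝ) : ℂ) + (Int.fract b : ℝ) * τ + (⌊a⌋ : ℤ) * 1) + (⌊b⌋ : ℤ) * τ := by
    rw [hz]
    have ea : (a : ℂ) = ((⌊a⌋ : ℤ) : ℂ) + ((Int.fract a : ℝ) : ℂ) := by
      exact_mod_cast (Int.floor_add_fract a).symm
    have eb : (b : ℂ) = ((⌊b⌋ : ℤ) : ℂ) + ((Int.fract b : ℝ) : ℂ) := by
      exact_mod_cast (Int.floor_add_fract b).symm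
    linear_combination ea + τ * eb
  simp only
  conv_rhs => rw [e]
  rw [(p2.int_mul _) _, (p1.int_mul _) _]

lemma entire_affine {τ : ℂ} (hτ : 0 < τ.im) {F : ℂ → ℂ} {S : Set ℂ} (hS : S.Countable)
    (hS1 : ∀ z, z ∉ S → z + 1 ∉ S) (hS2 : ∀ z, z ∉ S → z + τ ∉ S)
    (hF : ∀ z ∉ S, AnalyticAt ℂ F z) (he : ∀ p, ExtAt F p) {A B : ℂ}
    (h1 : ∀ z ∉ S, F (z + 1) = F z + A) (h2 : ∀ z ∉ S, F (z + τ) = F z + B) :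
    ∃ α β, (∀ z ∉ S, F z = α * z + β) ∧ A = α ∧ B = α * τ := by
  obtain ⟨G, hG, hGF⟩ := ext_entire he
  have hGc := hG.continuous
  have g1 : ∀ z, G (z + 1) = G z + A := by
    have := eq_off (F := fun z => G (z + 1)) (G := fun z => G z + A) (by fun_prop) (by fun_prop) hS
      (fun z hz => by rw [hGF z (hF z hz), hGF _ (hF _ (hS1 z hz)), h1 z hz])
    exact fun z => congrFun this z
  have g2 : ∀ z, G (z + τ) = G z + B := by
    have := eq_off (F := fun z => G (z + τ)) (G := fun z => G z + B) (by fun_prop) (by fun_prop) hS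
      (fun z hz => by rw [hGF z (hF z hz), hGF _ (hF _ (hS2 z hz)), h2 z hz])
    exact fun z => congrFun this z
  have hG' : Differentiable ℂ (deriv G) := by
    have := (hG.differentiableOn (s := univ)).deriv isOpen_univ
    exact fun z => (this z trivial).differentiableAt univ_mem
  have d : ∀ t C, (∀ z, G (z + t) = G z + C) → ∀ z, deriv G (z + t) = deriv G z := by
    intro t C h z
    rw [← deriv_comp_add_const]
    have : (fun x => G (x + t)) = fun x => G x + C := funext h
    rw [this, deriv_add_const]
  have hb := per_bounded hτ hG'.continuous (d 1 A g1) (d τ B g2)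
  have hconst := hG'.apply_eq_apply_of_bounded hb
  set α := deriv G 0
  have hder : ∀ z, HasDerivAt (fun z => G z - α * z) 0 z := by
    intro z
    have := (hG z).hasDerivAt.sub ((hasDerivAt_id z).const_mul α)
    rw [hconst z 0] at this
    simp only [mul_one, α, sub_self] at this
    exact this
  have hc := is_const_of_deriv_eq_zero (f := fun z => G z - α * z) (fun z => (hder z).differentiableAt)
    (fun z => (hder z).deriv)
  have hGa : ∀ z, G z = α * z + G 0 := by
    intro z
    have := hc z 0
    linear_combination this
  refine ⟨α, G 0, fun z hz => by rw [← hGF z (hF z hz), hGa], ?_, ?_⟩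
  · have := g1 0
    rw [hGa (0 + 1)] at this
    linear_combination -this
  · have := g2 0
    rw [hGa (0 + τ)] at this
    linear_combination -this

lemma per_all {τ : ℂ} {F : ℂ → ℂ} {S : Set ℂ} (hS : ∀ t ∈ lat τ, ∀ z, z + t ∈ S ↔ z ∈ S)
    (h1 : ∀ z ∉ S, F (z + 1) = F z) (h2 : ∀ z ∉ S, F (z + τ) = F z) :
    ∀ l ∈ lat τ, ∀ z ∉ S, F (z + l) = F z := by
  classical
  set G : ℂ → ℂ := fun z => if z ∈ S then 0 else F z with hG
  have p1 : Function.Periodic G 1 := by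
    intro z
    by_cases hz : z ∈ S
    · simp [hG, hz, (hS 1 (lat_one τ) z).2 hz]
    · simp [hG, hz, (hS 1 (lat_one τ) z), h1 z hz]
  have p2 : Function.Periodic G τ := by
    intro z
    by_cases hz : z ∈ S
    · simp [hG, hz, (hS τ (lat_tau τ) z).2 hz]
    · simp [hG, hz, (hS τ (lat_tau τ) z), h2 z hz]
  rintro l ⟨a, b, rfl⟩ z hz
  have e : G (z + ((a : ℂ) + b * τ)) = G z := by
    have : z + ((a : ℂ) + b * τ) = z + (a : ℤ) * 1 + (b : ℤ) * τ := by push_cast; ring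
    rw [this, (p2.int_mul b) _, (p1.int_mul a) _]
  have h3 := hS _ ⟨a, b, rfl⟩ z
  simpa [hG, hz, h3] using e

lemma lat_shift {τ t : ℂ} (ht : t ∈ lat τ) (z : ℂ) : z + t ∈ lat τ ↔ z ∈ lat τ := by
  constructor
  · intro h; simpa using lat_add h (lat_neg ht)
  · intro h; exact lat_add h ht

lemma wzeta_pole {τ : ℂ} (hτ : 0 < τ.im) {l : ℂ} (hl : l ∈ lat τ) :
    ∃ g, AnalyticAt ℂ g l ∧ ∀ᶠ z in 𝓝[≠] l, wzeta τ z = 1 / (z - l) + g z := by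
  obtain ⟨η, hη⟩ := wzeta_qp hτ hl
  refine ⟨fun z => zz τ (z + -l) + η, ?_, ?_⟩
  · refine (an_shift ?_).add analyticAt_const
    simpa using zz_an0 hτ
  · filter_upwards [isolated hτ ((lat_sub τ).trans (fullSing_sub τ)) l] with z hz
    have hz' : z + -l ∉ lat τ := by rwa [lat_shift (lat_neg hl)]
    have := hη _ hz'
    rw [neg_add_cancel_right] at this
    rw [this, wzeta_zz, ← sub_eq_add_neg]; ring

lemma wp_pole {τ : ℂ} (hτ : 0 < τ.im) {l : ℂ} (hl : l ∈ lat τ) :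
    ∃ g, AnalyticAt ℂ g l ∧ ∀ᶠ z in 𝓝[≠] l, wp τ z = 1 / (z - l) ^ 2 + g z := by
  refine ⟨fun z => - deriv (zz τ) (z + -l), ?_, ?_⟩
  · refine (an_shift (g := deriv (zz τ)) ?_).neg
    simpa using (zz_an0 hτ).deriv
  · have := punct_shift (p := l) (c := -l) (P := fun z => wp τ z = 1 / z ^ 2 - deriv (zz τ) z)
      (by rw [add_neg_cancel]; exact nhdsWithin_le_nhds (wp_zz hτ))
    filter_upwards [this] with z hz
    rw [wp_periodic hτ (lat_neg hl)] at hz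
    rw [hz, ← sub_eq_add_neg]; ring

lemma half_lat {τ : ℂ} (hτ : 0 < τ.im) {a b : ℤ} (h : ((a : ℂ) + b * τ) / 2 ∈ lat τ) :
    2 ∣ a ∧ 2 ∣ b := by
  obtain ⟨m, n, h⟩ := h
  have h' : (a : ℂ) + b * τ = 2 * (m + n * τ) := by rw [← h]; ring
  have hi := congrArg Complex.im h'
  have hr := congrArg Complex.re h'
  simp at hi hr
  have hb : (b : ℝ) = 2 * n := by
    have : ((b : ℝ) - 2 * n) * τ.im = 0 := by linarith
    rcases mul_eq_zero.1 this with h | h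
    · linarith
    · exact absurd h hτ.ne'
  have ha : (a : ℝ) = 2 * m := by rw [hb] at hr; linarith
  exact ⟨⟨m, by exact_mod_cast ha⟩, ⟨n, by exact_mod_cast hb⟩⟩

lemma ext_pole_zero {a k g : ℂ → ℂ} {p : ℂ} (hg : AnalyticAt ℂ g p)
    (ha : ∀ᶠ z in 𝓝[≠] p, a z = 1 / (z - p) + g z) (hk : AnalyticAt ℂ k p) (h0 : k p = 0) :
    ExtAt (fun z => a z * k z) p := by
  obtain ⟨k1, hk1, e⟩ : ∃ k1, AnalyticAt ℂ k1 p ∧ ∀ᶠ z in 𝓝[≠] p, k z = (z - p) * k1 z := by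
    refine ⟨dslope k p, ?_, ?_⟩
    · obtain ⟨P, hP⟩ := hk
      exact (hP.has_fpower_series_dslope_fslope).analyticAt
    · filter_upwards [self_mem_nhdsWithin] with z hz
      have := sub_smul_dslope k p z
      rw [h0, sub_zero] at this
      rw [← this]; rfl
  refine ⟨fun z => k1 z + g z * k z, hk1.add (hg.mul hk), ?_⟩
  filter_upwards [ha, e, self_mem_nhdsWithin] with z h1 h2 h3
  have : z - p ≠ 0 := sub_ne_zero.2 h3
  rw [h1, h2]; field_simp

lemma nondeg {τ : ℂ} (hτ : 0 < τ.im) {η₁ η₂ : ℂ} (h1 : ∀ z ∉ lat τ, wzeta τ (z + 1) = wzeta τ z + η₁)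
    (h2 : ∀ z ∉ lat τ, wzeta τ (z + τ) = wzeta τ z + η₂) : η₂ ≠ τ * η₁ := by
  intro hη
  set h : ℂ → ℂ := fun z => wzeta τ z - η₁ * z with hh
  have hper := per_all (F := h) (S := lat τ) (fun t ht z => lat_shift ht z)
    (fun z hz => by simp only [hh, h1 z hz]; ring)
    (fun z hz => by simp only [hh, h2 z hz, hη]; ring)
  have hodd : ∀ z, h (-z) = - h z := fun z => by simp only [hh, wzeta_odd]; ring
  have han : ∀ z ∉ lat τ, AnalyticAt ℂ h z := fun z hz =>
    (wzeta_an hτ hz).1.sub (analyticAt_const.mul analyticAt_id)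
  have hpole : ∀ l ∈ lat τ, ∃ g, AnalyticAt ℂ g l ∧ ∀ᶠ z in 𝓝[≠] l, h z = 1 / (z - l) + g z := by
    intro l hl
    obtain ⟨g, hg, e⟩ := wzeta_pole hτ hl
    refine ⟨fun z => g z - η₁ * z, hg.sub (analyticAt_const.mul analyticAt_id), ?_⟩
    filter_upwards [e] with z hz
    simp only [hh, hz]; ring
  have zero : ∀ p ∉ lat τ, 2 * p ∈ lat τ → h p = 0 := by
    intro p hp h2p
    have hm : -p ∉ lat τ := fun h => hp (by simpa using lat_neg h)
    have := hper _ h2p _ hm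
    rw [hodd, show -p + 2 * p = p by ring] at this
    linear_combination this / 2
  have n1 : (1 / 2 : ℂ) ∉ lat τ := fun h => by
    have := (half_lat hτ (a := 1) (b := 0) (by simpa using h)).1; omega
  have n2 : (τ / 2 : ℂ) ∉ lat τ := fun h => by
    have := (half_lat hτ (a := 0) (b := 1) (by simpa using h)).2; omega
  have n3 : (τ / 2 + 1 / 2 : ℂ) ∉ lat τ := fun h => by
    have := (half_lat hτ (a := 1) (b := 1) (by convert h using 1; push_cast; ring)).2; omega
  have two_half : 2 * (1 / 2 : ℂ) ∈ lat τ := by simpa using lat_one τ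
  set φ : ℂ → ℂ := fun z => h z * h (z + 1 / 2)
  set S : Set ℂ := {z | z ∈ lat τ ∨ z + 1 / 2 ∈ lat τ} with hS
  have hSsub : S ⊆ range (hp τ) := by
    rintro z (hz | ⟨a, b, hz⟩)
    · exact fullSing_sub τ (lat_sub τ hz)
    · refine ⟨(2 * a - 1, 2 * b), ?_⟩
      simp only [hp]; push_cast
      linear_combination -hz
  have hSsh : ∀ t ∈ lat τ, ∀ z, z + t ∈ S ↔ z ∈ S := by
    intro t ht z
    simp only [hS, mem_ofPred_eq, lat_shift ht]
    rw [show z + t + 1 / 2 = (z + 1 / 2) + t by ring, lat_shift ht]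
  have hφan : ∀ z ∉ S, AnalyticAt ℂ φ z := by
    intro z hz
    have hz' : z ∉ lat τ ∧ z + 1 / 2 ∉ lat τ := by simpa [hS] using hz
    exact (han z hz'.1).mul (an_shift (han _ hz'.2))
  have hφper : ∀ t ∈ lat τ, ∀ z ∉ S, φ (z + t) = φ z := by
    intro t ht z hz
    have hz' : z ∉ lat τ ∧ z + 1 / 2 ∉ lat τ := by simpa [hS] using hz
    simp only [φ]
    rw [hper t ht z hz'.1, show z + t + 1 / 2 = (z + 1 / 2) + t by ring, hper t ht _ hz'.2]
  have hφext : ∀ p, ExtAt φ p := by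
    intro p
    by_cases hp1 : p ∈ lat τ
    · obtain ⟨g, hg, e⟩ := hpole p hp1
      have hn : p + 1 / 2 ∉ lat τ := by
        rw [add_comm, lat_shift hp1]; exact n1
      refine ext_pole_zero hg e (an_shift (han _ hn)) (zero _ hn ?_)
      rw [show 2 * (p + 1 / 2) = (p + p) + 1 by ring]
      exact lat_add (lat_add hp1 hp1) (lat_one τ)
    · by_cases hp2 : p + 1 / 2 ∈ lat τ
      · obtain ⟨g, hg, e⟩ := hpole _ hp2
        have := ext_pole_zero (a := fun z => h (z + 1 / 2)) (k := h) (an_shift hg)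
          (by filter_upwards [punct_shift e] with z hz; rw [hz]; congr 2; ring) (han p hp1) (zero p hp1 (by
            rw [show 2 * p = (p + 1 / 2) + (p + 1 / 2) + -1 by ring]
            exact lat_add (lat_add hp2 hp2) (lat_neg (lat_one τ))))
        exact this.congr (Eventually.of_forall fun z => mul_comm _ _)
      · exact ExtAt.of_an (hφan p (by simp [hS] at *; exact ⟨hp1, hp2⟩))
  obtain ⟨α, β, hab, hA, hB⟩ := entire_affine hτ (half_countable hSsub)
    (fun z hz => by rwa [hSsh 1 (lat_one τ)]) (fun z hz => by rwa [hSsh τ (lat_tau τ)]) hφan hφext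
    (A := 0) (B := 0) (fun z hz => by rw [hφper 1 (lat_one τ) z hz, add_zero])
    (fun z hz => by rw [hφper τ (lat_tau τ) z hz, add_zero])
  have hβ : β = 0 := by
    have hn : τ / 2 ∉ S := by
      rintro (h | h)
      · exact n2 h
      · exact n3 h
    have := hab _ hn
    simp only [φ] at this
    rw [zero _ n2 (by rw [show 2 * (τ / 2) = τ by ring]; exact lat_tau τ), ← hA] at this
    simpa using this.symm
  -- near zero
  obtain ⟨g, hg, e⟩ := hpole 0 (lat_zero τ)
  have hnz : ∀ᶠ z in 𝓝[≠] (0 : ℂ), h z ≠ 0 := by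
    have hc : ContinuousAt (fun z => 1 + z * g z) 0 :=
      continuousAt_const.add (continuousAt_id.mul hg.continuousAt)
    have h3 : ∀ᶠ z in 𝓝[≠] (0 : ℂ), 1 + z * g z ≠ 0 :=
      nhdsWithin_le_nhds (hc.eventually_ne (by simp))
    filter_upwards [e, h3, self_mem_nhdsWithin] with z a b c hz
    have c' : z ≠ 0 := c
    rw [a, sub_zero] at hz
    apply b
    field_simp at hz
    rw [hz, mul_zero]
  have hz0 : ∀ᶠ z in 𝓝[≠] (0 : ℂ), h (z + 1 / 2) = 0 := by
    filter_upwards [hnz, isolated hτ hSsub 0] with z a b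
    have := hab z b
    rw [← hA, hβ] at this
    simp only [φ] at this
    rcases mul_eq_zero.1 (this.trans (by ring)) with h | h
    · exact absurd h a
    · exact h
  have hz1 : ∀ᶠ z in 𝓝[≠] (1 / 2 : ℂ), h z = 0 := by
    have := punct_shift (p := (1 / 2 : ℂ)) (c := -(1 / 2)) (P := fun z => h (z + 1 / 2) = 0)
      (by simpa using hz0)
    simpa using this
  have hpc : IsPreconnected (lat τ)ᶜ :=
    ((lat_countable τ).isConnected_compl_of_one_lt_rank
      (Module.one_lt_rank_of_one_lt_finrank (by simp) : 1 < Module.rank ℝ ℂ)).isPreconnected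
  have hall := AnalyticOnNhd.eqOn_zero_of_preconnected_of_frequently_eq_zero (f := h) (U := (lat τ)ᶜ)
    (fun z hz => han z hz) hpc n1 hz1.frequently
  have : ∀ᶠ z in 𝓝[≠] (0 : ℂ), False := by
    filter_upwards [hnz, isolated hτ ((lat_sub τ).trans (fullSing_sub τ)) 0] with z a b
    exact a (hall b)
  simpa using this.exists

lemma punct_punct {P : ℂ → Prop} {p : ℂ} (h : ∀ᶠ z in 𝓝[≠] p, P z) :
    ∀ᶠ z in 𝓝[≠] p, ∀ᶠ x in 𝓝 z, P x := by
  have := eventually_eventually_nhdsWithin.2 h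
  filter_upwards [this, self_mem_nhdsWithin] with z hz hne
  rwa [isOpen_compl_singleton.nhdsWithin_eq hne] at hz

lemma y2_form {y g : ℂ → ℂ} {p : ℂ} {k : ℤ} (hg : AnalyticAt ℂ g p) (h0 : g p ≠ 0)
    (hy : ∀ᶠ z in 𝓝[≠] p, y z = (z - p) ^ k * g z) :
    ∀ᶠ z in 𝓝[≠] p, y z ≠ 0 ∧ deriv (deriv y) z =
      ((k * (k - 1) : ℂ) / (z - p) ^ 2 + 2 * k / (z - p) * (deriv g z / g z) +
        deriv (deriv g) z / g z) * y z := by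
  have hga : ∀ᶠ z in 𝓝[≠] p, AnalyticAt ℂ g z := nhdsWithin_le_nhds hg.eventually_analyticAt
  have hgn : ∀ᶠ z in 𝓝[≠] p, g z ≠ 0 := nhdsWithin_le_nhds (hg.continuousAt.eventually_ne h0)
  have hz1 : ∀ z, z - p ≠ 0 → ∀ n : ℤ, HasDerivAt (fun x => (x - p) ^ n) (n * (z - p) ^ (n - 1)) z := by
    intro z hz n
    have := (hasDerivAt_zpow n (z - p) (Or.inl hz)).comp_sub_const z p
    exact this
  have d1 : ∀ᶠ z in 𝓝[≠] p, deriv y z = k * (z - p) ^ (k - 1) * g z + (z - p) ^ k * deriv g z := by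
    filter_upwards [punct_punct hy, hga, self_mem_nhdsWithin] with z h1 h2 h3
    have hz : z - p ≠ 0 := sub_ne_zero.2 h3
    have e : y =ᶠ[𝓝 z] fun z => (z - p) ^ k * g z := h1
    rw [e.deriv_eq]
    exact ((hz1 z hz k).mul h2.differentiableAt.hasDerivAt).deriv
  filter_upwards [punct_punct d1, hga, self_mem_nhdsWithin, hgn, hy] with z h1 h2 h3 h4 h5
  have hz : z - p ≠ 0 := sub_ne_zero.2 h3
  have e : deriv y =ᶠ[𝓝 z] fun z => k * (z - p) ^ (k - 1) * g z + (z - p) ^ k * deriv g z := h1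
  have hd := ((((hz1 z hz (k - 1)).const_mul (k : ℂ)).mul h2.differentiableAt.hasDerivAt).add
    ((hz1 z hz k).mul h2.deriv.differentiableAt.hasDerivAt)).deriv
  refine ⟨by rw [h5]; exact mul_ne_zero (zpow_ne_zero _ hz) h4, ?_⟩
  rw [e.deriv_eq]
  refine hd.trans ?_
  rw [h5]
  have z1 : (z - p) ^ (k - 1) = (z - p) ^ k / (z - p) := by rw [zpow_sub_one₀ hz]; rfl
  have z2 : (z - p) ^ (k - 1 - 1) = (z - p) ^ k / (z - p) ^ 2 := by
    rw [zpow_sub_one₀ hz, zpow_sub_one₀ hz]; field_simp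
  rw [z1, z2]
  push_cast
  field_simp
  ring

lemma q_pole {Q y g : ℂ → ℂ} {p : ℂ} {k : ℤ} (hg : AnalyticAt ℂ g p) (h0 : g p ≠ 0)
    (hy : ∀ᶠ z in 𝓝[≠] p, y z = (z - p) ^ k * g z)
    (hQ : ∀ᶠ z in 𝓝[≠] p, deriv (deriv y) z = Q z * y z) :
    ∃ T, ExtAt (fun z => Q z - ((k * (k - 1) : ℂ) / (z - p) ^ 2 + T / (z - p))) p := by
  set G : ℂ → ℂ := fun z => deriv g z / g z with hG
  have hGa : AnalyticAt ℂ G p := hg.deriv.div hg h0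
  refine ⟨2 * k * G p, fun z => 2 * k * dslope G p z + deriv (deriv g) z / g z, ?_, ?_⟩
  · refine (analyticAt_const.mul ?_).add (hg.deriv.deriv.div hg h0)
    obtain ⟨P, hP⟩ := hGa
    exact (hP.has_fpower_series_dslope_fslope).analyticAt
  · filter_upwards [y2_form hg h0 hy, hQ, self_mem_nhdsWithin] with z h1 h2 h3
    have hz : z - p ≠ 0 := sub_ne_zero.2 h3
    have e := h2.symm.trans h1.2
    have e2 := mul_right_cancel₀ h1.1 e
    have h4 := sub_smul_dslope G p z
    rw [smul_eq_mul] at h4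
    have h5 : deriv g z / g z = G p + (z - p) * dslope G p z := by rw [h4]; simp [hG]
    rw [e2, h5]
    field_simp
    ring

lemma per_distinct {τ : ℂ} (hτ : 0 < τ.im) {k j : Fin 4} (h : per τ k / 2 - per τ j / 2 ∈ lat τ) :
    k = j := by
  have key : ∀ a b : ℤ, per τ k / 2 - per τ j / 2 = ((a : ℂ) + b * τ) / 2 → 2 ∣ a ∧ 2 ∣ b := by
    intro a b e
    exact half_lat hτ (by rwa [← e])
  fin_cases k <;> fin_cases j <;> try rfl
  · have := (key (-1) 0 (by simp [per]; ring)).1; omega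
  · have := (key 0 (-1) (by simp [per]; ring)).2; omega
  · have := (key (-1) (-1) (by simp [per]; ring)).1; omega
  · have := (key (1) 0 (by simp [per])).1; omega
  · have := (key 1 (-1) (by simp [per]; ring)).2; omega
  · have := (key 0 (-1) (by simp [per]; ring)).2; omega
  · have := (key (0) 1 (by simp [per])).2; omega
  · have := (key (-1) 1 (by simp [per]; ring)).2; omega
  · have := (key (-1) 0 (by simp [per]; ring)).1; omega
  · have := (key (1) 1 (by simp [per])).2; omega
  · have := (key 0 1 (by simp [per]; ring)).2; omega
  · have := (key 1 0 (by simp [per]; ring)).1; omega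

lemma not_full {τ z : ℂ} (hz : z ∉ fullSing τ) (k : Fin 4) : z - per τ k / 2 ∉ lat τ :=
  fun h => hz ⟨k, _, h, by ring⟩

lemma not_sing_of_zero {τ : ℂ} (hτ : 0 < τ.im) {m : Fin 4 → ℕ} {k : Fin 4} (hk : m k = 0) {l : ℂ}
    (hl : l ∈ lat τ) : per τ k / 2 + l ∉ singSet τ m := by
  rintro ⟨j, hj, l', hl', h⟩
  have : k = j := per_distinct hτ (by
    have : per τ k / 2 - per τ j / 2 = l' + -l := by linear_combination h
    rw [this]; exact lat_add hl' (lat_neg hl))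
  subst this
  omega

/-- structure theorem for periodic potentials with prescribed principal parts -/
lemma q_struct {τ : ℂ} (hτ : 0 < τ.im) {m : Fin 4 → ℕ} {Q : ℂ → ℂ}
    (hQ : ∀ z ∉ fullSing τ, AnalyticAt ℂ Q z)
    (h1 : ∀ z ∉ fullSing τ, Q (z + 1) = Q z) (h2 : ∀ z ∉ fullSing τ, Q (z + τ) = Q z)
    (hp : ∀ k : Fin 4, ∃ T, ExtAt (fun z => Q z - ((m k : ℂ) * (m k + 1) / (z - per τ k / 2) ^ 2 +
      T / (z - per τ k / 2))) (per τ k / 2)) :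
    ∃ T₁ T₂ T₃ E, ∀ z ∉ fullSing τ, Q z = q8 τ m T₁ T₂ T₃ E z := by
  choose T hT using hp
  have hper := per_all (F := Q) (S := fullSing τ) (fun t ht z => fullSing_shift ht z) h1 h2
  obtain ⟨η₁, hη₁⟩ := wzeta_qp hτ (lat_one τ)
  obtain ⟨η₂, hη₂⟩ := wzeta_qp hτ (lat_tau τ)
  have hnd := nondeg hτ hη₁ hη₂
  set tm : Fin 4 → ℂ → ℂ := fun k z => (m k : ℂ) * (m k + 1) * wp τ (z - per τ k / 2) +
    T k * wzeta τ (z - per τ k / 2) with htm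
  have tman : ∀ (k : Fin 4) z, z - per τ k / 2 ∉ lat τ → AnalyticAt ℂ (tm k) z := by
    intro k z hz
    have a1 : AnalyticAt ℂ (fun z => wp τ (z - per τ k / 2)) z := by
      simpa [sub_eq_add_neg] using an_shift (g := wp τ) (c := -(per τ k / 2)) (p := z)
        (by rw [← sub_eq_add_neg]; exact wp_an hτ hz)
    have a2 : AnalyticAt ℂ (fun z => wzeta τ (z - per τ k / 2)) z := by
      simpa [sub_eq_add_neg] using an_shift (g := wzeta τ) (c := -(per τ k / 2)) (p := z)
        (by rw [← sub_eq_add_neg]; exact (wzeta_an hτ hz).1)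
    exact (analyticAt_const.mul a1).add (analyticAt_const.mul a2)
  set G : ℂ → ℂ := fun z => Q z - ∑ k, tm k z with hG
  have hGan : ∀ z ∉ fullSing τ, AnalyticAt ℂ G z := by
    intro z hz
    refine (hQ z hz).sub ?_
    simp only [Fin.sum_univ_four]
    exact (((tman 0 z (not_full hz 0)).add (tman 1 z (not_full hz 1))).add
      (tman 2 z (not_full hz 2))).add (tman 3 z (not_full hz 3))
  have hGext : ∀ p, ExtAt G p := by
    intro p
    by_cases hp : p ∉ fullSing τ
    · exact ExtAt.of_an (hGan p hp)
    push Not at hp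
    obtain ⟨k, l, hl, rfl⟩ := hp
    set p := per τ k / 2 + l with hpdef
    -- principal part of Q at p
    have hQp : ExtAt (fun z => Q z - ((m k : ℂ) * (m k + 1) / (z - p) ^ 2 + T k / (z - p))) p := by
      have := ExtAt.shift (p := p) (c := -l) (by rw [hpdef, add_neg_cancel_right]; exact hT k)
      refine this.congr ?_
      filter_upwards [isolated hτ (fullSing_sub τ) p] with z hz
      rw [hper _ (lat_neg hl) z hz]
      have : z + -l - per τ k / 2 = z - p := by rw [hpdef]; ring
      rw [this]
    have hD : ∀ j, ExtAt (fun z => (if j = k then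
        ((m k : ℂ) * (m k + 1) / (z - p) ^ 2 + T k / (z - p)) else 0) + -1 * tm j z) p := by
      intro j
      by_cases hj : j = k
      · subst hj
        obtain ⟨g1, hg1, e1⟩ := wp_pole hτ hl
        obtain ⟨g2, hg2, e2⟩ := wzeta_pole hτ hl
        have hpl : p + -(per τ j / 2) = l := by rw [hpdef]; ring
        rw [← hpl] at hg1 e1 hg2 e2
        refine ⟨fun z => -((m j : ℂ) * (m j + 1) * g1 (z + -(per τ j / 2)) +
          T j * g2 (z + -(per τ j / 2))),
          ((analyticAt_const.mul (an_shift hg1)).add (analyticAt_const.mul (an_shift hg2))).neg, ?_⟩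
        filter_upwards [punct_shift e1, punct_shift e2] with z h3 h4
        simp only [htm, if_true, sub_eq_add_neg z (per τ j / 2)]
        rw [h3, h4]
        have : z + -(per τ j / 2) - (p + -(per τ j / 2)) = z - p := by ring
        rw [this]; ring
      · simp only [hj, if_false, zero_add]
        refine (ExtAt.of_an (tman j p ?_)).cmul (-1)
        intro hl2
        apply hj
        refine (per_distinct hτ ?_).symm
        have : per τ k / 2 - per τ j / 2 = (p - per τ j / 2) + -l := by rw [hpdef]; ring
        rw [this]; exact lat_add hl2 (lat_neg hl)
    have := hQp.add (((hD 0).add (hD 1)).add ((hD 2).add (hD 3)))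
    refine this.congr (Eventually.of_forall fun z => ?_)
    have hs : ∑ j, ((if j = k then
        ((m k : ℂ) * (m k + 1) / (z - p) ^ 2 + T k / (z - p)) else 0) + -1 * tm j z) =
        ((m k : ℂ) * (m k + 1) / (z - p) ^ 2 + T k / (z - p)) - ∑ j, tm j z := by
      rw [Finset.sum_add_distrib, Finset.sum_ite_eq' Finset.univ k, ← Finset.mul_sum]
      simp; ring
    rw [Fin.sum_univ_four] at hs
    simp only [hG]
    linear_combination -hs
  have hinc : ∀ t η, t ∈ lat τ → (∀ z ∉ lat τ, wzeta τ (z + t) = wzeta τ z + η) → ∀ z ∉ fullSing τ,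
      G (z + t) = G z + -((T 0 + T 1 + T 2 + T 3) * η) := by
    intro t η ht hη z hz
    have : ∀ k, tm k (z + t) = tm k z + T k * η := by
      intro k
      have e : z + t - per τ k / 2 = (z - per τ k / 2) + t := by ring
      simp only [htm]
      rw [e, wp_periodic hτ ht, hη _ (not_full hz k)]; ring
    simp only [hG, this, hper t ht z hz, Fin.sum_univ_four]
    ring
  obtain ⟨α, β, hab, hA, hB⟩ := entire_affine hτ (half_countable (fullSing_sub τ))
    (fun z hz => by rwa [fullSing_shift (lat_one τ)]) (fun z hz => by rwa [fullSing_shift (lat_tau τ)])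
    hGan hGext (hinc 1 η₁ (lat_one τ) hη₁) (hinc τ η₂ (lat_tau τ) hη₂)
  have hsum : T 0 + T 1 + T 2 + T 3 = 0 := by
    have : (T 0 + T 1 + T 2 + T 3) * (η₂ - τ * η₁) = 0 := by
      rw [← hA] at hB
      linear_combination -hB
    rcases mul_eq_zero.1 this with h | h
    · exact h
    · exact absurd (sub_eq_zero.1 h) hnd
  have hα : α = 0 := by rw [← hA, hsum]; ring
  refine ⟨T 1, T 2, T 3, -β, fun z hz => ?_⟩
  have := hab z hz
  simp only [hG, htm, Fin.sum_univ_four, hα] at this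
  simp only [q8, Fin.sum_univ_four]
  have e0 : z - per τ ((0 : Fin 4) : ℕ) / 2 = z := by simp [per]
  rw [e0] at this ⊢
  have hT0 : T 0 = -(T 1 + T 2 + T 3) := by linear_combination hsum
  rw [hT0] at this
  have v1 : ((1 : Fin 4) : ℕ) = 1 := rfl
  have v2 : ((2 : Fin 4) : ℕ) = 2 := rfl
  have v3 : ((3 : Fin 4) : ℕ) = 3 := rfl
  rw [v1, v2, v3] at this ⊢
  linear_combination this

lemma PairAt.indep {w : ℂ → ℝ} {Y Z : ℂ → ℂ} {z : ℂ} (h : PairAt w Y Z z) {a b : ℂ}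
    (h0 : ∀ᶠ x in 𝓝 z, a * Y x + b * Z x = 0) : a = 0 ∧ b = 0 := by
  have e : (fun x => a * Y x + b * Z x) =ᶠ[𝓝 z] fun _ => 0 := h0
  have h1 := e.deriv_eq
  have h2 : deriv (fun x => a * Y x + b * Z x) z = a * deriv Y z + b * deriv Z z :=
    ((h.1.differentiableAt.hasDerivAt.const_mul a).add
      (h.2.1.differentiableAt.hasDerivAt.const_mul b)).deriv
  rw [h2, deriv_const] at h1
  have h3 := e.eq_of_nhds
  have h4 := h.2.2.self_of_nhds.1
  constructor
  · linear_combination -a * h4 + deriv Z z * h3 - Z z * h1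
  · linear_combination -b * h4 + Y z * h1 - deriv Y z * h3

theorem forward {τ : ℂ} (hτ : 0 < τ.im) {m : Fin 4 → ℕ} {u : ℂ → ℝ}
    (hu : IsCurvatureSolution τ m u) : ∃ T₁ T₂ T₃ E : ℂ,
        (∀ k : Fin 4, 1 ≤ m k → ∀ l ∈ lat τ,
          ApparentAt (q8 τ m T₁ T₂ T₃ E) (per τ (k : ℕ) / 2 + l)) ∧
        HasUnitaryMonodromy (q8 τ m T₁ T₂ T₃ E) (fullSing τ) τ := by
  classical
  obtain ⟨Y, Z, μ, ν, hmer, hpair, hzero, hμ, hν, hs1, hs2⟩ := global_pair hτ hu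
  set Q : ℂ → ℂ := fun z => wirt (wirt (cw (wof u))) z / (wof u z : ℂ) with hQdef
  have hode : ∀ z ∉ singSet τ m, deriv (deriv Y) z = Q z * Y z ∧ deriv (deriv Z) z = Q z * Z z := by
    intro z hz
    have h := (hpair z hz).ode
    have hw : (wof u z : ℂ) ≠ 0 := by exact_mod_cast (hpair z hz).pos.ne'
    simp only [hQdef]
    constructor
    · rw [div_mul_eq_mul_div, eq_div_iff hw]; exact h.1
    · rw [div_mul_eq_mul_div, eq_div_iff hw]; exact h.2
  have hne : ∀ z ∉ singSet τ m, Y z ≠ 0 ∨ Z z ≠ 0 := by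
    intro z hz
    by_contra hcon
    push Not at hcon
    have h1 := (hpair z hz).2.2.self_of_nhds.1
    rw [hcon.1, hcon.2] at h1
    simp at h1
  have hscl : IsClosed (singSet τ m) := half_closed hτ ((singSet_sub τ m).trans (fullSing_sub τ))
  have hfcl : IsClosed (fullSing τ) := half_closed hτ (fullSing_sub τ)
  have hQan : ∀ z ∉ singSet τ m, AnalyticAt ℂ Q z := by
    intro z hz
    have hev : ∀ᶠ x in 𝓝 z, x ∉ singSet τ m := hscl.isOpen_compl.mem_nhds hz
    rcases hne z hz with h | h
    · have ha := (hpair z hz).1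
      refine (ha.deriv.deriv.div ha h).congr ?_
      filter_upwards [hev, ha.continuousAt.eventually_ne h] with x h1 h2
      simp only [Pi.div_apply]
      rw [(hode x h1).1]; field_simp
    · have ha := (hpair z hz).2.1
      refine (ha.deriv.deriv.div ha h).congr ?_
      filter_upwards [hev, ha.continuousAt.eventually_ne h] with x h1 h2
      simp only [Pi.div_apply]
      rw [(hode x h1).2]; field_simp
  have hQper : ∀ t ∈ lat τ, ∀ c : ℂ, c * conj c = 1 →
      (∀ z, Y (z + t) = c * Y z ∧ Z (z + t) = conj c * Z z) →
      ∀ z ∉ singSet τ m, Q (z + t) = Q z := by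
    intro t ht c hc hsh z hz
    have hz' : z + t ∉ singSet τ m := by rwa [singSet_shift ht]
    have d2 : ∀ (y : ℂ → ℂ) (a : ℂ), (∀ z, y (z + t) = a * y z) →
        deriv (deriv y) (z + t) = a * deriv (deriv y) z := by
      intro y a hy
      have e1 : ∀ z, deriv y (z + t) = a * deriv y z := by
        intro z
        rw [← deriv_comp_add_const, show (fun x => y (x + t)) = fun x => a * y x from funext hy]
        exact deriv_const_mul_field a
      rw [← deriv_comp_add_const, show (fun x => deriv y (x + t)) = fun x => a * deriv y x from funext e1]
      exact deriv_const_mul_field a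
    have hc0 : c ≠ 0 := left_ne_zero_of_mul_eq_one hc
    have hc1 : conj c ≠ 0 := right_ne_zero_of_mul_eq_one hc
    rcases hne z hz with h | h
    · have e := d2 Y c (fun z => (hsh z).1)
      rw [(hode _ hz').1, (hode _ hz).1, (hsh z).1] at e
      exact mul_right_cancel₀ (mul_ne_zero hc0 h) (by rw [e]; ring)
    · have e := d2 Z (conj c) (fun z => (hsh z).2)
      rw [(hode _ hz').2, (hode _ hz).2, (hsh z).2] at e
      exact mul_right_cancel₀ (mul_ne_zero hc1 h) (by rw [e]; ring)
  have hsub : ∀ z, z ∉ fullSing τ → z ∉ singSet τ m := fun z hz h => hz (singSet_sub τ m h)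
  obtain ⟨T₁, T₂, T₃, E, hq⟩ := q_struct hτ (m := m) (Q := Q) (fun z hz => hQan z (hsub z hz))
    (fun z hz => hQper 1 (lat_one τ) μ hμ hs1 z (hsub z hz))
    (fun z hz => hQper τ (lat_tau τ) ν hν hs2 z (hsub z hz)) (by
    intro k
    rcases Nat.eq_zero_or_pos (m k) with hk | hk
    · refine ⟨0, (ExtAt.of_an (hQan (per τ k / 2) ?_)).congr (Eventually.of_forall fun z => ?_)⟩
      · simpa using not_sing_of_zero hτ hk (lat_zero τ)
      · simp [hk]
    · set p := per τ k / 2 with hp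
      obtain ⟨c₁, c₂, ε, hc₁, hε, hb⟩ := wof_bounds hu (p := p) hk (lat_zero τ) (by rw [add_zero])
      have hns : ∀ᶠ z in 𝓝[≠] p, z ∉ singSet τ m :=
        isolated hτ ((singSet_sub τ m).trans (fullSing_sub τ)) p
      have hex := expo (hmer p).1 (hmer p).2 0 0 (-2 * (m k : ℝ)) c₁ c₂ hc₁ (by
        filter_upwards [hns, nhdsWithin_le_nhds (ball_mem_nhds p hε), self_mem_nhdsWithin] with z h1 h2 h3
        have := hb z h2 h3
        rw [← (hpair z h1).norm_eq] at this
        simpa using this)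
      have fin : ∀ (y : ℂ → ℂ), (∀ z ∉ singSet τ m, deriv (deriv y) z = Q z * y z) →
          (∃ (k' : ℤ) (g : ℂ → ℂ), AnalyticAt ℂ g p ∧ g p ≠ 0 ∧
            (∀ᶠ z in 𝓝[≠] p, y z = (z - p) ^ k' * g z) ∧ -2 * (m k : ℝ) = 0 + 2 * k') →
          ∃ T, ExtAt (fun z => Q z - ((m k : ℂ) * (m k + 1) / (z - p) ^ 2 + T / (z - p))) p := by
        rintro y hy ⟨k', g, hg, hg0, hyg, hk'⟩
        obtain ⟨T, hT⟩ := q_pole (Q := Q) hg hg0 hyg (by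
          filter_upwards [hns] with z hz using hy z hz)
        refine ⟨T, ?_⟩
        have hkm : k' = -(m k : ℤ) := by
          have : (k' : ℝ) = -(m k : ℝ) := by linarith
          exact_mod_cast this
        subst hkm
        refine hT.congr (Eventually.of_forall fun z => ?_)
        push_cast
        ring
      rcases hex with h | h
      · exact fin Y (fun z hz => (hode z hz).1) h
      · exact fin Z (fun z hz => (hode z hz).2) h)
  refine ⟨T₁, T₂, T₃, E, ?_, ?_⟩
  · intro k hk l hl
    set p := per τ k / 2 + l
    obtain ⟨ε, hε, hb⟩ := Metric.eventually_nhds_iff_ball.1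
      (eventually_nhdsWithin_iff.1 (isolated hτ (fullSing_sub τ) p))
    refine ⟨Y, Z, ε, hε, fun z hz hne => ?_, (hmer p).1, (hmer p).2, ?_⟩
    · have hz' := hb z hz hne
      rw [← hq z hz']
      exact ⟨(hpair z (hsub z hz')).1, (hpair z (hsub z hz')).2.1, hode z (hsub z hz')⟩
    · intro a b hab
      set z₀ : ℂ := p + (ε / 2 : ℝ)
      have hz0 : z₀ ∈ ball p ε ∧ z₀ ≠ p := by
        constructor
        · simp only [z₀, mem_ball, dist_eq_norm, add_sub_cancel_left, Complex.norm_real, Real.norm_eq_abs]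
          rw [abs_of_pos (by positivity)]; linarith
        · simp only [z₀, ne_eq, add_eq_left]
          exact_mod_cast (by positivity : ε / 2 ≠ 0)
      refine (hpair z₀ (hsub _ (hb z₀ hz0.1 hz0.2))).indep ?_
      filter_upwards [isOpen_ball.mem_nhds hz0.1, isOpen_compl_singleton.mem_nhds hz0.2] with x h1 h2
      exact hab x h1 h2
  · have hmod : ∀ y : ℂ → ℂ, (∀ z, MeromorphicAt y z) → (∀ z ∉ singSet τ m, AnalyticAt ℂ y z) →
        (∀ z ∉ singSet τ m, deriv (deriv y) z = Q z * y z) →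
        SolvesODEOn (q8 τ m T₁ T₂ T₃ E) (fullSing τ) (fun z => if z ∈ fullSing τ then 0 else y z) := by
      intro y hy1 hy2 hy3
      refine ⟨fun z => ?_, fun z hz => ?_⟩
      · refine (hy1 z).congr ?_
        filter_upwards [isolated hτ (fullSing_sub τ) z] with x hx
        simp [hx]
      · have e : (fun z => if z ∈ fullSing τ then 0 else y z) =ᶠ[𝓝 z] y := by
          filter_upwards [hfcl.isOpen_compl.mem_nhds hz] with x hx
          exact if_neg hx
        refine ⟨(hy2 z (hsub z hz)).congr e.symm, ?_⟩
        rw [e.deriv.deriv_eq, hy3 z (hsub z hz), hq z hz]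
        simp [hz]
    refine ⟨fun z => if z ∈ fullSing τ then 0 else Y z, fun z => if z ∈ fullSing τ then 0 else Z z,
      hmod Y (fun z => (hmer z).1) (fun z hz => (hpair z hz).1) (fun z hz => (hode z hz).1),
      hmod Z (fun z => (hmer z).2) (fun z hz => (hpair z hz).2.1) (fun z hz => (hode z hz).2), ?_,
      !![μ, 0; 0, conj μ], !![ν, 0; 0, conj ν], ?_, ?_, ?_, ?_, ?_, ?_, ?_, ?_⟩
    · intro a b hab
      obtain ⟨z₀, hz₀⟩ := exists_not_sing (half_countable (fullSing_sub τ))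
      refine (hpair z₀ (hsub z₀ hz₀)).indep ?_
      filter_upwards [hfcl.isOpen_compl.mem_nhds hz₀] with x hx
      have hx' : x ∉ fullSing τ := hx
      simpa [hx'] using hab x hx
    · rw [Matrix.mem_unitaryGroup_iff]
      ext i j
      fin_cases i <;> fin_cases j <;> simp [Matrix.mul_apply, Fin.sum_univ_two, hμ, mul_comm] <;>
        first | exact hμ | (rw [mul_comm]; exact hμ)
    · simp [Matrix.det_fin_two, hμ]
    · rw [Matrix.mem_unitaryGroup_iff]
      ext i j
      fin_cases i <;> fin_cases j <;> simp [Matrix.mul_apply, Fin.sum_univ_two, hν, mul_comm] <;>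
        first | exact hν | (rw [mul_comm]; exact hν)
    · simp [Matrix.det_fin_two, hν]
    · intro z
      by_cases hz : z ∈ fullSing τ
      · simp [hz, (fullSing_shift (lat_one τ) z)]
      · simp [hz, (fullSing_shift (lat_one τ) z), (hs1 z).1]
    · intro z
      by_cases hz : z ∈ fullSing τ
      · simp [hz, (fullSing_shift (lat_one τ) z)]
      · simp [hz, (fullSing_shift (lat_one τ) z), (hs1 z).2]
    · intro z
      by_cases hz : z ∈ fullSing τ
      · simp [hz, (fullSing_shift (lat_tau τ) z)]
      · simp [hz, (fullSing_shift (lat_tau τ) z), (hs2 z).1]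
    · intro z
      by_cases hz : z ∈ fullSing τ
      · simp [hz, (fullSing_shift (lat_tau τ) z)]
      · simp [hz, (fullSing_shift (lat_tau τ) z), (hs2 z).2]

lemma sub_tendsto (p : ℂ) : Tendsto (fun z : ℂ => z - p) (𝓝[≠] p) (𝓝 0) := by
  have : Tendsto (fun z : ℂ => z - p) (𝓝 p) (𝓝 (p - p)) := Continuous.tendsto (by fun_prop) p
  rw [sub_self] at this
  exact this.mono_left nhdsWithin_le_nhds

lemma an_tendsto {g : ℂ → ℂ} {p : ℂ} (h : AnalyticAt ℂ g p) : Tendsto g (𝓝[≠] p) (𝓝 (g p)) :=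
  h.continuousAt.tendsto.mono_left nhdsWithin_le_nhds

lemma wz_lim {τ : ℂ} (hτ : 0 < τ.im) (p c : ℂ) :
    Tendsto (fun z => (z - p) ^ 2 * wzeta τ (z - c)) (𝓝[≠] p) (𝓝 0) := by
  by_cases h : p - c ∈ lat τ
  · obtain ⟨g, hg, e⟩ := wzeta_pole hτ h
    rw [sub_eq_add_neg] at hg e
    have t := ((sub_tendsto p).add (((sub_tendsto p).pow 2).mul (an_tendsto (an_shift hg))))
    simp only [zero_add, ne_eq, OfNat.ofNat_ne_zero, not_false_eq_true, zero_pow, zero_mul] at t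
    refine t.congr' ?_
    filter_upwards [punct_shift e, self_mem_nhdsWithin] with z h1 h2
    have : z - p ≠ 0 := sub_ne_zero.2 h2
    rw [sub_eq_add_neg z c, h1]
    have e2 : z + -c - (p + -c) = z - p := by ring
    rw [e2]; field_simp
  · have ha := (wzeta_an hτ h).1
    rw [sub_eq_add_neg] at ha
    have t := ((sub_tendsto p).pow 2).mul (an_tendsto (an_shift ha))
    simpa [sub_eq_add_neg] using t

lemma wp_lim {τ : ℂ} (hτ : 0 < τ.im) (p c : ℂ) [Decidable (p - c ∈ lat τ)] :
    Tendsto (fun z => (z - p) ^ 2 * wp τ (z - c)) (𝓝[≠] p) (𝓝 (if p - c ∈ lat τ then 1 else 0)) := by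
  by_cases h : p - c ∈ lat τ
  · rw [if_pos h]
    obtain ⟨g, hg, e⟩ := wp_pole hτ h
    rw [sub_eq_add_neg] at hg e
    have t := ((((sub_tendsto p).pow 2).mul (an_tendsto (an_shift hg))).const_add 1)
    simp only [zero_add, ne_eq, OfNat.ofNat_ne_zero, not_false_eq_true, zero_pow, zero_mul, add_zero] at t
    refine t.congr' ?_
    filter_upwards [punct_shift e, self_mem_nhdsWithin] with z h1 h2
    have : z - p ≠ 0 := sub_ne_zero.2 h2
    rw [sub_eq_add_neg z c, h1]
    have e2 : z + -c - (p + -c) = z - p := by ring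
    rw [e2]; field_simp
  · rw [if_neg h]
    have ha := wp_an hτ h
    rw [sub_eq_add_neg] at ha
    have t := ((sub_tendsto p).pow 2).mul (an_tendsto (an_shift ha))
    simpa [sub_eq_add_neg] using t

lemma q8_lim {τ : ℂ} (hτ : 0 < τ.im) (m : Fin 4 → ℕ) (T₁ T₂ T₃ E : ℂ) (k : Fin 4) {l : ℂ}
    (hl : l ∈ lat τ) :
    Tendsto (fun z => (z - (per τ k / 2 + l)) ^ 2 * q8 τ m T₁ T₂ T₃ E z) (𝓝[≠] (per τ k / 2 + l))
      (𝓝 ((m k : ℂ) * (m k + 1))) := by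
  classical
  set p := per τ k / 2 + l with hp
  have hz := wz_lim hτ p
  have hz0 : Tendsto (fun z => (z - p) ^ 2 * wzeta τ z) (𝓝[≠] p) (𝓝 0) := by simpa using hz 0
  have hw : ∀ j : Fin 4, Tendsto (fun z => (m j : ℂ) * ((m j : ℂ) + 1) * ((z - p) ^ 2 * wp τ (z - per τ j / 2)))
      (𝓝[≠] p) (𝓝 (if j = k then (m k : ℂ) * (m k + 1) else 0)) := by
    intro j
    have := (wp_lim hτ p (per τ j / 2)).const_mul ((m j : ℂ) * ((m j : ℂ) + 1))
    convert this using 2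
    have : p - per τ j / 2 ∈ lat τ ↔ j = k := by
      constructor
      · intro h
        refine (per_distinct hτ ?_).symm
        have : per τ k / 2 - per τ j / 2 = (p - per τ j / 2) + -l := by rw [hp]; ring
        rw [this]; exact lat_add h (lat_neg hl)
      · rintro rfl
        rw [hp, add_sub_cancel_left]; exact hl
    simp only [this]
    by_cases hj : j = k
    · subst hj; simp
    · simp [hj]
  have hs := tendsto_finsetSum Finset.univ (fun j (_ : j ∈ Finset.univ) => hw j)
  rw [Finset.sum_ite_eq' Finset.univ k, if_pos (Finset.mem_univ k)] at hs
  have t1 := ((hz (per τ 1 / 2)).sub hz0).const_mul T₁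
  have t2 := ((hz (per τ 2 / 2)).sub hz0).const_mul T₂
  have t3 := ((hz (per τ 3 / 2)).sub hz0).const_mul T₃
  have tE := ((sub_tendsto p).pow 2).mul_const E
  have t := (((hs.add t1).add t2).add t3).sub tE
  simp only [sub_self, mul_zero, add_zero, ne_eq, OfNat.ofNat_ne_zero, not_false_eq_true, zero_pow,
    zero_mul, sub_zero] at t
  refine t.congr fun z => ?_
  simp only [q8, Fin.sum_univ_four]
  ring

lemma one_form {y q : ℂ → ℂ} {p : ℂ} {m : ℕ} (hy : MeromorphicAt y p)
    (hn : ¬ ∀ᶠ z in 𝓝[≠] p, y z = 0)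
    (hq : Tendsto (fun z => (z - p) ^ 2 * q z) (𝓝[≠] p) (𝓝 ((m : ℂ) * (m + 1))))
    (ho : ∀ᶠ z in 𝓝[≠] p, deriv (deriv y) z = q z * y z) :
    ∃ h, AnalyticAt ℂ h p ∧ (∀ᶠ z in 𝓝[≠] p, y z = (z - p) ^ (-(m : ℤ)) * h z) ∧
      (h p ≠ 0 ∨ ∃ h', AnalyticAt ℂ h' p ∧ ∀ᶠ z in 𝓝[≠] p, y z = (z - p) * h' z) := by
  have ht : meromorphicOrderAt y p ≠ ⊤ := by
    rw [ne_eq, meromorphicOrderAt_eq_top_iff]; exact hn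
  obtain ⟨g, hg, hg0, e⟩ := (meromorphicOrderAt_ne_top_iff hy).1 ht
  set k := (meromorphicOrderAt y p).untop₀
  simp only [smul_eq_mul] at e
  have hind : (k * (k - 1) : ℂ) = (m : ℂ) * (m + 1) := by
    refine tendsto_nhds_unique ?_ hq
    have hG : AnalyticAt ℂ (fun z => deriv g z / g z) p := hg.deriv.div hg hg0
    have hG2 : AnalyticAt ℂ (fun z => deriv (deriv g) z / g z) p := hg.deriv.deriv.div hg hg0
    have t := (((((sub_tendsto p).const_mul (2 * k : ℂ)).mul (an_tendsto hG)).add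
      (((sub_tendsto p).pow 2).mul (an_tendsto hG2))).const_add (k * (k - 1) : ℂ))
    simp only [mul_zero, zero_mul, add_zero, ne_eq, OfNat.ofNat_ne_zero, not_false_eq_true, zero_pow] at t
    refine t.congr' ?_
    filter_upwards [y2_form hg hg0 e, ho, self_mem_nhdsWithin] with z h1 h2 h3
    have hz : z - p ≠ 0 := sub_ne_zero.2 h3
    have := mul_right_cancel₀ h1.1 (h2.symm.trans h1.2)
    rw [this]
    field_simp
    ring
  have hk : k = -(m : ℤ) ∨ k = m + 1 := by
    have h1 : k * (k - 1) = (m : ℤ) * (m + 1) := by exact_mod_cast hind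
    have h2 : (k + m) * (k - (m + 1)) = 0 := by linear_combination h1
    rcases mul_eq_zero.1 h2 with h | h
    · left; linarith
    · right; linarith
  rcases hk with hk | hk
  · exact ⟨g, hg, by rw [← hk]; exact e, Or.inl hg0⟩
  · have hpa : ∀ n : ℕ, AnalyticAt ℂ (fun z : ℂ => (z - p) ^ n) p := fun n =>
      (analyticAt_id.sub analyticAt_const).pow n
    refine ⟨fun z => (z - p) ^ (2 * m + 1) * g z, (hpa _).mul hg, ?_, Or.inr
      ⟨fun z => (z - p) ^ m * g z, (hpa _).mul hg, ?_⟩⟩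
    · filter_upwards [e, self_mem_nhdsWithin] with z h1 h3
      have hz : z - p ≠ 0 := sub_ne_zero.2 h3
      rw [h1, hk, ← mul_assoc, ← zpow_natCast, ← zpow_add₀ hz]
      congr 2; push_cast; ring
    · filter_upwards [e, self_mem_nhdsWithin] with z h1 h3
      have hz : z - p ≠ 0 := sub_ne_zero.2 h3
      rw [h1, hk, ← mul_assoc, zpow_add_one₀ hz, zpow_natCast, mul_comm ((z - p) ^ m)]

lemma two_form {Y Z q : ℂ → ℂ} {p : ℂ} {m : ℕ} (hY : MeromorphicAt Y p) (hZ : MeromorphicAt Z p)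
    (hq : Tendsto (fun z => (z - p) ^ 2 * q z) (𝓝[≠] p) (𝓝 ((m : ℂ) * (m + 1))))
    (hoY : ∀ᶠ z in 𝓝[≠] p, deriv (deriv Y) z = q z * Y z)
    (hoZ : ∀ᶠ z in 𝓝[≠] p, deriv (deriv Z) z = q z * Z z)
    (hW : ∀ᶠ z in 𝓝[≠] p, Y z * deriv Z z - deriv Y z * Z z = 1) :
    ∃ h₁ h₂, AnalyticAt ℂ h₁ p ∧ AnalyticAt ℂ h₂ p ∧ (h₁ p ≠ 0 ∨ h₂ p ≠ 0) ∧
      (∀ᶠ z in 𝓝[≠] p, Y z = (z - p) ^ (-(m : ℤ)) * h₁ z) ∧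
      (∀ᶠ z in 𝓝[≠] p, Z z = (z - p) ^ (-(m : ℤ)) * h₂ z) := by
  have dz : ∀ y : ℂ → ℂ, (∀ᶠ z in 𝓝[≠] p, y z = 0) → ∀ᶠ z in 𝓝[≠] p, y z = 0 ∧ deriv y z = 0 := by
    intro y h
    filter_upwards [h, punct_punct h] with z h1 h2
    have e : y =ᶠ[𝓝 z] fun _ => 0 := h2
    exact ⟨h1, by rw [e.deriv_eq]; simp⟩
  have hnY : ¬ ∀ᶠ z in 𝓝[≠] p, Y z = 0 := by
    intro h
    obtain ⟨z, h1, h2, h3⟩ := (hW.and (dz Y h)).exists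
    simp [h2, h3] at h1
  have hnZ : ¬ ∀ᶠ z in 𝓝[≠] p, Z z = 0 := by
    intro h
    obtain ⟨z, h1, h2, h3⟩ := (hW.and (dz Z h)).exists
    simp [h2, h3] at h1
  obtain ⟨h₁, a1, e1, c1⟩ := one_form hY hnY hq hoY
  obtain ⟨h₂, a2, e2, c2⟩ := one_form hZ hnZ hq hoZ
  refine ⟨h₁, h₂, a1, a2, ?_, e1, e2⟩
  rcases c1 with c1 | ⟨A, hA, eA⟩
  · exact Or.inl c1
  rcases c2 with c2 | ⟨B, hB, eB⟩
  · exact Or.inr c2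
  exfalso
  have hid : AnalyticAt ℂ (fun z : ℂ => z - p) p := analyticAt_id.sub analyticAt_const
  have hA' : AnalyticAt ℂ (fun z => (z - p) * A z) p := hid.mul hA
  have hB' : AnalyticAt ℂ (fun z => (z - p) * B z) p := hid.mul hB
  have t := an_tendsto ((hA'.mul hB'.deriv).sub (hA'.deriv.mul hB'))
  have : Tendsto (fun _ : ℂ => (1 : ℂ)) (𝓝[≠] p) (𝓝 1) := tendsto_const_nhds
  have t2 := tendsto_nhds_unique (t.congr' ?_) this
  · simp at t2
  · filter_upwards [hW, eA, eB, punct_punct eA, punct_punct eB] with z w a b a' b'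
    have ea : Y =ᶠ[𝓝 z] fun z => (z - p) * A z := a'
    have eb : Z =ᶠ[𝓝 z] fun z => (z - p) * B z := b'
    rw [ea.deriv_eq, eb.deriv_eq, a, b] at w
    exact w

lemma wronsk {q y₁ y₂ : ℂ → ℂ} {S : Set ℂ} (hS : S.Countable) (hSc : IsClosed S)
    (h1 : SolvesODEOn q S y₁) (h2 : SolvesODEOn q S y₂) (hli : LinIndepOn S y₁ y₂) :
    ∃ W₀ : ℂ, W₀ ≠ 0 ∧ ∀ z ∉ S, y₁ z * deriv y₂ z - deriv y₁ z * y₂ z = W₀ := by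
  have hd : ∀ z ∉ S, HasDerivAt (fun z => y₁ z * deriv y₂ z - deriv y₁ z * y₂ z) 0 z := by
    intro z hz
    obtain ⟨a1, o1⟩ := h1.2 z hz
    obtain ⟨a2, o2⟩ := h2.2 z hz
    have := ((a1.differentiableAt.hasDerivAt.mul a2.deriv.differentiableAt.hasDerivAt).sub
      (a1.deriv.differentiableAt.hasDerivAt.mul a2.differentiableAt.hasDerivAt))
    rw [o1, o2] at this
    exact this.congr_deriv (by ring)
  obtain ⟨z₀, hz₀⟩ := exists_not_sing hS
  have hW : ∀ z ∉ S, y₁ z * deriv y₂ z - deriv y₁ z * y₂ z =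
      y₁ z₀ * deriv y₂ z₀ - deriv y₁ z₀ * y₂ z₀ := fun z hz =>
    const_off (U := univ) (S := S) isOpen_univ isPreconnected_univ hS hSc
      (fun z => y₁ z * deriv y₂ z - deriv y₁ z * y₂ z)
      (fun z _ h => (hd z h).differentiableAt) (fun z _ h => (hd z h).deriv) z trivial hz z₀ trivial hz₀
  refine ⟨_, fun h0 => ?_, hW⟩
  rw [h0] at hW
  obtain ⟨z₁, hz₁, hy⟩ : ∃ z₁, z₁ ∉ S ∧ y₁ z₁ ≠ 0 := by
    by_contra hcon
    push Not at hcon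
    have := (hli 1 0 (fun z hz => by rw [hcon z hz]; ring)).1
    exact one_ne_zero this
  set c := y₂ z₁ / y₁ z₁ with hc
  have ha : ∀ᶠ z in 𝓝 z₁, z ∉ S := hSc.isOpen_compl.mem_nhds hz₁
  have hev : ∀ᶠ z in 𝓝 z₁, z ∉ S ∧ y₁ z ≠ 0 :=
    ha.and ((h1.2 z₁ hz₁).1.continuousAt.eventually_ne hy)
  obtain ⟨r, hr, hb⟩ := Metric.eventually_nhds_iff_ball.1 hev
  have hdq : ∀ z ∈ ball z₁ r, HasDerivAt (fun z => y₂ z / y₁ z) 0 z := by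
    intro z hz
    obtain ⟨hzS, hzy⟩ := hb z hz
    have := (h2.2 z hzS).1.differentiableAt.hasDerivAt.div (h1.2 z hzS).1.differentiableAt.hasDerivAt hzy
    have e : deriv y₂ z * y₁ z - y₂ z * deriv y₁ z = 0 := by linear_combination hW z hzS
    rw [e, zero_div] at this
    exact this
  have hq : ∀ z ∈ ball z₁ r, y₂ z - c * y₁ z = 0 := by
    intro z hz
    have := const_off (U := ball z₁ r) (S := ∅) isOpen_ball (convex_ball z₁ r).isPreconnected
      countable_empty isClosed_empty (fun z => y₂ z / y₁ z) (fun z h _ => (hdq z h).differentiableAt)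
      (fun z h _ => (hdq z h).deriv) z hz (by simp) z₁ (mem_ball_self hr) (by simp)
    have hzy := (hb z hz).2
    rw [← hc, div_eq_iff hzy] at this
    rw [this]; ring
  have hpc : IsPreconnected Sᶜ :=
    (hS.isConnected_compl_of_one_lt_rank
      (Module.one_lt_rank_of_one_lt_finrank (by simp) : 1 < Module.rank ℝ ℂ)).isPreconnected
  have hall := AnalyticOnNhd.eqOn_zero_of_preconnected_of_eventuallyEq_zero (f := fun z => y₂ z - c * y₁ z)
    (U := Sᶜ) (fun z hz => (h2.2 z hz).1.sub (analyticAt_const.mul (h1.2 z hz).1)) hpc hz₁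
    (by filter_upwards [ball_mem_nhds z₁ hr] with z hz using hq z hz)
  have := (hli (-c) 1 (fun z hz => by have := hall hz; simp only [Pi.zero_apply] at this; linear_combination this)).2
  exact one_ne_zero this

lemma ext_fill (F : ℂ → ℂ) : ∃ G : ℂ → ℂ, (∀ p, ExtAt F p → AnalyticAt ℂ G p) ∧
    (∀ z, AnalyticAt ℂ F z → G z = F z) := by
  have lim : ∀ z g, AnalyticAt ℂ g z → (∀ᶠ x in 𝓝[≠] z, F x = g x) → limUnder (𝓝[≠] z) F = g z := by
    intro z g hg h
    refine Tendsto.limUnder_eq ((an_tendsto hg).congr' ?_)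
    filter_upwards [h] with x hx using hx.symm
  refine ⟨fun z => limUnder (𝓝[≠] z) F, ?_, ?_⟩
  · rintro p ⟨g, hg, e⟩
    refine hg.congr ?_
    have h1 : ∀ᶠ z in 𝓝[≠] p, g z = limUnder (𝓝[≠] z) F := by
      have e3 : ∀ᶠ z in 𝓝[≠] p, AnalyticAt ℂ g z :=
        nhdsWithin_le_nhds hg.eventually_analyticAt
      filter_upwards [punct_punct e, e3] with z h2 h3
      exact (lim z g h3 (nhdsWithin_le_nhds h2)).symm
    rw [eventually_nhdsWithin_iff] at h1
    filter_upwards [h1] with z hz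
    by_cases hp : z = p
    · rw [hp]; exact (lim p g hg e).symm
    · exact hz hp
  · intro z hz
    exact lim z F hz (Eventually.of_forall fun _ => rfl)

lemma unit_norm {M : Matrix (Fin 2) (Fin 2) ℂ} (hM : M ∈ Matrix.unitaryGroup (Fin 2) ℂ) (a b : ℂ) :
    ‖M 0 0 * a + M 0 1 * b‖ ^ 2 + ‖M 1 0 * a + M 1 1 * b‖ ^ 2 = ‖a‖ ^ 2 + ‖b‖ ^ 2 := by
  have h := Matrix.mem_unitaryGroup_iff'.1 hM
  have h00 := congrFun (congrFun h 0) 0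
  have h01 := congrFun (congrFun h 0) 1
  have h10 := congrFun (congrFun h 1) 0
  have h11 := congrFun (congrFun h 1) 1
  simp [Matrix.mul_apply, Fin.sum_univ_two, Matrix.star_apply] at h00 h01 h10 h11
  have e : ∀ x : ℂ, ((‖x‖ ^ 2 : ℝ) : ℂ) = conj x * x := fun x => by
    rw [Complex.conj_mul']; push_cast; rfl
  have : ((‖M 0 0 * a + M 0 1 * b‖ ^ 2 + ‖M 1 0 * a + M 1 1 * b‖ ^ 2 : ℝ) : ℂ) =
      ((‖a‖ ^ 2 + ‖b‖ ^ 2 : ℝ) : ℂ) := by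
    rw [Complex.ofReal_add, Complex.ofReal_add, e, e, e, e]
    simp only [map_add, map_mul]
    linear_combination (conj a * a) * h00 + (conj a * b) * h01 + (conj b * a) * h10 + (conj b * b) * h11
  exact_mod_cast this

lemma zero_scale {q y : ℂ → ℂ} {S : Set ℂ} (s : ℂ) (h : SolvesODEOn q S y) :
    SolvesODEOn q S (fun z => s * y z) ∧ (∀ z, deriv (fun z => s * y z) z = s * deriv y z) := by
  have hd : ∀ y : ℂ → ℂ, ∀ z, deriv (fun z => s * y z) z = s * deriv y z := fun y z =>
    deriv_const_mul_field s
  refine ⟨⟨fun z => (MeromorphicAt.const s z).mul (h.1 z), fun z hz => ⟨analyticAt_const.mul (h.2 z hz).1, ?_⟩⟩, hd y⟩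
  rw [show deriv (fun z => s * y z) = fun z => s * deriv y z from funext (hd y), hd, (h.2 z hz).2]
  ring

lemma back_pair {τ : ℂ} (hτ : 0 < τ.im) {m : Fin 4 → ℕ} {T₁ T₂ T₃ E : ℂ}
    (h : HasUnitaryMonodromy (q8 τ m T₁ T₂ T₃ E) (fullSing τ) τ) :
    ∃ Y Z : ℂ → ℂ, (∀ z ∉ singSet τ m, AnalyticAt ℂ Y z ∧ AnalyticAt ℂ Z z ∧
        Y z * deriv Z z - deriv Y z * Z z = 1) ∧
      (∀ z ∉ fullSing τ, ‖Y (z + 1)‖ ^ 2 + ‖Z (z + 1)‖ ^ 2 = ‖Y z‖ ^ 2 + ‖Z z‖ ^ 2) ∧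
      (∀ z ∉ fullSing τ, ‖Y (z + τ)‖ ^ 2 + ‖Z (z + τ)‖ ^ 2 = ‖Y z‖ ^ 2 + ‖Z z‖ ^ 2) ∧
      (∀ (k : Fin 4) (l : ℂ), l ∈ lat τ → ∃ h₁ h₂, AnalyticAt ℂ h₁ (per τ k / 2 + l) ∧
        AnalyticAt ℂ h₂ (per τ k / 2 + l) ∧
        (h₁ (per τ k / 2 + l) ≠ 0 ∨ h₂ (per τ k / 2 + l) ≠ 0) ∧
      (∀ᶠ z in 𝓝[≠] (per τ k / 2 + l), Y z = (z - (per τ k / 2 + l)) ^ (-(m k : ℤ)) * h₁ z) ∧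
      (∀ᶠ z in 𝓝[≠] (per τ k / 2 + l), Z z = (z - (per τ k / 2 + l)) ^ (-(m k : ℤ)) * h₂ z)) := by
  have hFc := half_closed hτ (fullSing_sub τ)
  have hFn := half_countable (fullSing_sub τ)
  have hFi := isolated hτ (fullSing_sub τ)
  obtain ⟨y₁, y₂, s1, s2, hli, M₁, M₂, u1, -, u2, -, a1, a2, b1, b2⟩ := h
  obtain ⟨W₀, hW0, hW⟩ := wronsk hFn hFc s1 s2 hli
  obtain ⟨s, hs⟩ := IsAlgClosed.exists_pow_nat_eq W₀⁻¹ (n := 2) two_pos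
  obtain ⟨o1, d1⟩ := zero_scale s s1
  obtain ⟨o2, d2⟩ := zero_scale s s2
  set Y₀ := fun z => s * y₁ z with hY0
  set Z₀ := fun z => s * y₂ z with hZ0
  have hW1 : ∀ z ∉ fullSing τ, Y₀ z * deriv Z₀ z - deriv Y₀ z * Z₀ z = 1 := by
    intro z hz
    rw [d1, d2, hY0, hZ0]
    have : s ^ 2 * W₀ = 1 := by rw [hs]; exact inv_mul_cancel₀ hW0
    simp only
    linear_combination s ^ 2 * hW z hz + this
  obtain ⟨Y, eY, fY⟩ := ext_fill Y₀
  obtain ⟨Z, eZ, fZ⟩ := ext_fill Z₀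
  have gY : ∀ z ∉ fullSing τ, Y z = Y₀ z := fun z hz => fY z (o1.2 z hz).1
  have gZ : ∀ z ∉ fullSing τ, Z z = Z₀ z := fun z hz => fZ z (o2.2 z hz).1
  have tf : ∀ (k : Fin 4) (l : ℂ), l ∈ lat τ → ∃ h₁ h₂, AnalyticAt ℂ h₁ (per τ k / 2 + l) ∧
        AnalyticAt ℂ h₂ (per τ k / 2 + l) ∧
        (h₁ (per τ k / 2 + l) ≠ 0 ∨ h₂ (per τ k / 2 + l) ≠ 0) ∧
      (∀ᶠ z in 𝓝[≠] (per τ k / 2 + l), Y₀ z = (z - (per τ k / 2 + l)) ^ (-(m k : ℤ)) * h₁ z) ∧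
      (∀ᶠ z in 𝓝[≠] (per τ k / 2 + l), Z₀ z = (z - (per τ k / 2 + l)) ^ (-(m k : ℤ)) * h₂ z) := by
    intro k l hl
    refine two_form (o1.1 _) (o2.1 _) (q8_lim hτ m T₁ T₂ T₃ E k hl) ?_ ?_ ?_
    · filter_upwards [hFi (per τ k / 2 + l)] with z hz using (o1.2 z hz).2
    · filter_upwards [hFi (per τ k / 2 + l)] with z hz using (o2.2 z hz).2
    · filter_upwards [hFi (per τ k / 2 + l)] with z hz using hW1 z hz
  have hext : ∀ z ∉ singSet τ m, ExtAt Y₀ z ∧ ExtAt Z₀ z := by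
    intro z hz
    by_cases hzF : z ∈ fullSing τ
    · obtain ⟨k, l, hl, rfl⟩ := hzF
      have hk : m k = 0 := by
        by_contra hk
        exact hz ⟨k, Nat.one_le_iff_ne_zero.2 hk, l, hl, rfl⟩
      obtain ⟨h₁, h₂, c1, c2, -, e1, e2⟩ := tf k l hl
      simp only [hk, Nat.cast_zero, neg_zero, zpow_zero, one_mul] at e1 e2
      exact ⟨⟨h₁, c1, e1⟩, ⟨h₂, c2, e2⟩⟩
    · exact ⟨.of_an (o1.2 z hzF).1, .of_an (o2.2 z hzF).1⟩
  have hnm : ∀ z t, z ∉ fullSing τ → t ∈ lat τ → z + t ∉ fullSing τ := fun z t hz ht =>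
    (fullSing_shift ht z).not.2 hz
  have hsc : ∀ a b : ℂ, ‖s * a‖ ^ 2 + ‖s * b‖ ^ 2 = ‖s‖ ^ 2 * (‖a‖ ^ 2 + ‖b‖ ^ 2) := fun a b => by
    rw [norm_mul, norm_mul]; ring
  refine ⟨Y, Z, fun z hz => ?_, fun z hz => ?_, fun z hz => ?_, fun k l hl => ?_⟩
  · have hY := eY z (hext z hz).1
    have hZ := eZ z (hext z hz).2
    refine ⟨hY, hZ, ?_⟩
    have t := an_tendsto ((hY.mul hZ.deriv).sub (hY.deriv.mul hZ))
    refine tendsto_nhds_unique t ?_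
    refine (tendsto_const_nhds (x := (1 : ℂ))).congr' ?_
    filter_upwards [hFi z] with x hx
    have hn : ∀ᶠ v in 𝓝 x, v ∉ fullSing τ := hFc.isOpen_compl.mem_nhds hx
    have q1 : Y =ᶠ[𝓝 x] Y₀ := by filter_upwards [hn] with v hv using gY v hv
    have q2 : Z =ᶠ[𝓝 x] Z₀ := by filter_upwards [hn] with v hv using gZ v hv
    simp only [Pi.sub_apply, Pi.mul_apply]
    rw [q1.deriv_eq, q2.deriv_eq, gY x hx, gZ x hx, hW1 x hx]
  · have hz' := hnm z 1 hz (lat_one τ)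
    rw [gY z hz, gZ z hz, gY _ hz', gZ _ hz', hY0, hZ0]
    simp only
    rw [hsc, hsc, a1, a2, unit_norm u1]
  · have hz' := hnm z τ hz (lat_tau τ)
    rw [gY z hz, gZ z hz, gY _ hz', gZ _ hz', hY0, hZ0]
    simp only
    rw [hsc, hsc, b1, b2, unit_norm u2]
  · obtain ⟨h₁, h₂, c1, c2, c3, e1, e2⟩ := tf k l hl
    refine ⟨h₁, h₂, c1, c2, c3, ?_, ?_⟩
    · filter_upwards [e1, hFi (per τ k / 2 + l)] with z h hz
      rw [gY z hz, h]
    · filter_upwards [e2, hFi (per τ k / 2 + l)] with z h hz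
      rw [gZ z hz, h]

theorem backward {τ : ℂ} (hτ : 0 < τ.im) {m : Fin 4 → ℕ} {T₁ T₂ T₃ E : ℂ}
    (h : HasUnitaryMonodromy (q8 τ m T₁ T₂ T₃ E) (fullSing τ) τ) :
    ∃ u : ℂ → ℝ, IsCurvatureSolution τ m u := by
  classical
  obtain ⟨Y, Z, hA, hp1, hp2, hf⟩ := back_pair hτ h
  have hSc := half_closed hτ ((singSet_sub τ m).trans (fullSing_sub τ))
  have hFi := isolated hτ (fullSing_sub τ)
  set w : ℂ → ℝ := fun z => ‖Y z‖ ^ 2 + ‖Z z‖ ^ 2 with hw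
  have hwp : ∀ z ∉ singSet τ m, 0 < w z := by
    intro z hz
    have h1 := (hA z hz).2.2
    by_contra hc
    have e1 : ‖Y z‖ ^ 2 = 0 := le_antisymm (by simp only [hw] at hc; nlinarith [sq_nonneg ‖Y z‖, sq_nonneg ‖Z z‖]) (sq_nonneg _)
    have e2 : ‖Z z‖ ^ 2 = 0 := le_antisymm (by simp only [hw] at hc; nlinarith [sq_nonneg ‖Y z‖, sq_nonneg ‖Z z‖]) (sq_nonneg _)
    have e1' : Y z = 0 := by simpa using e1
    have e2' : Z z = 0 := by simpa using e2
    rw [e1', e2'] at h1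
    simp at h1
  have hn : ∀ z ∉ singSet τ m, ∀ᶠ x in 𝓝 z, x ∉ singSet τ m := fun z hz =>
    hSc.isOpen_compl.mem_nhds hz
  set u : ℂ → ℝ := fun z => if z ∈ singSet τ m then 0 else Real.log 8 - 2 * Real.log (w z) with hu
  have hun : ∀ z ∉ singSet τ m, u z = Real.log 8 - 2 * Real.log (w z) := fun z hz => if_neg hz
  have hpair : ∀ z ∉ singSet τ m, PairAt w Y Z z := by
    intro z hz
    refine ⟨(hA z hz).1, (hA z hz).2.1, ?_⟩
    filter_upwards [hn z hz] with x hx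
    refine ⟨(hA x hx).2.2, ?_⟩
    rw [Complex.mul_conj', Complex.mul_conj']
    simp [hw]
  have hwof : ∀ z ∉ singSet τ m, w z = wof u z := by
    intro z hz
    have h0 := hwp z hz
    unfold wof
    rw [hun z hz, show -(Real.log 8 - 2 * Real.log (w z)) / 2 = Real.log (w z) - Real.log 8 / 2 by ring,
      Real.exp_sub, Real.exp_log h0, ← Real.log_sqrt (by norm_num), Real.exp_log (by positivity)]
    field_simp
  have hws : ∀ z ∉ singSet τ m, ContDiffAt ℝ ∞ w z := by
    intro z hz
    have c1 : ContDiffAt ℝ ∞ Y z := (hA z hz).1.contDiffAt.restrict_scalars ℝ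
    have c2 : ContDiffAt ℝ ∞ Z z := (hA z hz).2.1.contDiffAt.restrict_scalars ℝ
    exact (c1.norm_sq ℝ).add (c2.norm_sq ℝ)
  have hus : ∀ z ∉ singSet τ m, ContDiffAt ℝ ∞ u z := by
    intro z hz
    have : ContDiffAt ℝ ∞ (fun z => Real.log 8 - 2 * Real.log (w z)) z :=
      contDiffAt_const.sub (contDiffAt_const.mul ((hws z hz).log (hwp z hz).ne'))
    refine this.congr_of_eventuallyEq ?_
    filter_upwards [hn z hz] with x hx using hun x hx
  have hwper : ∀ t ∈ lat τ, (∀ z ∉ fullSing τ, w (z + t) = w z) → ∀ z, u (z + t) = u z := by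
    intro t ht hper z
    by_cases hz : z ∈ singSet τ m
    · have hz' := (singSet_shift (m := m) ht z).2 hz
      simp only [hu, if_pos hz, if_pos hz']
    have hz' := (singSet_shift (m := m) ht z).not.2 hz
    rw [hun z hz, hun _ hz']
    have t1 : Tendsto w (𝓝[≠] z) (𝓝 (w z)) :=
      (hws z hz).continuousAt.tendsto.mono_left nhdsWithin_le_nhds
    have t2 : Tendsto (fun x => w (x + t)) (𝓝[≠] z) (𝓝 (w (z + t))) := by
      have : ContinuousAt (fun x => w (x + t)) z :=
        ContinuousAt.comp (f := fun x => x + t) (g := w) (hws _ hz').continuousAt (by fun_prop)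
      exact this.tendsto.mono_left nhdsWithin_le_nhds
    have : w (z + t) = w z := by
      refine tendsto_nhds_unique (t2.congr' ?_) t1
      filter_upwards [hFi z] with x hx using hper x hx
    rw [this]
  refine ⟨u, hwper 1 (lat_one τ) hp1, hwper τ (lat_tau τ) hp2, fun z hz => ⟨fun n => ?_, ?_⟩, ?_⟩
  · exact (hus z hz).of_le (by exact_mod_cast le_top)
  · have hp := (hpair z hz).congr_w (w' := wof u) (by filter_upwards [hn z hz] with x hx using hwof x hx)
    have hk := hp.KK
    rw [KK_wof (by filter_upwards [hn z hz] with x hx using hus x hx)] at hk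
    have hk' : -(lapl u z * Real.exp (-(u z))) = 1 := by exact_mod_cast hk
    rw [Real.exp_neg] at hk'
    have := (Real.exp_pos (u z)).ne'
    field_simp at hk'
    linarith
  · intro k hk l hl
    obtain ⟨h₁, h₂, c1, c2, c3, e1, e2⟩ := hf k l hl
    set p := per τ k / 2 + l with hp
    set B : ℂ → ℝ := fun z => ‖h₁ z‖ ^ 2 + ‖h₂ z‖ ^ 2 with hB
    have hBp : 0 < B p := by
      rcases c3 with c | c
      · have := norm_pos_iff.2 c
        simp only [hB]; positivity
      · have := norm_pos_iff.2 c
        simp only [hB]; positivity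
    have hBc : ContinuousAt B p := (c1.continuousAt.norm.pow 2).add (c2.continuousAt.norm.pow 2)
    have hLc : ContinuousAt (fun z => |Real.log 8 - 2 * Real.log (B z)|) p :=
      (continuousAt_const.sub (continuousAt_const.mul (hBc.log hBp.ne'))).abs
    have hb : ∀ᶠ z in 𝓝[≠] p, |Real.log 8 - 2 * Real.log (B z)| < |Real.log 8 - 2 * Real.log (B p)| + 1 :=
      nhdsWithin_le_nhds (hLc.eventually (gt_mem_nhds (lt_add_one _)))
    have hBpos : ∀ᶠ z in 𝓝[≠] p, 0 < B z := nhdsWithin_le_nhds (hBc.eventually (lt_mem_nhds hBp))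
    have hall : ∀ᶠ z in 𝓝[≠] p, |u z - 4 * (m k : ℝ) * Real.log (dist z p)| ≤
        |Real.log 8 - 2 * Real.log (B p)| + 1 := by
      filter_upwards [e1, e2, hb, hBpos, hFi p, self_mem_nhdsWithin] with z g1 g2 g3 g4 g5 g6
      have hr : 0 < ‖z - p‖ := norm_pos_iff.2 (sub_ne_zero.2 g6)
      have hwz : w z = (‖z - p‖ ^ (-(m k : ℤ))) ^ 2 * B z := by
        simp only [hw, hB]
        rw [g1, g2, norm_mul, norm_mul, norm_zpow]; ring
      rw [hun z (fun h => g5 (singSet_sub τ m h)), hwz, dist_eq_norm,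
        Real.log_mul (by positivity) g4.ne', Real.log_pow, Real.log_zpow]
      push_cast
      refine le_trans (le_of_eq ?_) g3.le
      congr 1; ring
    rw [eventually_nhdsWithin_iff, Metric.eventually_nhds_iff] at hall
    obtain ⟨ε, hε, hh⟩ := hall
    exact ⟨_, ε, hε, fun z hne hd => hh hd hne⟩

/-- **Theorem (Statement 8).** The curvature equation has a solution iff there exist
`T₁, T₂, T₃, E ∈ ℂ` such that `y″ = q·y` (with the potential built from them) is apparent at
every lattice translate of each `ω_k/2` with `m_k ≥ 1` and has unitary monodromy. Moreover,
in that case the solution admits a type II developing map. -/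
theorem statement8 (τ : ℂ) (hτ : 0 < τ.im) (m : Fin 4 → ℕ) (hm : 1 ≤ ∑ k, m k) :
    ((∃ u : ℂ → ℝ, IsCurvatureSolution τ m u) ↔
      ∃ T₁ T₂ T₃ E : ℂ,
        (∀ k : Fin 4, 1 ≤ m k → ∀ l ∈ lat τ,
          ApparentAt (q8 τ m T₁ T₂ T₃ E) (per τ (k : ℕ) / 2 + l)) ∧
        HasUnitaryMonodromy (q8 τ m T₁ T₂ T₃ E) (fullSing τ) τ) ∧
    (∀ u : ℂ → ℝ, IsCurvatureSolution τ m u →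
      ∃ f : ℂ → ℂ, IsDevelopingMapOf u f ∧ IsTypeII τ f) := by
  exact ⟨⟨fun ⟨_, hu⟩ => forward hτ hu, fun ⟨_, _, _, _, _, h⟩ => backward hτ h⟩, fun _ hu => typeII hτ hu⟩
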